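/- For every classical solution of the two-piston system with zero input u ≡ 0, the total momentum R(t) := a'(t) + b'(t) + ∫_{a(t)}^{b(t)} ρ(t,x)v(t,x)dx is constant in time: dR/dt(t) = 0 for all t > 0. -/

import Mathlib

open MeasureTheory Set Filter

/-- A classical solution of the two-piston system (2.1)-(2.5) with boundary input `u`:
piston positions `a < b` (with velocities `a'`, `b'` and accelerations `a''`, `b''`),
gas density `ρ > 0` and velocity `v` on the moving domain `{(t,x) : a(t) ≤ x ≤ b(t)}`,
with the indicated partial derivatives, satisfying mass conservation, the momentum
(Navier–Stokes) equation, the kinematic boundary conditions, and Newton's law for the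
two pistons. -/
structure PistonSol (P μ : ℝ → ℝ) (Pext : ℝ) where
  /-- position of the left piston -/
  a : ℝ → ℝ
  /-- position of the right piston -/
  b : ℝ → ℝ
  a' : ℝ → ℝ
  b' : ℝ → ℝ
  a'' : ℝ → ℝ
  b'' : ℝ → ℝ
  /-- boundary control input -/
  u : ℝ → ℝ
  /-- gas density -/
  ρ : ℝ → ℝ → ℝ
  /-- gas velocity -/
  v : ℝ → ℝ → ℝ
  ρt : ℝ → ℝ → ℝ
  ρx : ℝ → ℝ → ℝ
  vt : ℝ → ℝ → ℝ
  vx : ℝ → ℝ → ℝ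
  u_cont : ContinuousOn u (Ici 0)
  hab : ∀ t, 0 ≤ t → a t < b t
  ha' : ∀ t, 0 ≤ t → HasDerivWithinAt a (a' t) (Ici 0) t
  hb' : ∀ t, 0 ≤ t → HasDerivWithinAt b (b' t) (Ici 0) t
  ha'_cont : ContinuousOn a' (Ici 0)
  hb'_cont : ContinuousOn b' (Ici 0)
  ha'' : ∀ t, 0 < t → HasDerivAt a' (a'' t) t
  hb'' : ∀ t, 0 < t → HasDerivAt b' (b'' t) t
  ρ_pos : ∀ t, 0 ≤ t → ∀ x ∈ Icc (a t) (b t), 0 < ρ t x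
  ρ_cont : ContinuousOn (fun p : ℝ × ℝ => ρ p.1 p.2)
    {p : ℝ × ℝ | 0 ≤ p.1 ∧ p.2 ∈ Icc (a p.1) (b p.1)}
  v_cont : ContinuousOn (fun p : ℝ × ℝ => v p.1 p.2)
    {p : ℝ × ℝ | 0 ≤ p.1 ∧ p.2 ∈ Icc (a p.1) (b p.1)}
  hρt : ∀ t, 0 < t → ∀ x ∈ Icc (a t) (b t), HasDerivAt (fun s => ρ s x) (ρt t x) t
  hρx : ∀ t, 0 ≤ t → ∀ x ∈ Icc (a t) (b t), HasDerivAt (fun y => ρ t y) (ρx t x) x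
  hvt : ∀ t, 0 < t → ∀ x ∈ Icc (a t) (b t), HasDerivAt (fun s => v s x) (vt t x) t
  hvx : ∀ t, 0 < t → ∀ x ∈ Icc (a t) (b t), HasDerivAt (fun y => v t y) (vx t x) x
  ρx_cont : ∀ t, 0 ≤ t → ContinuousOn (ρx t) (Icc (a t) (b t))
  vx_cont : ∀ t, 0 < t → ContinuousOn (vx t) (Icc (a t) (b t))
  /-- mass conservation `ρ_t + (ρ v)_x = 0` on `[a(t), b(t)]` -/
  mass_eq : ∀ t, 0 < t → ∀ x ∈ Icc (a t) (b t),
    ρt t x + (ρx t x * v t x + ρ t x * vx t x) = 0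
  /-- momentum equation `ρ(v_t + v v_x) = (μ(ρ) v_x − P(ρ))_x` on `(a(t), b(t))` -/
  momentum_eq : ∀ t, 0 < t → ∀ x ∈ Ioo (a t) (b t),
    HasDerivAt (fun y => μ (ρ t y) * vx t y - P (ρ t y))
      (ρ t x * (vt t x + v t x * vx t x)) x
  /-- `v(t, a(t)) = a'(t)` -/
  bc_a : ∀ t, 0 ≤ t → v t (a t) = a' t
  /-- `v(t, b(t)) = b'(t)` -/
  bc_b : ∀ t, 0 ≤ t → v t (b t) = b' t
  /-- Newton's law for the right piston -/
  newton_b : ∀ t, 0 < t →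
    b'' t = P (ρ t (b t)) - μ (ρ t (b t)) * vx t (b t) - Pext
  /-- Newton's law for the left (actuated) piston -/
  newton_a : ∀ t, 0 < t →
    a'' t = u t + Pext - P (ρ t (a t)) + μ (ρ t (a t)) * vx t (a t)

open Topology

lemma tm_L1 (K : ℝ → ℝ) (hK : Continuous K) (A B : ℝ)
    (H : ∀ x ∈ Ioo A B, ∀ δ > 0, ∀ᶠ η in 𝓝[>] (0:ℝ),
      -δ * η ^ 2 ≤ K (x + η) + K (x - η) - 2 * K x)
    (x r : ℝ) (hr : 0 < r) (h1 : A ≤ x - r) (h2 : x + r ≤ B) :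
    0 ≤ K (x + r) + K (x - r) - 2 * K x := by
  by_contra hneg
  push Not at hneg
  obtain ⟨δ, hδ, hδ2⟩ : ∃ δ > 0, 2 * δ * r ^ 2 < -(K (x + r) + K (x - r) - 2 * K x) := by
    refine ⟨-(K (x + r) + K (x - r) - 2 * K x) / (4 * r ^ 2), by
      apply div_pos (by linarith) (by positivity), ?_⟩
    have : 2 * (-(K (x + r) + K (x - r) - 2 * K x) / (4 * r ^ 2)) * r ^ 2
      = -(K (x + r) + K (x - r) - 2 * K x) / 2 := by field_simp; ring
    rw [this]; linarith
  set G : ℝ → ℝ := fun y => K y - ((K (x + r) - K (x - r)) / (2 * r) * (y - x)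
     + (K (x + r) + K (x - r)) / 2) + δ * ((y - x) ^ 2 - r ^ 2) with hG
  have hGc : Continuous G := by rw [hG]; fun_prop
  obtain ⟨y, hy, hmax⟩ := (isCompact_Icc (a := x - r) (b := x + r)).exists_isMaxOn
    ⟨x, by constructor <;> linarith⟩ hGc.continuousOn
  have hGx : 0 < G x := by
    simp only [hG, sub_self]; nlinarith
  have hyx : G x ≤ G y := hmax (show x ∈ Icc (x-r) (x+r) by constructor <;> linarith)
  have hGl : G (x - r) = 0 := by simp only [hG]; field_simp; ring
  have hGr : G (x + r) = 0 := by simp only [hG]; field_simp; ring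
  have hy1 : x - r < y := by
    rcases hy.1.lt_or_eq with h | h
    · exact h
    · rw [← h, hGl] at hyx; linarith
  have hy2 : y < x + r := by
    rcases hy.2.lt_or_eq with h | h
    · exact h
    · rw [h, hGr] at hyx; linarith
  have e1 := H y ⟨by linarith, by linarith⟩ δ hδ
  have e2 : ∀ᶠ η in 𝓝[>] (0:ℝ), η < min (x + r - y) (y - (x - r)) :=
    eventually_nhdsWithin_of_eventually_nhds
      (eventually_lt_nhds (lt_min (by linarith) (by linarith)))
  obtain ⟨η, ⟨h3, h4⟩, h5⟩ := ((e1.and e2).and self_mem_nhdsWithin).exists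
  have h5 : 0 < η := h5
  have h6 := lt_min_iff.1 h4
  have m1 : G (y + η) ≤ G y := hmax ⟨by linarith, by linarith⟩
  have m2 : G (y - η) ≤ G y := hmax ⟨by linarith, by linarith⟩
  simp only [hG] at m1 m2
  have : 0 < δ * η ^ 2 := by positivity
  nlinarith

lemma tm_L2 (h H1 H : ℝ → ℝ) (hh : Continuous h) (d1 : ∀ x, HasDerivAt H1 (h x) x)
    (d2 : ∀ x, HasDerivAt H (H1 x) x) (x r : ℝ) :
    r ^ 2 * ∫ σ in (-1:ℝ)..1, (1 - |σ|) * h (x + r * σ) = H (x + r) + H (x - r) - 2 * H x := by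
  have hl : ∀ σ : ℝ, HasDerivAt (fun σ => x + r * σ) r σ := fun σ => by
    simpa using ((hasDerivAt_id σ).const_mul r).const_add x
  have i1 : ∫ σ in (0:ℝ)..1, r ^ 2 * ((1 - |σ|) * h (x + r * σ))
      = H (x + r) - H x - r * H1 x := by
    have : ∀ σ ∈ uIcc (0:ℝ) 1, HasDerivAt (fun σ => (1 - σ) * (r * H1 (x + r * σ)) + H (x + r * σ))
        (r ^ 2 * ((1 - |σ|) * h (x + r * σ))) σ := by
      intro σ hσ
      rw [uIcc_of_le zero_le_one] at hσ
      rw [abs_of_nonneg hσ.1]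
      have a1 := (((hasDerivAt_id σ).const_sub 1).mul
        (((d1 _).comp σ (hl σ)).const_mul r)).add ((d2 _).comp σ (hl σ))
      refine a1.congr_deriv ?_
      simp; ring
    rw [intervalIntegral.integral_eq_sub_of_hasDerivAt this (by
      apply Continuous.intervalIntegrable; fun_prop)]
    simp; ring
  have i2 : ∫ σ in (-1:ℝ)..0, r ^ 2 * ((1 - |σ|) * h (x + r * σ))
      = H (x - r) - H x + r * H1 x := by
    have : ∀ σ ∈ uIcc (-1:ℝ) 0, HasDerivAt (fun σ => (1 + σ) * (r * H1 (x + r * σ)) - H (x + r * σ))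
        (r ^ 2 * ((1 - |σ|) * h (x + r * σ))) σ := by
      intro σ hσ
      rw [uIcc_of_le (by norm_num)] at hσ
      rw [abs_of_nonpos hσ.2]
      have a1 := (((hasDerivAt_id σ).const_add 1).mul
        (((d1 _).comp σ (hl σ)).const_mul r)).sub ((d2 _).comp σ (hl σ))
      refine a1.congr_deriv ?_
      simp; ring
    rw [intervalIntegral.integral_eq_sub_of_hasDerivAt this (by
      apply Continuous.intervalIntegrable; fun_prop)]
    simp [sub_eq_add_neg]; ring
  rw [← intervalIntegral.integral_const_mul, ← intervalIntegral.integral_add_adjacent_intervals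
    (b := 0) (by apply Continuous.intervalIntegrable; fun_prop)
      (by apply Continuous.intervalIntegrable; fun_prop), i1, i2]
  ring

lemma tm_L12 (u h : ℝ → ℝ) (hu : Continuous u) (hh : Continuous h) (A B : ℝ)
    (H : ∀ x ∈ Ioo A B, ∀ δ > 0, ∀ᶠ η in 𝓝[>] (0:ℝ),
      (h x - δ) * η ^ 2 ≤ u (x + η) + u (x - η) - 2 * u x)
    (x r : ℝ) (hr : 0 < r) (h1 : A ≤ x - r) (h2 : x + r ≤ B) :
    r ^ 2 * ∫ σ in (-1:ℝ)..1, (1 - |σ|) * h (x + r * σ) ≤ u (x + r) + u (x - r) - 2 * u x := by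
  set H1 : ℝ → ℝ := fun z => ∫ y in (0:ℝ)..z, h y with hH1
  have d1 : ∀ x, HasDerivAt H1 (h x) x := fun x =>
    intervalIntegral.integral_hasDerivAt_right (hh.intervalIntegrable _ _)
      hh.aestronglyMeasurable.stronglyMeasurableAtFilter hh.continuousAt
  have c1 : Continuous H1 := continuous_iff_continuousAt.2 fun x => (d1 x).continuousAt
  set HH : ℝ → ℝ := fun z => ∫ y in (0:ℝ)..z, H1 y with hHH
  have d2 : ∀ x, HasDerivAt HH (H1 x) x := fun x =>
    intervalIntegral.integral_hasDerivAt_right (c1.intervalIntegrable _ _)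
      c1.aestronglyMeasurable.stronglyMeasurableAtFilter c1.continuousAt
  have c2 : Continuous HH := continuous_iff_continuousAt.2 fun x => (d2 x).continuousAt
  have key := tm_L1 (fun x => u x - HH x) (hu.sub c2) A B ?_ x r hr h1 h2
  · rw [tm_L2 h H1 HH hh d1 d2]; linarith
  intro x hx δ hδ
  have e1 := H x hx (δ/2) (by linarith)
  obtain ⟨τ, hτ, hτ2⟩ := Metric.continuousAt_iff.1 (hh.continuousAt (x := x)) (δ/2) (by linarith)
  have e2 : ∀ᶠ η in 𝓝[>] (0:ℝ), η < τ :=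
    eventually_nhdsWithin_of_eventually_nhds (eventually_lt_nhds hτ)
  filter_upwards [e1, e2, self_mem_nhdsWithin] with η h3 h4 h5
  have h5 : 0 < η := h5
  have hL := tm_L2 h H1 HH hh d1 d2 x η
  have hint : ∫ σ in (-1:ℝ)..1, (1 - |σ|) * h (x + η * σ) ≤
      ∫ σ in (-1:ℝ)..1, (1 - |σ|) * (h x + δ/2) := by
    apply intervalIntegral.integral_mono_on (by norm_num)
      (by apply Continuous.intervalIntegrable; fun_prop)
      (by apply Continuous.intervalIntegrable; fun_prop)
    intro σ hσ
    have hσ' : |σ| ≤ 1 := abs_le.2 hσ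
    apply mul_le_mul_of_nonneg_left _ (by linarith)
    have : dist (x + η * σ) x < τ := by
      rw [Real.dist_eq]; simp only [add_sub_cancel_left, abs_mul, abs_of_pos h5]
      nlinarith [abs_nonneg σ]
    have := hτ2 this
    rw [Real.dist_eq] at this
    linarith [(abs_lt.1 this).2]
  have h1' : ∫ σ in (-1:ℝ)..1, (1 - |σ|) * (h x + δ/2) = h x + δ/2 := by
    have := tm_L2 (fun _ => h x + δ/2) (fun y => (h x + δ/2) * y) (fun y => (h x + δ/2) * y^2/2)
      continuous_const (fun y => by simpa using (hasDerivAt_id y).const_mul (h x + δ/2))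
      (fun y => by
        refine (((hasDerivAt_id y).pow 2).const_mul (h x + δ/2) |>.div_const 2).congr_deriv ?_
        simp; ring) 0 1
    simp only [one_pow, one_mul] at this
    rw [this]; ring
  rw [h1'] at hint
  have : 0 ≤ η ^ 2 := by positivity
  nlinarith

noncomputable def tm_sc (w : ℝ → ℝ → ℝ) (T0 T1 ε t x : ℝ) : ℝ :=
  sSup ((fun s => w s x - (t - s) ^ 2 / ε) '' Icc T0 T1)

lemma tm_sc_cont (w : ℝ → ℝ → ℝ) (hw : Continuous (fun p : ℝ × ℝ => w p.1 p.2)) (T0 T1 ε : ℝ) :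
    Continuous (fun p : ℝ × ℝ => tm_sc w T0 T1 ε p.1 p.2) := by
  have := IsCompact.continuous_sSup (K := Icc T0 T1) isCompact_Icc
    (f := fun (p : ℝ × ℝ) s => w s p.2 - (p.1 - s) ^ 2 / ε) (by
      have h1 : Continuous (fun q : (ℝ × ℝ) × ℝ => w q.2 q.1.2) :=
        hw.comp (continuous_snd.prodMk (continuous_snd.comp continuous_fst))
      change Continuous (fun q : (ℝ × ℝ) × ℝ => w q.2 q.1.2 - (q.1.1 - q.2) ^ 2 / ε)
      fun_prop)
  exact this

lemma tm_sc_le (w : ℝ → ℝ → ℝ) (hw : Continuous (fun p : ℝ × ℝ => w p.1 p.2)) (T0 T1 ε t x s : ℝ)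
    (hs : s ∈ Icc T0 T1) : w s x - (t - s) ^ 2 / ε ≤ tm_sc w T0 T1 ε t x := by
  have hc : Continuous (fun s => w s x) := hw.comp (continuous_id.prodMk continuous_const)
  have : Continuous (fun s => w s x - (t - s) ^ 2 / ε) := by fun_prop
  exact le_csSup (isCompact_Icc.image this).bddAbove ⟨s, hs, rfl⟩

lemma tm_sc_att (w : ℝ → ℝ → ℝ) (hw : Continuous (fun p : ℝ × ℝ => w p.1 p.2)) (T0 T1 ε t x : ℝ)
    (hT : T0 ≤ T1) : ∃ s ∈ Icc T0 T1, tm_sc w T0 T1 ε t x = w s x - (t - s) ^ 2 / ε := by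
  have hc : Continuous (fun s => w s x) := hw.comp (continuous_id.prodMk continuous_const)
  have : Continuous (fun s => w s x - (t - s) ^ 2 / ε) := by fun_prop
  obtain ⟨s, hs, he⟩ := (isCompact_Icc (a := T0) (b := T1)).exists_sSup_image_eq
    ⟨T0, left_mem_Icc.2 hT⟩ this.continuousOn
  exact ⟨s, hs, he⟩

lemma tm_sup (w c S : ℝ → ℝ → ℝ) (hw : Continuous (fun p : ℝ × ℝ => w p.1 p.2))
    (hS : Continuous (fun p : ℝ × ℝ => S p.1 p.2)) (hc0 : ∀ t x, 0 ≤ c t x)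
    (T0 T1 X0 X1 s0 t1 Lc : ℝ) (hs0 : T0 < s0) (hst : s0 ≤ t1) (ht1 : t1 < T1)
    (hL0 : 0 ≤ Lc)
    (hL : ∀ t ∈ Icc T0 T1, ∀ t' ∈ Icc T0 T1, ∀ x ∈ Icc X0 X1, |c t x - c t' x| ≤ Lc * |t - t'|)
    (H : ∀ s ∈ Ioo T0 T1, ∀ x ∈ Ioo X0 X1, ∀ p,
      (∃ C, ∀ᶠ d in 𝓝[>] (0:ℝ), p * d - C * d ^ 2 ≤ w s x - w (s - d) x) →
      ∀ δ > 0, ∀ᶠ η in 𝓝[>] (0:ℝ),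
        (c s x * p - S s x - δ) * η ^ 2 ≤ w s (x + η) + w s (x - η) - 2 * w s x)
    (γ : ℝ) (hγ : 0 < γ) :
    ∃ ε0 > 0, ∀ ε, 0 < ε → ε < ε0 →
      (∀ t ∈ Icc s0 t1, ∀ x ∈ Icc X0 X1, |tm_sc w T0 T1 ε t x - w t x| ≤ γ) ∧
      ∀ t ∈ Icc s0 t1, ∀ x ∈ Ioo X0 X1, ∀ k > 0, ∀ δ > 0, ∀ᶠ η in 𝓝[>] (0:ℝ),
        (c t x * ((tm_sc w T0 T1 ε t x - tm_sc w T0 T1 ε (t - k) x) / k - k / ε)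
          - S t x - γ - δ) * η ^ 2 ≤
        tm_sc w T0 T1 ε t (x + η) + tm_sc w T0 T1 ε t (x - η) - 2 * tm_sc w T0 T1 ε t x := by
  set Q : Set (ℝ × ℝ) := Icc T0 T1 ×ˢ Icc X0 X1 with hQ
  have hQc : IsCompact Q := isCompact_Icc.prod isCompact_Icc
  set g := γ / (2 * Lc + 1) with hg
  have hg0 : 0 < g := by positivity
  have hg1 : 2 * Lc * g + g = γ := by rw [hg]; field_simp
  have hgγ : g ≤ γ := by nlinarith [mul_nonneg hL0 hg0.le]
  obtain ⟨M, hM⟩ := hQc.exists_bound_of_continuousOn hw.continuousOn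
  have uw := hQc.uniformContinuousOn_of_continuous hw.continuousOn
  have uS := hQc.uniformContinuousOn_of_continuous hS.continuousOn
  obtain ⟨τ1, hτ1, hw1⟩ := Metric.uniformContinuousOn_iff.1 uw g hg0
  obtain ⟨τ2, hτ2, hS1⟩ := Metric.uniformContinuousOn_iff.1 uS g hg0
  set τ := min (min τ1 τ2) (min (s0 - T0) (T1 - t1)) with hτ
  have hτ0 : 0 < τ := lt_min (lt_min hτ1 hτ2) (lt_min (by linarith) (by linarith))
  have hτa : τ ≤ τ1 := (min_le_left _ _).trans (min_le_left _ _)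
  have hτb : τ ≤ τ2 := (min_le_left _ _).trans (min_le_right _ _)
  have hτc : τ ≤ s0 - T0 := (min_le_right _ _).trans (min_le_left _ _)
  have hτd : τ ≤ T1 - t1 := (min_le_right _ _).trans (min_le_right _ _)
  refine ⟨τ ^ 2 / (2 * |M| + 1), by positivity, ?_⟩
  intro ε hε hε0
  rw [lt_div_iff₀ (by positivity)] at hε0
  have hT : T0 ≤ T1 := by linarith
  have main : ∀ t ∈ Icc s0 t1, ∀ x ∈ Icc X0 X1, ∃ s ∈ Ioo T0 T1,
      tm_sc w T0 T1 ε t x = w s x - (t - s) ^ 2 / ε ∧ (t - s) ^ 2 / ε ≤ g ∧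
      |w s x - w t x| ≤ g ∧ |S s x - S t x| ≤ g := by
    intro t ht x hx
    have htT : t ∈ Icc T0 T1 := ⟨by linarith [ht.1], by linarith [ht.2]⟩
    obtain ⟨s, hs, he⟩ := tm_sc_att w hw T0 T1 ε t x hT
    have hle := tm_sc_le w hw T0 T1 ε t x t htT
    rw [he] at hle
    simp only [sub_self, ne_eq, OfNat.ofNat_ne_zero, not_false_eq_true, zero_pow, zero_div,
      sub_zero] at hle
    have b1 := hM (s, x) ⟨hs, hx⟩
    have b2 := hM (t, x) ⟨htT, hx⟩
    simp only [Real.norm_eq_abs] at b1 b2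
    have b1' := abs_le.1 b1
    have b2' := abs_le.1 b2
    have hq : (t - s) ^ 2 / ε ≤ 2 * |M| := by
      have := le_abs_self M; linarith [b1'.2, b2'.1]
    have hsq : (t - s) ^ 2 < τ ^ 2 := by
      rw [div_le_iff₀ hε] at hq
      nlinarith
    have habs : |t - s| < τ := abs_lt_of_sq_lt_sq hsq hτ0.le
    have habs' := abs_lt.1 habs
    have hd : dist (s, x) (t, x) < τ := by
      rw [Prod.dist_eq, Real.dist_eq, dist_self, abs_sub_comm]
      simp [habs]
    have w1 := hw1 (s, x) ⟨hs, hx⟩ (t, x) ⟨htT, hx⟩ (hd.trans_le hτa)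
    have S1 := hS1 (s, x) ⟨hs, hx⟩ (t, x) ⟨htT, hx⟩ (hd.trans_le hτb)
    rw [Real.dist_eq] at w1 S1
    refine ⟨s, ⟨by linarith [ht.1], by linarith [ht.2]⟩, he, ?_, w1.le, S1.le⟩
    have := (abs_lt.1 w1).2
    simp only at this
    linarith
  refine ⟨?_, ?_⟩
  · intro t ht x hx
    obtain ⟨s, hs, he, h1, h2, -⟩ := main t ht x hx
    have htT : t ∈ Icc T0 T1 := ⟨by linarith [ht.1], by linarith [ht.2]⟩
    have hle := tm_sc_le w hw T0 T1 ε t x t htT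
    simp only [sub_self, ne_eq, OfNat.ofNat_ne_zero, not_false_eq_true, zero_pow, zero_div,
      sub_zero] at hle
    rw [abs_of_nonneg (by linarith)]
    have := (abs_le.1 h2).2
    have : 0 ≤ (t - s) ^ 2 / ε := by positivity
    linarith
  · intro t ht x hx k hk δ hδ
    obtain ⟨s, hs, he, h1, h2, h3⟩ := main t ht x (Ioo_subset_Icc_self hx)
    have htT : t ∈ Icc T0 T1 := ⟨by linarith [ht.1], by linarith [ht.2]⟩
    have hsI := Ioo_subset_Icc_self hs
    set p := 2 * (s - t) / ε with hp
    have hH := H s hs x hx p ⟨1 / ε, by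
      have : ∀ᶠ d in 𝓝[>] (0:ℝ), d < s - T0 :=
        eventually_nhdsWithin_of_eventually_nhds (eventually_lt_nhds (by linarith [hs.1]))
      filter_upwards [this, self_mem_nhdsWithin] with d hd hd0
      have hd0 : 0 < d := hd0
      have hle := tm_sc_le w hw T0 T1 ε t x (s - d) ⟨by linarith, by linarith [hs.2]⟩
      rw [he] at hle
      have : p * d - 1 / ε * d ^ 2 = (t - s) ^ 2 / ε - (t - (s - d)) ^ 2 / ε := by
        rw [hp]; field_simp; ring
      rw [this]; linarith⟩ δ hδ
    filter_upwards [hH, self_mem_nhdsWithin] with η h5 h6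
    have l1 := tm_sc_le w hw T0 T1 ε t (x + η) s hsI
    have l2 := tm_sc_le w hw T0 T1 ε t (x - η) s hsI
    have l3 := tm_sc_le w hw T0 T1 ε (t - k) x s hsI
    have hq : (tm_sc w T0 T1 ε t x - tm_sc w T0 T1 ε (t - k) x) / k - k / ε ≤ p := by
      have : (t - k - s) ^ 2 / ε - (t - s) ^ 2 / ε = k * (p + k / ε) := by
        rw [hp]; field_simp; ring
      have : (tm_sc w T0 T1 ε t x - tm_sc w T0 T1 ε (t - k) x) / k ≤ p + k / ε := by
        rw [div_le_iff₀ hk, he]; linarith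
      linarith
    have hcp : c t x * ((tm_sc w T0 T1 ε t x - tm_sc w T0 T1 ε (t - k) x) / k - k / ε) ≤
        c s x * p + 2 * Lc * g := by
      have a1 := mul_le_mul_of_nonneg_left hq (hc0 t x)
      have a2 : (c t x - c s x) * p ≤ 2 * Lc * g := by
        have b := hL t htT s hsI x (Ioo_subset_Icc_self hx)
        have : |(c t x - c s x) * p| ≤ Lc * |t - s| * |p| := by
          rw [abs_mul]; exact mul_le_mul_of_nonneg_right b (abs_nonneg _)
        have hp' : Lc * |t - s| * |p| = 2 * Lc * ((t - s) ^ 2 / ε) := by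
          rw [hp, abs_div, abs_mul, abs_sub_comm s t, abs_of_pos hε, ← sq_abs (t - s)]
          rw [abs_of_pos (zero_lt_two' ℝ)]; ring
        have := (le_abs_self _).trans this
        rw [hp'] at this
        nlinarith
      linarith
    have hS3 := (abs_le.1 h3).2
    have : c t x * ((tm_sc w T0 T1 ε t x - tm_sc w T0 T1 ε (t - k) x) / k - k / ε)
          - S t x - γ - δ ≤ c s x * p - S s x - δ := by linarith
    have := mul_le_mul_of_nonneg_right this (sq_nonneg η)
    linarith [he]

lemma tm_avg (F : ℕ → ℝ → ℝ) (G : ℝ → ℝ) (k : ℕ → ℝ) (hk : ∀ n, 0 < k n)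
    (hk0 : Tendsto k atTop (𝓝 0)) (s0 t : ℝ) (hs : s0 < t)
    (hF : ∀ n, Continuous (F n)) (hG : Continuous G)
    (hu : ∀ γ > 0, ∀ᶠ n in atTop, ∀ τ ∈ Icc s0 t, |F n τ - G τ| ≤ γ) :
    Tendsto (fun n => (∫ τ in (t - k n)..t, F n τ) / k n) atTop (𝓝 (G t)) := by
  rw [Metric.tendsto_nhds]
  intro ε hε
  obtain ⟨d, hd, hd2⟩ := Metric.continuousAt_iff.1 (hG.continuousAt (x := t)) (ε/4) (by linarith)
  have e1 : ∀ᶠ n in atTop, k n < min d (t - s0) :=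
    hk0.eventually (eventually_lt_nhds (lt_min hd (by linarith)))
  filter_upwards [e1, hu (ε/4) (by linarith)] with n h1 h2
  have h3 := lt_min_iff.1 h1
  have hkn := hk n
  have : ‖∫ τ in (t - k n)..t, (F n τ - G t)‖ ≤ (ε/2) * |t - (t - k n)| := by
    apply intervalIntegral.norm_integral_le_of_norm_le_const
    intro τ hτ
    rw [uIoc_of_le (by linarith)] at hτ
    have a1 := h2 τ ⟨by linarith [hτ.1], hτ.2⟩
    have a2 := hd2 (show dist τ t < d by
      rw [Real.dist_eq, abs_lt]; constructor <;> linarith [hτ.1, hτ.2])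
    rw [Real.dist_eq] at a2
    rw [Real.norm_eq_abs, show F n τ - G t = (F n τ - G τ) + (G τ - G t) by ring]
    linarith [abs_add_le (F n τ - G τ) (G τ - G t)]
  rw [intervalIntegral.integral_sub ((hF n).intervalIntegrable _ _)
    (intervalIntegrable_const), intervalIntegral.integral_const] at this
  simp only [sub_sub_cancel, smul_eq_mul, Real.norm_eq_abs, abs_of_pos hkn] at this
  rw [Real.dist_eq, show (∫ τ in (t - k n)..t, F n τ) / k n - G t =
    ((∫ τ in (t - k n)..t, F n τ) - k n * G t) / k n by field_simp, abs_div, abs_of_pos hkn,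
    div_lt_iff₀ hkn]
  nlinarith

lemma tm_time (K : Set (ℝ × ℝ)) (hK : IsCompact K) (Θ Θt W : ℝ → ℝ × ℝ → ℝ)
    (U : ℕ → ℝ → ℝ × ℝ → ℝ) (k : ℕ → ℝ) (hk : ∀ n, 0 < k n)
    (hk0 : Tendsto k atTop (𝓝 0)) (s0 s t L : ℝ) (hs0 : s0 < s) (hst : s ≤ t)
    (hΘ : Continuous (Function.uncurry Θ)) (hW : Continuous (Function.uncurry W))
    (hU : ∀ n, Continuous (Function.uncurry (U n)))
    (hUW : ∀ γ > 0, ∀ᶠ n in atTop, ∀ τ ∈ Icc s0 t, ∀ ω ∈ K, |U n τ ω - W τ ω| ≤ γ)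
    (hd : ∀ τ ∈ Icc s t, ∀ ω ∈ K, HasDerivAt (fun τ => Θ τ ω) (Θt τ ω) τ)
    (hL0 : 0 ≤ L)
    (hL : ∀ τ ∈ Icc s0 t, ∀ τ' ∈ Icc s0 t, ∀ ω ∈ K, |Θ τ ω - Θ τ' ω| ≤ L * |τ - τ'|) :
    Tendsto (fun n => ∫ τ in s..t, ∫ ω in K, Θ τ ω * ((U n τ ω - U n (τ - k n) ω) / k n)) atTop
      (𝓝 ((∫ ω in K, Θ t ω * W t ω) - (∫ ω in K, Θ s ω * W s ω)
        - ∫ τ in s..t, ∫ ω in K, W τ ω * Θt τ ω)) := by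
  have hKm := hK.measurableSet
  set F : ℕ → ℝ → ℝ := fun n τ => ∫ ω in K, Θ τ ω * U n τ ω with hF
  set G : ℝ → ℝ := fun τ => ∫ ω in K, Θ τ ω * W τ ω with hG
  have hFc : ∀ n, Continuous (F n) := fun n =>
    continuous_parametric_integral_of_continuous (f := fun τ ω => Θ τ ω * U n τ ω)
      (hΘ.mul (hU n)) hK
  have hGc : Continuous G :=
    continuous_parametric_integral_of_continuous (f := fun τ ω => Θ τ ω * W τ ω)
      (hΘ.mul hW) hK
  obtain ⟨BΘ, hBΘ⟩ := ((isCompact_Icc (a := s0) (b := t)).prod hK).exists_bound_of_continuousOn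
    hΘ.continuousOn
  obtain ⟨BW, hBW⟩ := ((isCompact_Icc (a := s0) (b := t)).prod hK).exists_bound_of_continuousOn
    hW.continuousOn
  have hKfin : volume K < ⊤ := hK.measure_lt_top
  have cΘ : ∀ τ, Continuous (Θ τ) := fun τ => hΘ.comp (Continuous.prodMk_right τ)
  have cW : ∀ τ, Continuous (W τ) := fun τ => hW.comp (Continuous.prodMk_right τ)
  have cU : ∀ n τ, Continuous (U n τ) := fun n τ => (hU n).comp (Continuous.prodMk_right τ)
  have intK : ∀ f : ℝ × ℝ → ℝ, Continuous f → Integrable f (volume.restrict K) := fun f hf =>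
    hf.continuousOn.integrableOn_compact hK
  have hFG : ∀ γ > 0, ∀ᶠ n in atTop, ∀ τ ∈ Icc s0 t, |F n τ - G τ| ≤ γ := by
    intro γ hγ
    set V := (volume K).toReal with hV
    have hV0 : 0 ≤ V := ENNReal.toReal_nonneg
    filter_upwards [hUW (γ / ((|BΘ| + 1) * (V + 1))) (by positivity)] with n hn τ hτ
    have : F n τ - G τ = ∫ ω in K, Θ τ ω * (U n τ ω - W τ ω) := by
      simp only [hF, hG]
      rw [← integral_sub (intK (fun ω => Θ τ ω * U n τ ω) ((cΘ τ).mul (cU n τ)))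
        (intK (fun ω => Θ τ ω * W τ ω) ((cΘ τ).mul (cW τ)))]
      congr 1; ext ω; ring
    rw [this]
    have := norm_setIntegral_le_of_norm_le_const (μ := volume) (s := K)
      (f := fun ω => Θ τ ω * (U n τ ω - W τ ω))
      (C := (|BΘ| + 1) * (γ / ((|BΘ| + 1) * (V + 1)))) hKfin (by
        intro ω hω
        rw [norm_mul]
        apply mul_le_mul _ (hn τ hτ ω hω) (abs_nonneg _) (by positivity)
        have := hBΘ (τ, ω) ⟨hτ, hω⟩
        simp only [Function.uncurry] at this
        linarith [le_abs_self BΘ])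
    rw [Real.norm_eq_abs] at this
    refine this.trans ?_
    have e : (|BΘ| + 1) * (γ / ((|BΘ| + 1) * (V + 1))) = γ / (V + 1) := by field_simp
    rw [e, measureReal_def, ← hV, div_mul_eq_mul_div, div_le_iff₀ (by positivity)]
    nlinarith
  have T1 := tm_avg F G k hk hk0 s0 t (by linarith) hFc hGc hFG
  have T2 := tm_avg F G k hk hk0 s0 s hs0 hFc hGc (by
    intro γ hγ
    filter_upwards [hFG γ hγ] with n hn τ hτ
    exact hn τ ⟨hτ.1, hτ.2.trans hst⟩)
  have T3 : Tendsto (fun n => ∫ τ in s..t, ∫ ω in K,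
      U n (τ - k n) ω * ((Θ τ ω - Θ (τ - k n) ω) / k n)) atTop
      (𝓝 (∫ τ in s..t, ∫ ω in K, W τ ω * Θt τ ω)) := by
    have ev1 : ∀ᶠ n in atTop, k n < s - s0 := hk0.eventually (eventually_lt_nhds (by linarith))
    have ev2 := hUW 1 one_pos
    have bd : ∀ᶠ n in atTop, ∀ τ ∈ Icc s t, ∀ ω ∈ K,
        ‖U n (τ - k n) ω * ((Θ τ ω - Θ (τ - k n) ω) / k n)‖ ≤ (|BW| + 1) * L := by
      filter_upwards [ev1, ev2] with n h1 h2 τ hτ ω hω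
      have hkn := hk n
      have m : τ - k n ∈ Icc s0 t := ⟨by linarith [hτ.1], by linarith [hτ.2]⟩
      rw [norm_mul]
      apply mul_le_mul _ _ (norm_nonneg _) (by positivity)
      · have a1 := h2 _ m ω hω
        have a2 := hBW (τ - k n, ω) ⟨m, hω⟩
        simp only [Function.uncurry, Real.norm_eq_abs] at a2 ⊢
        have : |U n (τ - k n) ω| ≤ |U n (τ - k n) ω - W (τ - k n) ω| + |W (τ - k n) ω| := by
          have := abs_add_le (U n (τ - k n) ω - W (τ - k n) ω) (W (τ - k n) ω)
          simpa using this
        linarith [le_abs_self BW]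
      · have a1 := hL τ ⟨by linarith [hτ.1], hτ.2⟩ _ m ω hω
        rw [Real.norm_eq_abs, abs_div, abs_of_pos hkn, div_le_iff₀ hkn]
        simpa [abs_of_pos hkn] using a1
    have hsub : ∀ n, Continuous (fun p : ℝ × (ℝ × ℝ) => (p.1 - k n, p.2)) := fun n => by fun_prop
    have cInt : ∀ n, Continuous (Function.uncurry (fun (τ : ℝ) (ω : ℝ × ℝ) =>
        U n (τ - k n) ω * ((Θ τ ω - Θ (τ - k n) ω) / k n))) := fun n => by
      exact ((hU n).comp (hsub n)).mul ((hΘ.sub (hΘ.comp (hsub n))).div_const _)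
    apply intervalIntegral.tendsto_integral_filter_of_dominated_convergence
      (fun _ => (|BW| + 1) * L * (volume K).toReal)
    · refine Eventually.of_forall fun n => ?_
      exact (continuous_parametric_integral_of_continuous (cInt n) hK).aestronglyMeasurable
    · filter_upwards [bd] with n hn
      refine Eventually.of_forall fun τ hτ => ?_
      rw [uIoc_of_le hst] at hτ
      exact norm_setIntegral_le_of_norm_le_const hKfin (hn τ (Ioc_subset_Icc_self hτ))
    · exact intervalIntegrable_const
    · refine Eventually.of_forall fun τ hτ => ?_
      rw [uIoc_of_le hst] at hτ
      have hτ' := Ioc_subset_Icc_self hτ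
      apply tendsto_integral_filter_of_dominated_convergence (fun _ => (|BW| + 1) * L)
      · refine Eventually.of_forall fun n => ?_
        exact ((cInt n).comp (Continuous.prodMk_right τ)).aestronglyMeasurable
      · filter_upwards [bd] with n hn
        exact (ae_restrict_iff' hKm).2 (Eventually.of_forall fun ω hω => hn τ hτ' ω hω)
      · exact integrableOn_const hKfin.ne
      · refine (ae_restrict_iff' hKm).2 (Eventually.of_forall fun ω hω => ?_)
        have t0 : Tendsto (fun n => τ - k n) atTop (𝓝 τ) := by
          simpa using hk0.const_sub τ
        apply Tendsto.mul
        · have w1 : Tendsto (fun n => W (τ - k n) ω) atTop (𝓝 (W τ ω)) :=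
            ((hW.comp (Continuous.prodMk_left ω)).tendsto τ).comp t0
          have w2 : Tendsto (fun n => U n (τ - k n) ω - W (τ - k n) ω) atTop (𝓝 0) := by
            rw [Metric.tendsto_nhds]
            intro ε hε
            filter_upwards [ev1, hUW (ε/2) (by linarith)] with n h1 h2
            have hkn := hk n
            have := h2 (τ - k n) ⟨by linarith [hτ.1], by linarith [hτ.2]⟩ ω hω
            rw [Real.dist_eq, sub_zero]; linarith
          simpa using w2.add w1
        · have := (hd τ hτ' ω hω).tendsto_slope
          have t1 : Tendsto (fun n => τ - k n) atTop (𝓝[≠] τ) := by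
            rw [tendsto_nhdsWithin_iff]
            refine ⟨t0, Eventually.of_forall fun n => ?_⟩
            have := hk n
            simp only [mem_compl_iff, mem_singleton_iff]
            intro h; linarith
          refine (this.comp t1).congr fun n => ?_
          have := (hk n).ne'
          simp only [Function.comp, slope_def_field]
          rw [show τ - k n - τ = -k n by ring, div_neg, ← neg_div]
          ring
  have := (T1.sub T2).sub T3
  refine this.congr fun n => ?_
  have hkn := (hk n).ne'
  have cshift : Continuous (fun τ => F n (τ - k n)) := (hFc n).comp (by fun_prop)
  have e1 : (∫ τ in (t - k n)..t, F n τ) - (∫ τ in (s - k n)..s, F n τ)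
      = ∫ τ in s..t, (F n τ - F n (τ - k n)) := by
    rw [intervalIntegral.integral_sub ((hFc n).intervalIntegrable _ _)
      (cshift.intervalIntegrable _ _), intervalIntegral.integral_comp_sub_right]
    have i1 := intervalIntegral.integral_add_adjacent_intervals
      ((hFc n).intervalIntegrable (μ := volume) (s - k n) s) ((hFc n).intervalIntegrable s t)
    have i2 := intervalIntegral.integral_add_adjacent_intervals
      ((hFc n).intervalIntegrable (μ := volume) (s - k n) (t - k n))
      ((hFc n).intervalIntegrable (t - k n) t)
    linarith
  rw [← sub_div, e1, ← intervalIntegral.integral_div, ← intervalIntegral.integral_sub]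
  · congr 1
    ext τ
    simp only [hF]
    rw [← integral_sub (intK (fun ω => Θ τ ω * U n τ ω) ((cΘ τ).mul (cU n τ)))
      (intK (fun ω => Θ (τ - k n) ω * U n (τ - k n) ω) ((cΘ _).mul (cU n _))), ← integral_div,
      ← integral_sub (intK (fun ω => (Θ τ ω * U n τ ω - Θ (τ - k n) ω * U n (τ - k n) ω) / k n)
        ((((cΘ τ).mul (cU n τ)).sub ((cΘ _).mul (cU n _))).div_const (k n)))
      (intK (fun ω => U n (τ - k n) ω * ((Θ τ ω - Θ (τ - k n) ω) / k n))
        ((cU n _).mul (((cΘ _).sub (cΘ _)).div_const (k n))))]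
    congr 1; ext ω; field_simp; ring
  · exact (((hFc n).sub cshift).div_const _).intervalIntegrable _ _
  · apply Continuous.intervalIntegrable
    have hsub : Continuous (fun p : ℝ × (ℝ × ℝ) => (p.1 - k n, p.2)) := by fun_prop
    exact continuous_parametric_integral_of_continuous
      (f := fun τ ω => U n (τ - k n) ω * ((Θ τ ω - Θ (τ - k n) ω) / k n))
      (((hU n).comp hsub).mul ((hΘ.sub (hΘ.comp hsub)).div_const _)) hK

lemma tm_A0n (u h φ : ℝ → ℝ → ℝ) (hu : Continuous (fun p : ℝ × ℝ => u p.1 p.2))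
    (hh : Continuous (fun p : ℝ × ℝ => h p.1 p.2))
    (hφ : Continuous (fun p : ℝ × ℝ => φ p.1 p.2)) (φ0 : ∀ t x, 0 ≤ φ t x)
    (s t X0 X1 Y0 Y1 r : ℝ) (hst : s ≤ t) (hr : 0 < r) (hX0 : X0 ≤ Y0 - r)
    (hX1 : Y1 + r ≤ X1)
    (H : ∀ τ ∈ Icc s t, ∀ x ∈ Ioo X0 X1, ∀ δ > 0, ∀ᶠ η in 𝓝[>] (0:ℝ),
      (h τ x - δ) * η ^ 2 ≤ u τ (x + η) + u τ (x - η) - 2 * u τ x) :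
    r ^ 2 * ∫ τ in s..t, ∫ ω in Icc Y0 Y1 ×ˢ Icc (-1:ℝ) 1,
      φ τ ω.1 * (1 - |ω.2|) * h τ (ω.1 + r * ω.2) ≤
    ∫ τ in s..t, ∫ x in Icc Y0 Y1, φ τ x * (u τ (x + r) + u τ (x - r) - 2 * u τ x) := by
  rw [← intervalIntegral.integral_const_mul]
  have hK : IsCompact (Icc Y0 Y1 ×ˢ Icc (-1:ℝ) 1) := isCompact_Icc.prod isCompact_Icc
  have c1 : Continuous (fun q : ℝ × (ℝ × ℝ) =>
      φ q.1 q.2.1 * (1 - |q.2.2|) * h q.1 (q.2.1 + r * q.2.2)) := by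
    have a1 : Continuous (fun q : ℝ × (ℝ × ℝ) => φ q.1 q.2.1) :=
      hφ.comp (by fun_prop : Continuous (fun q : ℝ × (ℝ × ℝ) => (q.1, q.2.1)))
    have a2 : Continuous (fun q : ℝ × (ℝ × ℝ) => h q.1 (q.2.1 + r * q.2.2)) :=
      hh.comp (by fun_prop : Continuous (fun q : ℝ × (ℝ × ℝ) => (q.1, q.2.1 + r * q.2.2)))
    fun_prop
  have c2 : Continuous (fun q : ℝ × ℝ =>
      φ q.1 q.2 * (u q.1 (q.2 + r) + u q.1 (q.2 - r) - 2 * u q.1 q.2)) := by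
    have a1 : Continuous (fun q : ℝ × ℝ => u q.1 (q.2 + r)) :=
      hu.comp (by fun_prop : Continuous (fun q : ℝ × ℝ => (q.1, q.2 + r)))
    have a2 : Continuous (fun q : ℝ × ℝ => u q.1 (q.2 - r)) :=
      hu.comp (by fun_prop : Continuous (fun q : ℝ × ℝ => (q.1, q.2 - r)))
    fun_prop
  apply intervalIntegral.integral_mono_on hst
  · apply Continuous.intervalIntegrable
    exact (continuous_parametric_integral_of_continuous (f := fun τ (ω : ℝ × ℝ) =>
       φ τ ω.1 * (1 - |ω.2|) * h τ (ω.1 + r * ω.2)) c1 hK).const_mul _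
  · apply Continuous.intervalIntegrable
    exact continuous_parametric_integral_of_continuous (f := fun τ x =>
       φ τ x * (u τ (x + r) + u τ (x - r) - 2 * u τ x)) c2 isCompact_Icc
  intro τ hτ
  have cτ1 : Continuous (fun ω : ℝ × ℝ => φ τ ω.1 * (1 - |ω.2|) * h τ (ω.1 + r * ω.2)) :=
    c1.comp (Continuous.prodMk_right τ)
  have cu : Continuous (u τ) := hu.comp (Continuous.prodMk_right τ)
  have ch : Continuous (h τ) := hh.comp (Continuous.prodMk_right τ)
  have cp : Continuous (φ τ) := hφ.comp (Continuous.prodMk_right τ)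
  rw [Measure.volume_eq_prod, setIntegral_prod _ (by
    rw [← Measure.volume_eq_prod]; exact cτ1.continuousOn.integrableOn_compact hK),
    ← integral_const_mul]
  have cin : Continuous (fun x => ∫ σ in Icc (-1:ℝ) 1, φ τ x * (1 - |σ|) * h τ (x + r * σ)) :=
    continuous_parametric_integral_of_continuous
      (f := fun x σ => φ τ x * (1 - |σ|) * h τ (x + r * σ)) cτ1 isCompact_Icc
  apply setIntegral_mono_on
  · exact (continuous_const.mul cin).continuousOn.integrableOn_compact isCompact_Icc
  · exact (c2.comp (Continuous.prodMk_right τ)).continuousOn.integrableOn_compact isCompact_Icc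
  · exact measurableSet_Icc
  intro x hx
  have := tm_L12 (u τ) (h τ) cu ch X0 X1 (H τ hτ) x r hr (by linarith [hx.1]) (by linarith [hx.2])
  have e : ∫ σ in Icc (-1:ℝ) 1, φ τ x * (1 - |σ|) * h τ (x + r * σ)
      = φ τ x * ∫ σ in (-1:ℝ)..1, (1 - |σ|) * h τ (x + r * σ) := by
    rw [intervalIntegral.integral_of_le (by norm_num), ← integral_Icc_eq_integral_Ioc,
      ← integral_const_mul]
    congr 1; ext σ; ring
  rw [e]
  calc _ = φ τ x * (r ^ 2 * ∫ σ in (-1:ℝ)..1, (1 - |σ|) * h τ (x + r * σ)) := by ring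
    _ ≤ _ := mul_le_mul_of_nonneg_left this (φ0 τ x)

lemma tm_int4 {Ω : Type*} [MeasurableSpace Ω] (ν : Measure Ω) (f1 f2 f3 f4 : Ω → ℝ) (a b : ℝ)
    (h1 : Integrable f1 ν) (h2 : Integrable f2 ν) (h3 : Integrable f3 ν) (h4 : Integrable f4 ν) :
    ∫ ω, (f1 ω - a * f2 ω - b * f3 ω - f4 ω) ∂ν
      = ∫ ω, f1 ω ∂ν - a * ∫ ω, f2 ω ∂ν - b * ∫ ω, f3 ω ∂ν - ∫ ω, f4 ω ∂ν := by
  have k2 : Integrable (fun ω => a * f2 ω) ν := h2.const_mul a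
  have k3 : Integrable (fun ω => b * f3 ω) ν := h3.const_mul b
  have m1 : Integrable (fun ω => f1 ω - a * f2 ω) ν := h1.sub k2
  have m2 : Integrable (fun ω => f1 ω - a * f2 ω - b * f3 ω) ν := m1.sub k3
  rw [integral_sub m2 h4, integral_sub m1 k3, integral_sub h1 k2, integral_const_mul,
    integral_const_mul]

lemma tm_A0 (w c S φ φt ct : ℝ → ℝ → ℝ) (hw : Continuous (fun p : ℝ × ℝ => w p.1 p.2))
    (hc : Continuous (fun p : ℝ × ℝ => c p.1 p.2))
    (hS : Continuous (fun p : ℝ × ℝ => S p.1 p.2)) (hc0 : ∀ t x, 0 ≤ c t x)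
    (hφ : Continuous (fun p : ℝ × ℝ => φ p.1 p.2)) (φ0 : ∀ t x, 0 ≤ φ t x)
    (T0 T1 X0 X1 Y0 Y1 r s0 s t Lc Lφ : ℝ) (hs0 : T0 < s0) (hss : s0 < s) (hst : s ≤ t)
    (ht1 : t < T1) (hr : 0 < r) (hX0 : X0 ≤ Y0 - r) (hX1 : Y1 + r ≤ X1)
    (hL0 : 0 ≤ Lc) (hLφ0 : 0 ≤ Lφ)
    (hL : ∀ t ∈ Icc T0 T1, ∀ t' ∈ Icc T0 T1, ∀ x ∈ Icc X0 X1, |c t x - c t' x| ≤ Lc * |t - t'|)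
    (hLφ : ∀ τ ∈ Icc s0 t, ∀ t' ∈ Icc s0 t, ∀ x ∈ Icc Y0 Y1, |φ τ x - φ t' x| ≤ Lφ * |τ - t'|)
    (hct : ∀ τ ∈ Icc s t, ∀ x ∈ Icc X0 X1, HasDerivAt (fun τ => c τ x) (ct τ x) τ)
    (hφt : ∀ τ ∈ Icc s t, ∀ x ∈ Icc Y0 Y1, HasDerivAt (fun τ => φ τ x) (φt τ x) τ)
    (H : ∀ s ∈ Ioo T0 T1, ∀ x ∈ Ioo X0 X1, ∀ p,
      (∃ C, ∀ᶠ d in 𝓝[>] (0:ℝ), p * d - C * d ^ 2 ≤ w s x - w (s - d) x) →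
      ∀ δ > 0, ∀ᶠ η in 𝓝[>] (0:ℝ),
        (c s x * p - S s x - δ) * η ^ 2 ≤ w s (x + η) + w s (x - η) - 2 * w s x) :
    r ^ 2 * (((∫ ω in Icc Y0 Y1 ×ˢ Icc (-1:ℝ) 1,
        φ t ω.1 * (1 - |ω.2|) * c t (ω.1 + r * ω.2) * w t (ω.1 + r * ω.2))
      - (∫ ω in Icc Y0 Y1 ×ˢ Icc (-1:ℝ) 1,
        φ s ω.1 * (1 - |ω.2|) * c s (ω.1 + r * ω.2) * w s (ω.1 + r * ω.2))
      - ∫ τ in s..t, ∫ ω in Icc Y0 Y1 ×ˢ Icc (-1:ℝ) 1, w τ (ω.1 + r * ω.2) *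
         (φt τ ω.1 * (1 - |ω.2|) * c τ (ω.1 + r * ω.2)
          + φ τ ω.1 * (1 - |ω.2|) * ct τ (ω.1 + r * ω.2)))
      - ∫ τ in s..t, ∫ ω in Icc Y0 Y1 ×ˢ Icc (-1:ℝ) 1,
        φ τ ω.1 * (1 - |ω.2|) * S τ (ω.1 + r * ω.2)) ≤
    ∫ τ in s..t, ∫ x in Icc Y0 Y1, φ τ x * (w τ (x + r) + w τ (x - r) - 2 * w τ x) := by
  have hK : IsCompact (Icc Y0 Y1 ×ˢ Icc (-1:ℝ) 1) := isCompact_Icc.prod isCompact_Icc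
  set K := Icc Y0 Y1 ×ˢ Icc (-1:ℝ) 1 with hKd
  set γ : ℕ → ℝ := fun n => 1 / ((n:ℝ) + 1) with hγ
  have hγ0 : ∀ n, 0 < γ n := fun n => by simp only [hγ]; positivity
  have hγt : Tendsto γ atTop (𝓝 0) := tendsto_one_div_add_atTop_nhds_zero_nat
  have ex := fun n => tm_sup w c S hw hS hc0 T0 T1 X0 X1 s0 t Lc hs0 (by linarith) ht1 hL0 hL H
    (γ n) (hγ0 n)
  choose ε0 hε0 hex using ex
  set ε : ℕ → ℝ := fun n => min (ε0 n) (γ n) / 2 with hε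
  have hεp : ∀ n, 0 < ε n := fun n => half_pos (lt_min (hε0 n) (hγ0 n))
  have hεl : ∀ n, ε n < ε0 n := fun n =>
    (half_lt_self (lt_min (hε0 n) (hγ0 n))).trans_le (min_le_left _ _)
  have hεg : ∀ n, ε n ≤ γ n := fun n =>
    (half_lt_self (lt_min (hε0 n) (hγ0 n))).le.trans (min_le_right _ _)
  have hεt : Tendsto ε atTop (𝓝 0) := squeeze_zero (fun n => (hεp n).le) hεg hγt
  set k : ℕ → ℝ := fun n => ε n ^ 2 with hkd
  have hk : ∀ n, 0 < k n := fun n => pow_pos (hεp n) 2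
  have hkt : Tendsto k atTop (𝓝 0) := by simpa using hεt.pow 2
  set u : ℕ → ℝ → ℝ → ℝ := fun n => tm_sc w T0 T1 (ε n) with hud
  have cu : ∀ n, Continuous (fun p : ℝ × ℝ => u n p.1 p.2) := fun n => tm_sc_cont w hw T0 T1 (ε n)
  have csh : Continuous (fun q : ℝ × (ℝ × ℝ) => (q.1, q.2.1 + r * q.2.2)) := by fun_prop
  have csm : Continuous (fun q : ℝ × (ℝ × ℝ) => (q.1, q.2.1)) := by fun_prop
  have cφ := hφ.comp csm
  have cc := hc.comp csh
  have cS := hS.comp csh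
  have cw := hw.comp csh
  simp only [Function.comp_def] at cφ cc cS cw
  have mem : ∀ ω ∈ K, ω.1 + r * ω.2 ∈ Icc X0 X1 := by
    rintro ⟨x, σ⟩ ⟨h1, h2⟩
    simp only at h1 h2 ⊢
    constructor <;> nlinarith [h1.1, h1.2, h2.1, h2.2]
  obtain ⟨Bc, hBc⟩ := ((isCompact_Icc (a := s0) (b := t)).prod hK).exists_bound_of_continuousOn
    cc.continuousOn
  obtain ⟨Bφ, hBφ⟩ := ((isCompact_Icc (a := s0) (b := t)).prod hK).exists_bound_of_continuousOn
    cφ.continuousOn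
  have TT := tm_time K hK (fun τ ω => φ τ ω.1 * (1 - |ω.2|) * c τ (ω.1 + r * ω.2))
    (fun τ ω => φt τ ω.1 * (1 - |ω.2|) * c τ (ω.1 + r * ω.2)
          + φ τ ω.1 * (1 - |ω.2|) * ct τ (ω.1 + r * ω.2))
    (fun τ ω => w τ (ω.1 + r * ω.2)) (fun n τ ω => u n τ (ω.1 + r * ω.2)) k hk hkt s0 s t
    (Lφ * |Bc| + |Bφ| * Lc) hss hst
    (by simp only [Function.uncurry_def]; fun_prop) cw (fun n => (cu n).comp csh)
    (by
      intro g hg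
      filter_upwards [hγt.eventually (eventually_le_nhds hg)] with n hn τ hτ ω hω
      exact ((hex n (ε n) (hεp n) (hεl n)).1 τ hτ _ (mem ω hω)).trans hn)
    (by
      intro τ hτ ω hω
      exact ((hφt τ hτ ω.1 hω.1).mul_const (1 - |ω.2|)).mul (hct τ hτ _ (mem ω hω)))
    (by positivity)
    (by
      intro τ hτ τ' hτ' ω hω
      have hσ : |(1 - |ω.2| : ℝ)| ≤ 1 := by
        have := abs_le.2 hω.2
        rw [abs_le]; constructor <;> linarith [abs_nonneg ω.2]
      have a1 := hLφ τ hτ τ' hτ' ω.1 hω.1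
      have a2 := hL τ ⟨by linarith [hτ.1], by linarith [hτ.2]⟩ τ'
        ⟨by linarith [hτ'.1], by linarith [hτ'.2]⟩ _ (mem ω hω)
      have b1 := (hBc (τ, ω) ⟨hτ, hω⟩).trans (le_abs_self _)
      have b2 := (hBφ (τ', ω) ⟨hτ', hω⟩).trans (le_abs_self _)
      simp only [Real.norm_eq_abs] at b1 b2
      have : φ τ ω.1 * (1 - |ω.2|) * c τ (ω.1 + r * ω.2)
          - φ τ' ω.1 * (1 - |ω.2|) * c τ' (ω.1 + r * ω.2)
          = (1 - |ω.2|) * ((φ τ ω.1 - φ τ' ω.1) * c τ (ω.1 + r * ω.2)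
            + φ τ' ω.1 * (c τ (ω.1 + r * ω.2) - c τ' (ω.1 + r * ω.2))) := by ring
      rw [this, abs_mul]
      calc _ ≤ 1 * |(φ τ ω.1 - φ τ' ω.1) * c τ (ω.1 + r * ω.2)
            + φ τ' ω.1 * (c τ (ω.1 + r * ω.2) - c τ' (ω.1 + r * ω.2))| :=
              mul_le_mul_of_nonneg_right hσ (abs_nonneg _)
        _ ≤ |φ τ ω.1 - φ τ' ω.1| * |c τ (ω.1 + r * ω.2)|
            + |φ τ' ω.1| * |c τ (ω.1 + r * ω.2) - c τ' (ω.1 + r * ω.2)| := by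
              rw [one_mul, ← abs_mul, ← abs_mul]; exact abs_add_le _ _
        _ ≤ (Lφ * |τ - τ'|) * |Bc| + |Bφ| * (Lc * |τ - τ'|) := by
              gcongr
        _ = _ := by ring)
  set I1 := ∫ τ in s..t, ∫ ω in K, φ τ ω.1 * (1 - |ω.2|) * c τ (ω.1 + r * ω.2) with hI1
  set I2 := ∫ τ in s..t, ∫ ω in K, φ τ ω.1 * (1 - |ω.2|) with hI2
  set I3 := ∫ τ in s..t, ∫ x in Icc Y0 Y1, φ τ x with hI3
  set J := ∫ τ in s..t, ∫ ω in K, φ τ ω.1 * (1 - |ω.2|) * S τ (ω.1 + r * ω.2) with hJ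
  set A : ℕ → ℝ := fun n => ∫ τ in s..t, ∫ ω in K, φ τ ω.1 * (1 - |ω.2|) * c τ (ω.1 + r * ω.2)
    * ((u n τ (ω.1 + r * ω.2) - u n (τ - k n) (ω.1 + r * ω.2)) / k n) with hA
  have key : ∀ n, r ^ 2 * (A n - ε n * I1 - γ n * I2 - J) ≤
      (∫ τ in s..t, ∫ x in Icc Y0 Y1, φ τ x * (w τ (x + r) + w τ (x - r) - 2 * w τ x))
        + 4 * γ n * I3 := by
    intro n
    have cun : Continuous (fun p : ℝ × ℝ => u n (p.1 - k n) p.2) :=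
      (cu n).comp (by fun_prop : Continuous (fun p : ℝ × ℝ => (p.1 - k n, p.2)))
    have cunn := cu n
    have st := tm_A0n (u n) (fun τ x => c τ x * ((u n τ x - u n (τ - k n) x) / k n - k n / ε n)
      - S τ x - γ n) φ (cu n) (by fun_prop) hφ φ0 s t X0 X1 Y0 Y1 r hst hr hX0 hX1
      (fun τ hτ x hx δ hδ => (hex n (ε n) (hεp n) (hεl n)).2 τ ⟨by linarith [hτ.1], hτ.2⟩ x hx
        (k n) (hk n) δ hδ)
    have cq1 := (cu n).comp csh
    have cq2 := cun.comp csh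
    simp only [Function.comp_def] at cq1 cq2
    have iK : ∀ f : ℝ × (ℝ × ℝ) → ℝ, Continuous f →
        IntervalIntegrable (fun τ => ∫ ω in K, f (τ, ω)) volume s t := fun f hf =>
      (continuous_parametric_integral_of_continuous (f := fun τ ω => f (τ, ω)) hf
        hK).intervalIntegrable _ _
    have iI : ∀ f : ℝ × ℝ → ℝ, Continuous f →
        IntervalIntegrable (fun τ => ∫ x in Icc Y0 Y1, f (τ, x)) volume s t := fun f hf =>
      (continuous_parametric_integral_of_continuous (f := fun τ ω => f (τ, ω)) hf
        isCompact_Icc).intervalIntegrable _ _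
    have jK : ∀ f : ℝ × (ℝ × ℝ) → ℝ, Continuous f → ∀ τ,
        Integrable (fun ω => f (τ, ω)) (volume.restrict K) := fun f hf τ =>
      (hf.comp (Continuous.prodMk_right τ)).continuousOn.integrableOn_compact hK
    have e1 : (∫ τ in s..t, ∫ ω in K, φ τ ω.1 * (1 - |ω.2|) *
        (c τ (ω.1 + r * ω.2) * ((u n τ (ω.1 + r * ω.2) - u n (τ - k n) (ω.1 + r * ω.2)) / k n
          - k n / ε n) - S τ (ω.1 + r * ω.2) - γ n)) = A n - ε n * I1 - γ n * I2 - J := by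
      have hke : k n / ε n = ε n := by simp only [hkd]; have := (hεp n).ne'; field_simp
      rw [hke]
      have f1 := iK (fun q => φ q.1 q.2.1 * (1 - |q.2.2|) * c q.1 (q.2.1 + r * q.2.2)
        * ((u n q.1 (q.2.1 + r * q.2.2) - u n (q.1 - k n) (q.2.1 + r * q.2.2)) / k n)) (by fun_prop)
      have f2 := iK (fun q => φ q.1 q.2.1 * (1 - |q.2.2|) * c q.1 (q.2.1 + r * q.2.2)) (by fun_prop)
      have f3 := iK (fun q => φ q.1 q.2.1 * (1 - |q.2.2|)) (by fun_prop)
      have f4 := iK (fun q => φ q.1 q.2.1 * (1 - |q.2.2|) * S q.1 (q.2.1 + r * q.2.2)) (by fun_prop)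
      have g1 := jK (fun q => φ q.1 q.2.1 * (1 - |q.2.2|) * c q.1 (q.2.1 + r * q.2.2)
        * ((u n q.1 (q.2.1 + r * q.2.2) - u n (q.1 - k n) (q.2.1 + r * q.2.2)) / k n)) (by fun_prop)
      have g2 := jK (fun q => φ q.1 q.2.1 * (1 - |q.2.2|) * c q.1 (q.2.1 + r * q.2.2)) (by fun_prop)
      have g3 := jK (fun q => φ q.1 q.2.1 * (1 - |q.2.2|)) (by fun_prop)
      have g4 := jK (fun q => φ q.1 q.2.1 * (1 - |q.2.2|) * S q.1 (q.2.1 + r * q.2.2)) (by fun_prop)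
      simp only [hA, hI1, hI2, hJ]
      rw [← intervalIntegral.integral_const_mul, ← intervalIntegral.integral_const_mul,
        ← intervalIntegral.integral_sub f1 (f2.const_mul _),
        ← intervalIntegral.integral_sub (f1.sub (f2.const_mul _)) (f3.const_mul _),
        ← intervalIntegral.integral_sub ((f1.sub (f2.const_mul _)).sub (f3.const_mul _)) f4]
      congr 1
      ext τ
      simp only
      refine Eq.trans ?_ (tm_int4 _ _ _ _ _ (ε n) (γ n) (g1 τ) (g2 τ) (g3 τ) (g4 τ))
      congr 1
      ext ω
      ring
    rw [e1] at st
    refine st.trans ?_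
    have hwp : Continuous (fun q : ℝ × ℝ => w q.1 (q.2 + r)) :=
      hw.comp (by fun_prop : Continuous (fun q : ℝ × ℝ => (q.1, q.2 + r)))
    have hwm : Continuous (fun q : ℝ × ℝ => w q.1 (q.2 - r)) :=
      hw.comp (by fun_prop : Continuous (fun q : ℝ × ℝ => (q.1, q.2 - r)))
    have hup : Continuous (fun q : ℝ × ℝ => u n q.1 (q.2 + r)) :=
      (cu n).comp (by fun_prop : Continuous (fun q : ℝ × ℝ => (q.1, q.2 + r)))
    have hum : Continuous (fun q : ℝ × ℝ => u n q.1 (q.2 - r)) :=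
      (cu n).comp (by fun_prop : Continuous (fun q : ℝ × ℝ => (q.1, q.2 - r)))
    have f1 := iI (fun q => φ q.1 q.2 * (w q.1 (q.2 + r) + w q.1 (q.2 - r) - 2 * w q.1 q.2))
      (by fun_prop)
    have f2 := iI (fun q => φ q.1 q.2) hφ
    have f3 := iI (fun q => φ q.1 q.2 * (u n q.1 (q.2 + r) + u n q.1 (q.2 - r) - 2 * u n q.1 q.2))
      (by fun_prop)
    rw [hI3, ← intervalIntegral.integral_const_mul, ← intervalIntegral.integral_add f1
      (f2.const_mul _)]
    apply intervalIntegral.integral_mono_on hst f3 (f1.add (f2.const_mul _))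
    intro τ hτ
    have jI : ∀ f : ℝ × ℝ → ℝ, Continuous f →
        Integrable (fun ω => f (τ, ω)) (volume.restrict (Icc Y0 Y1)) := fun f hf =>
      (hf.comp (Continuous.prodMk_right τ)).continuousOn.integrableOn_compact isCompact_Icc
    have g1 := jI (fun q => φ q.1 q.2 * (w q.1 (q.2 + r) + w q.1 (q.2 - r) - 2 * w q.1 q.2))
      (by fun_prop)
    have g2 := jI (fun q => φ q.1 q.2) hφ
    have g3 := jI (fun q => φ q.1 q.2 * (u n q.1 (q.2 + r) + u n q.1 (q.2 - r) - 2 * u n q.1 q.2))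
      (by fun_prop)
    simp only
    rw [← integral_const_mul, ← integral_add g1 (g2.const_mul _)]
    apply setIntegral_mono_on g3 (g1.add (g2.const_mul _)) measurableSet_Icc
    intro x hx
    have hb := (hex n (ε n) (hεp n) (hεl n)).1 τ ⟨by linarith [hτ.1], hτ.2⟩
    have b1 := abs_le.1 (hb (x + r) ⟨by linarith [hx.1], by linarith [hx.2]⟩)
    have b2 := abs_le.1 (hb (x - r) ⟨by linarith [hx.1], by linarith [hx.2]⟩)
    have b3 := abs_le.1 (hb x ⟨by linarith [hx.1], by linarith [hx.2]⟩)
    have : u n τ (x + r) + u n τ (x - r) - 2 * u n τ x ≤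
      w τ (x + r) + w τ (x - r) - 2 * w τ x + 4 * γ n := by
      simp only [hud]; linarith [b1.2, b2.2, b3.1]
    have := mul_le_mul_of_nonneg_left this (φ0 τ x)
    simp only [Pi.add_apply]
    linarith
  have L1 : Tendsto (fun n => r ^ 2 * (A n - ε n * I1 - γ n * I2 - J)) atTop (𝓝 _) :=
    (((TT.sub (hεt.mul_const I1)).sub (hγt.mul_const I2)).sub_const J).const_mul (r ^ 2)
  have L2 := ((hγt.const_mul 4).mul_const I3).const_add
    (∫ τ in s..t, ∫ x in Icc Y0 Y1, φ τ x * (w τ (x + r) + w τ (x - r) - 2 * w τ x))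
  have := le_of_tendsto_of_tendsto' L1 L2 key
  simpa using this

lemma tm_theta_lower (G : ℝ → ℝ) (hG : LowerSemicontinuous G) (B : ℝ) (hB : ∀ t, |G t| ≤ B)
    (T0 s e : ℝ) (he : 0 < e) :
    ∀ᶠ d in 𝓝[>] (0:ℝ), d * (G s - e) ≤ (∫ τ in T0..s, G τ) - ∫ τ in T0..(s - d), G τ := by
  have hint : ∀ a b, IntervalIntegrable G volume a b := fun a b => by
    apply (intervalIntegrable_const (c := B)).mono_fun
    · exact hG.measurable.aestronglyMeasurable
    · refine Eventually.of_forall fun t => ?_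
      simp only [Real.norm_eq_abs]; exact (hB t).trans (le_abs_self _)
  have h1 := hG s (G s - e) (by linarith)
  obtain ⟨τ, hτ, h2⟩ := Metric.eventually_nhds_iff.1 h1
  have e2 : ∀ᶠ η in 𝓝[>] (0:ℝ), η < τ :=
    eventually_nhdsWithin_of_eventually_nhds (eventually_lt_nhds hτ)
  filter_upwards [e2, self_mem_nhdsWithin] with d h3 h4
  have h4 : 0 < d := h4
  rw [intervalIntegral.integral_interval_sub_left (hint _ _) (hint _ _)]
  have : ∫ τ in (s - d)..s, (G s - e) ≤ ∫ τ in (s - d)..s, G τ := by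
    apply intervalIntegral.integral_mono_on (by linarith) intervalIntegrable_const (hint _ _)
    intro y hy
    exact (h2 (by rw [Real.dist_eq, abs_lt]; constructor <;> linarith [hy.1, hy.2])).le
  rwa [intervalIntegral.integral_const, smul_eq_mul, sub_sub_cancel] at this

lemma tm_A1H (v vt c S : ℝ → ℝ → ℝ) (Sn : ℝ → ℝ → ℝ) (G : ℝ → ℝ) (hG : LowerSemicontinuous G)
    (B : ℝ) (hB : ∀ t, |G t| ≤ B) (T0 s x : ℝ) (hc : 0 ≤ c s x)
    (hGS : S s x - Sn s x ≤ c s x * G s)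
    (hvt : HasDerivAt (fun τ => v τ x) (vt s x) s)
    (hv2 : ∀ δ > 0, ∀ᶠ η in 𝓝[>] (0:ℝ),
        (c s x * vt s x - S s x - δ) * η ^ 2 ≤ v s (x + η) + v s (x - η) - 2 * v s x)
    (p : ℝ) (hp : ∃ C, ∀ᶠ d in 𝓝[>] (0:ℝ), p * d - C * d ^ 2 ≤
      (v s x - ∫ τ in T0..s, G τ) - (v (s - d) x - ∫ τ in T0..(s-d), G τ)) :
      ∀ δ > 0, ∀ᶠ η in 𝓝[>] (0:ℝ),
        (c s x * p - Sn s x - δ) * η ^ 2 ≤ (v s (x + η) - ∫ τ in T0..s, G τ)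
          + (v s (x - η) - ∫ τ in T0..s, G τ) - 2 * (v s x - ∫ τ in T0..s, G τ) := by
  obtain ⟨C, hC⟩ := hp
  have key : p + G s ≤ vt s x := by
    apply le_of_forall_pos_le_add
    intro e he
    have t0 : Tendsto (fun d : ℝ => s - d) (𝓝[>] 0) (𝓝[≠] s) := by
      rw [tendsto_nhdsWithin_iff]
      refine ⟨?_, ?_⟩
      · have : Tendsto (fun d : ℝ => s - d) (𝓝 0) (𝓝 (s - 0)) := by
          apply Continuous.tendsto; fun_prop
        rw [sub_zero] at this
        exact this.mono_left nhdsWithin_le_nhds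
      · filter_upwards [self_mem_nhdsWithin] with d hd
        have hd : 0 < d := hd
        simp only [mem_compl_iff, mem_singleton_iff]; intro h; linarith
    have L1 := hvt.tendsto_slope.comp t0
    have L2 : Tendsto (fun d : ℝ => p - C * d + (G s - e)) (𝓝[>] 0) (𝓝 (p - C * 0 + (G s - e))) :=
      (Continuous.tendsto (by fun_prop) 0).mono_left nhdsWithin_le_nhds
    have := le_of_tendsto_of_tendsto L2 L1 (by
      filter_upwards [hC, tm_theta_lower G hG B hB T0 s e he, self_mem_nhdsWithin] with d h1 h2 h3
      have h3 : 0 < d := h3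
      simp only [Function.comp, slope_def_field]
      rw [show s - d - s = -d by ring, div_neg, ← neg_div, le_div_iff₀ h3]
      nlinarith)
    linarith
  intro δ hδ
  filter_upwards [hv2 δ hδ] with η h1
  have : c s x * p - Sn s x - δ ≤ c s x * vt s x - S s x - δ := by
    have := mul_le_mul_of_nonneg_left key hc
    linarith
  have := mul_le_mul_of_nonneg_right this (sq_nonneg η)
  linarith

lemma tm_A1 (v vt c S φ φt ct : ℝ → ℝ → ℝ) (Sn : ℕ → ℝ → ℝ → ℝ)
    (hv : Continuous (fun p : ℝ × ℝ => v p.1 p.2))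
    (hc : Continuous (fun p : ℝ × ℝ => c p.1 p.2))
    (hSn : ∀ n, Continuous (fun p : ℝ × ℝ => Sn n p.1 p.2)) (c0 : ℝ) (hc00 : 0 < c0)
    (hc0 : ∀ t x, c0 ≤ c t x)
    (hφ : Continuous (fun p : ℝ × ℝ => φ p.1 p.2)) (φ0 : ∀ t x, 0 ≤ φ t x)
    (T0 T1 X0 X1 Y0 Y1 r s0 s t Lc Lφ : ℝ) (hs0 : T0 < s0) (hss : s0 < s) (hst : s ≤ t)
    (ht1 : t < T1) (hr : 0 < r) (hX0 : X0 ≤ Y0 - r) (hX1 : Y1 + r ≤ X1) (hY : Y0 ≤ Y1)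
    (hL0 : 0 ≤ Lc) (hLφ0 : 0 ≤ Lφ)
    (hL : ∀ t ∈ Icc T0 T1, ∀ t' ∈ Icc T0 T1, ∀ x ∈ Icc X0 X1, |c t x - c t' x| ≤ Lc * |t - t'|)
    (hLφ : ∀ τ ∈ Icc s0 t, ∀ t' ∈ Icc s0 t, ∀ x ∈ Icc Y0 Y1, |φ τ x - φ t' x| ≤ Lφ * |τ - t'|)
    (hct : ∀ τ ∈ Icc s t, ∀ x ∈ Icc X0 X1, HasDerivAt (fun τ => c τ x) (ct τ x) τ)
    (hφt : ∀ τ ∈ Icc s t, ∀ x ∈ Icc Y0 Y1, HasDerivAt (fun τ => φ τ x) (φt τ x) τ)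
    (mct : Measurable (fun p : ℝ × ℝ => ct p.1 p.2))
    (mφt : Measurable (fun p : ℝ × ℝ => φt p.1 p.2))
    (B : ℝ) (hB : ∀ n t x, |Sn n t x| ≤ B)
    (bct : ∀ t x, |ct t x| ≤ B) (bφt : ∀ t x, |φt t x| ≤ B)
    (bv : ∀ t x, |v t x| ≤ B) (bc : ∀ t x, |c t x| ≤ B) (bφ : ∀ t x, |φ t x| ≤ B)
    (hS : ∀ t ∈ Icc T0 T1, ∀ e > 0, ∀ᶠ n in atTop, ∀ x ∈ Icc X0 X1, |Sn n t x - S t x| ≤ e)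
    (hvt : ∀ s ∈ Ioo T0 T1, ∀ x ∈ Ioo X0 X1, HasDerivAt (fun τ => v τ x) (vt s x) s)
    (hv2 : ∀ s ∈ Ioo T0 T1, ∀ x ∈ Ioo X0 X1, ∀ δ > 0, ∀ᶠ η in 𝓝[>] (0:ℝ),
        (c s x * vt s x - S s x - δ) * η ^ 2 ≤ v s (x + η) + v s (x - η) - 2 * v s x) :
    r ^ 2 * (((∫ ω in Icc Y0 Y1 ×ˢ Icc (-1:ℝ) 1,
        φ t ω.1 * (1 - |ω.2|) * c t (ω.1 + r * ω.2) * v t (ω.1 + r * ω.2))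
      - (∫ ω in Icc Y0 Y1 ×ˢ Icc (-1:ℝ) 1,
        φ s ω.1 * (1 - |ω.2|) * c s (ω.1 + r * ω.2) * v s (ω.1 + r * ω.2))
      - ∫ τ in s..t, ∫ ω in Icc Y0 Y1 ×ˢ Icc (-1:ℝ) 1, v τ (ω.1 + r * ω.2) *
         (φt τ ω.1 * (1 - |ω.2|) * c τ (ω.1 + r * ω.2)
          + φ τ ω.1 * (1 - |ω.2|) * ct τ (ω.1 + r * ω.2)))
      - ∫ τ in s..t, ∫ ω in Icc Y0 Y1 ×ˢ Icc (-1:ℝ) 1,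
        φ τ ω.1 * (1 - |ω.2|) * S τ (ω.1 + r * ω.2)) ≤
    ∫ τ in s..t, ∫ x in Icc Y0 Y1, φ τ x * (v τ (x + r) + v τ (x - r) - 2 * v τ x) := by
  have hK : IsCompact (Icc Y0 Y1 ×ˢ Icc (-1:ℝ) 1) := isCompact_Icc.prod isCompact_Icc
  set K := Icc Y0 Y1 ×ˢ Icc (-1:ℝ) 1 with hKd
  have hKm := hK.measurableSet
  have hKfin : volume K < ⊤ := hK.measure_lt_top
  have hB0 : 0 ≤ B := (abs_nonneg _).trans (bv 0 0)
  have hXX : X0 ≤ X1 := by linarith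
  haveI : Nonempty (Icc X0 X1) := ⟨⟨X0, left_mem_Icc.2 hXX⟩⟩
  have mem : ∀ ω ∈ K, ω.1 + r * ω.2 ∈ Icc X0 X1 := by
    rintro ⟨x, σ⟩ ⟨h1, h2⟩
    simp only at h1 h2 ⊢
    constructor <;> nlinarith [h1.1, h1.2, h2.1, h2.2]
  have hσK : ∀ ω ∈ K, |(1 - |ω.2| : ℝ)| ≤ 1 := fun ω hω => by
    have := abs_le.2 hω.2
    rw [abs_le]; constructor <;> linarith [abs_nonneg ω.2]
  set g : ℕ → (ℕ × Icc X0 X1) → ℝ → ℝ := fun n i τ =>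
    |Sn (n + i.1) τ i.2 - Sn n τ i.2| / c0 with hg
  have gle : ∀ n i τ, g n i τ ≤ 2 * B / c0 := fun n i τ => by
    simp only [hg]
    gcongr
    have := abs_sub (Sn (n + i.1) τ i.2) (Sn n τ i.2)
    linarith [hB (n + i.1) τ i.2, hB n τ i.2]
  have g0 : ∀ n i τ, 0 ≤ g n i τ := fun n i τ => by simp only [hg]; positivity
  have gb : ∀ n τ, BddAbove (range fun i => g n i τ) := fun n τ =>
    ⟨2 * B / c0, by rintro _ ⟨i, rfl⟩; exact gle n i τ⟩
  set G : ℕ → ℝ → ℝ := fun n τ => ⨆ i, g n i τ with hG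
  have Glsc : ∀ n, LowerSemicontinuous (G n) := fun n =>
    lowerSemicontinuous_ciSup (gb n) fun i => by
      have a1 : Continuous (fun τ => Sn (n + i.1) τ i.2) := (hSn _).comp (Continuous.prodMk_left _)
      have a2 : Continuous (fun τ => Sn n τ i.2) := (hSn _).comp (Continuous.prodMk_left _)
      exact ((a1.sub a2).abs.div_const c0).lowerSemicontinuous
  have G0 : ∀ n τ, 0 ≤ G n τ := fun n τ => Real.iSup_nonneg fun i => g0 n i τ
  have Gle : ∀ n τ, G n τ ≤ 2 * B / c0 := fun n τ => ciSup_le fun i => gle n i τ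
  have Gabs : ∀ n τ, |G n τ| ≤ 2 * B / c0 := fun n τ => by
    rw [abs_of_nonneg (G0 n τ)]; exact Gle n τ
  have Gint : ∀ n a b, IntervalIntegrable (G n) volume a b := fun n a b => by
    apply (intervalIntegrable_const (c := 2 * B / c0)).mono_fun
    · exact (Glsc n).measurable.aestronglyMeasurable
    · refine Eventually.of_forall fun t => ?_
      simp only [Real.norm_eq_abs]; exact (Gabs n t).trans (le_abs_self _)
  have Gt : ∀ τ ∈ Icc T0 T1, Tendsto (fun n => G n τ) atTop (𝓝 0) := by
    intro τ hτ
    rw [Metric.tendsto_nhds]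
    intro e he
    obtain ⟨N, hN⟩ := eventually_atTop.1 (hS τ hτ (e * c0 / 4) (by positivity))
    filter_upwards [eventually_ge_atTop N] with n hn
    rw [Real.dist_eq, sub_zero, abs_of_nonneg (G0 n τ)]
    refine lt_of_le_of_lt (b := e / 2) (ciSup_le fun i => ?_) (by linarith)
    have a1 := hN (n + i.1) (by omega) i.2 i.2.2
    have a2 := hN n hn i.2 i.2.2
    simp only [hg]
    rw [div_le_iff₀ hc00]
    have := abs_sub_le (Sn (n + i.1) τ i.2) (S τ i.2) (Sn n τ i.2)
    rw [abs_sub_comm (S τ i.2)] at this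
    linarith
  set θ : ℕ → ℝ → ℝ := fun n τ => ∫ y in T0..τ, G n y with hθ
  have θc : ∀ n, Continuous (θ n) := fun n => intervalIntegral.continuous_primitive (Gint n) T0
  have I0 : Tendsto (fun n => ∫ y in T0..T1, G n y) atTop (𝓝 0) := by
    have := intervalIntegral.tendsto_integral_filter_of_dominated_convergence
      (μ := volume) (a := T0) (b := T1) (F := G) (f := fun _ => (0:ℝ)) (l := atTop)
      (fun _ => 2 * B / c0)
      (Eventually.of_forall fun n => (Glsc n).measurable.aestronglyMeasurable)
      (Eventually.of_forall fun n => Eventually.of_forall fun τ _ => Gabs n τ)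
      intervalIntegrable_const
      (Eventually.of_forall fun τ hτ => Gt τ (by
        rw [uIoc_of_le (by linarith)] at hτ; exact Ioc_subset_Icc_self hτ))
    simpa using this
  have θle : ∀ n, ∀ τ ∈ Icc T0 T1, |θ n τ| ≤ ∫ y in T0..T1, G n y := by
    intro n τ hτ
    rw [abs_of_nonneg (intervalIntegral.integral_nonneg hτ.1 fun y _ => G0 n y)]
    exact intervalIntegral.integral_mono_interval le_rfl hτ.1 hτ.2
      (Eventually.of_forall fun y => G0 n y) (Gint n _ _)
  have θt : ∀ τ ∈ Icc T0 T1, Tendsto (fun n => θ n τ) atTop (𝓝 0) := fun τ hτ =>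
    squeeze_zero_norm (fun n => θle n τ hτ) I0
  have θev : ∀ᶠ n in atTop, ∀ τ ∈ Icc T0 T1, |θ n τ| ≤ 1 := by
    filter_upwards [I0.eventually (eventually_le_nhds one_pos)] with n hn τ hτ
    exact (θle n τ hτ).trans hn
  have hIT : ∀ τ ∈ Icc s t, τ ∈ Icc T0 T1 := fun τ hτ =>
    ⟨by linarith [hτ.1], by linarith [hτ.2]⟩
  have A0 := fun n => tm_A0 (fun τ x => v τ x - θ n τ) c (Sn n) φ φt ct
    (by have := θc n; fun_prop) hc (hSn n) (fun t x => hc00.le.trans (hc0 t x)) hφ φ0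
    T0 T1 X0 X1 Y0 Y1 r s0 s t Lc Lφ hs0 hss hst ht1 hr hX0 hX1 hL0 hLφ0 hL hLφ hct hφt
    (by
      intro τ hτ x hx p hp
      refine tm_A1H v vt c S (Sn n) (G n) (Glsc n) _ (Gabs n) T0 τ x
        (hc00.le.trans (hc0 τ x)) ?_ (hvt τ hτ x hx) (hv2 τ hτ x hx) p hp
      have hx' := Ioo_subset_Icc_self hx
      have hτ' := Ioo_subset_Icc_self hτ
      have l1 : ∀ m, Sn (n + m) τ x - Sn n τ x ≤ c0 * G n τ := fun m => by
        have := le_ciSup (gb n τ) (m, ⟨x, hx'⟩)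
        simp only [hg] at this
        rw [div_le_iff₀ hc00] at this
        have h2 := le_abs_self (Sn (n + m) τ x - Sn n τ x)
        simp only [hG, hg]
        linarith
      have : S τ x - Sn n τ x ≤ c0 * G n τ := by
        apply le_of_forall_pos_le_add
        intro e he
        obtain ⟨N, hN⟩ := eventually_atTop.1 (hS τ hτ' e he)
        have := (abs_le.1 (hN (n + N) (by omega) x hx')).1
        linarith [l1 N]
      exact this.trans (mul_le_mul_of_nonneg_right (hc0 τ x) (G0 n τ)))
  have csh : Continuous (fun q : ℝ × (ℝ × ℝ) => (q.1, q.2.1 + r * q.2.2)) := by fun_prop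
  have csm : Continuous (fun q : ℝ × (ℝ × ℝ) => (q.1, q.2.1)) := by fun_prop
  have cφ := hφ.comp csm
  have cc := hc.comp csh
  have cv := hv.comp csh
  have mφt2 := mφt.comp csm.measurable
  have mct2 := mct.comp csh.measurable
  simp only [Function.comp_def] at cφ cc cv mφt2 mct2
  have cS := fun n => (hSn n).comp csh
  simp only [Function.comp_def] at cS
  have bnd : ∀ τ ∈ Icc T0 T1, ∀ ω ∈ K, ∀ n, |θ n τ| ≤ 1 →
      ‖φ τ ω.1 * (1 - |ω.2|) * c τ (ω.1 + r * ω.2) * (v τ (ω.1 + r * ω.2) - θ n τ)‖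
        ≤ B * 1 * B * (B + 1) := by
    intro τ hτ ω hω n hn
    have h1 : |v τ (ω.1 + r * ω.2) - θ n τ| ≤ B + 1 := by
      have := abs_sub (v τ (ω.1 + r * ω.2)) (θ n τ)
      linarith [bv τ (ω.1 + r * ω.2)]
    rw [Real.norm_eq_abs, abs_mul, abs_mul, abs_mul]
    have := hσK ω hω
    have := bφ τ ω.1
    have := bc τ (ω.1 + r * ω.2)
    gcongr
  have Tb : ∀ τ ∈ Icc s t, Tendsto (fun n => ∫ ω in K,
        φ τ ω.1 * (1 - |ω.2|) * c τ (ω.1 + r * ω.2) * (v τ (ω.1 + r * ω.2) - θ n τ)) atTop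
      (𝓝 (∫ ω in K, φ τ ω.1 * (1 - |ω.2|) * c τ (ω.1 + r * ω.2) * v τ (ω.1 + r * ω.2))) := by
    intro τ hτ
    apply tendsto_integral_filter_of_dominated_convergence (fun _ => B * 1 * B * (B + 1))
    · refine Eventually.of_forall fun n => ?_
      have : Continuous (fun q : ℝ × (ℝ × ℝ) => φ q.1 q.2.1 * (1 - |q.2.2|) *
        c q.1 (q.2.1 + r * q.2.2) * (v q.1 (q.2.1 + r * q.2.2) - θ n q.1)) := by
        have := θc n; fun_prop
      exact (this.comp (Continuous.prodMk_right τ)).aestronglyMeasurable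
    · filter_upwards [θev] with n hn
      exact (ae_restrict_iff' hKm).2 (Eventually.of_forall fun ω hω =>
        bnd τ (hIT τ hτ) ω hω n (hn τ (hIT τ hτ)))
    · exact integrableOn_const hKfin.ne
    · refine Eventually.of_forall fun ω => ?_
      have := ((θt τ (hIT τ hτ)).const_sub (v τ (ω.1 + r * ω.2))).const_mul
        (φ τ ω.1 * (1 - |ω.2|) * c τ (ω.1 + r * ω.2))
      simpa using this
  have bnd2 : ∀ τ ∈ Icc T0 T1, ∀ ω ∈ K, ∀ n, |θ n τ| ≤ 1 →
      ‖(v τ (ω.1 + r * ω.2) - θ n τ) * (φt τ ω.1 * (1 - |ω.2|) * c τ (ω.1 + r * ω.2)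
          + φ τ ω.1 * (1 - |ω.2|) * ct τ (ω.1 + r * ω.2))‖
        ≤ (B + 1) * (B * 1 * B + B * 1 * B) := by
    intro τ hτ ω hω n hn
    have h1 : |v τ (ω.1 + r * ω.2) - θ n τ| ≤ B + 1 := by
      have := abs_sub (v τ (ω.1 + r * ω.2)) (θ n τ)
      linarith [bv τ (ω.1 + r * ω.2)]
    rw [Real.norm_eq_abs, abs_mul]
    have h2 : |φt τ ω.1 * (1 - |ω.2|) * c τ (ω.1 + r * ω.2)
          + φ τ ω.1 * (1 - |ω.2|) * ct τ (ω.1 + r * ω.2)| ≤ B * 1 * B + B * 1 * B := by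
      refine (abs_add_le _ _).trans ?_
      rw [abs_mul, abs_mul, abs_mul, abs_mul]
      have := hσK ω hω
      have := bφ τ ω.1
      have := bφt τ ω.1
      have := bc τ (ω.1 + r * ω.2)
      have := bct τ (ω.1 + r * ω.2)
      gcongr
    gcongr
  have mF : ∀ n, Measurable (fun q : ℝ × (ℝ × ℝ) => (v q.1 (q.2.1 + r * q.2.2) - θ n q.1) *
      (φt q.1 q.2.1 * (1 - |q.2.2|) * c q.1 (q.2.1 + r * q.2.2)
          + φ q.1 q.2.1 * (1 - |q.2.2|) * ct q.1 (q.2.1 + r * q.2.2))) := fun n => by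
    have := (θc n).measurable
    have := cv.measurable
    have := cc.measurable
    have := cφ.measurable
    have : Measurable (fun q : ℝ × (ℝ × ℝ) => (1 - |q.2.2| : ℝ)) :=
      (by fun_prop : Continuous (fun q : ℝ × (ℝ × ℝ) => (1 - |q.2.2| : ℝ))).measurable
    fun_prop
  have Tc : Tendsto (fun n => ∫ τ in s..t, ∫ ω in K, (v τ (ω.1 + r * ω.2) - θ n τ) *
         (φt τ ω.1 * (1 - |ω.2|) * c τ (ω.1 + r * ω.2)
          + φ τ ω.1 * (1 - |ω.2|) * ct τ (ω.1 + r * ω.2))) atTop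
      (𝓝 (∫ τ in s..t, ∫ ω in K, v τ (ω.1 + r * ω.2) *
         (φt τ ω.1 * (1 - |ω.2|) * c τ (ω.1 + r * ω.2)
          + φ τ ω.1 * (1 - |ω.2|) * ct τ (ω.1 + r * ω.2)))) := by
    apply intervalIntegral.tendsto_integral_filter_of_dominated_convergence
      (fun _ => (B + 1) * (B * 1 * B + B * 1 * B) * (volume K).toReal)
    · refine Eventually.of_forall fun n => ?_
      exact ((mF n).stronglyMeasurable.integral_prod_right'
        (ν := volume.restrict K)).aestronglyMeasurable
    · filter_upwards [θev] with n hn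
      refine Eventually.of_forall fun τ hτ => ?_
      rw [uIoc_of_le hst] at hτ
      have hτ' := hIT τ (Ioc_subset_Icc_self hτ)
      exact norm_setIntegral_le_of_norm_le_const hKfin (fun ω hω => bnd2 τ hτ' ω hω n (hn τ hτ'))
    · exact intervalIntegrable_const
    · refine Eventually.of_forall fun τ hτ => ?_
      rw [uIoc_of_le hst] at hτ
      have hτ' := hIT τ (Ioc_subset_Icc_self hτ)
      apply tendsto_integral_filter_of_dominated_convergence
        (fun _ => (B + 1) * (B * 1 * B + B * 1 * B))
      · refine Eventually.of_forall fun n => ?_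
        exact ((mF n).comp measurable_prodMk_left).aestronglyMeasurable
      · filter_upwards [θev] with n hn
        exact (ae_restrict_iff' hKm).2 (Eventually.of_forall fun ω hω =>
          bnd2 τ hτ' ω hω n (hn τ hτ'))
      · exact integrableOn_const hKfin.ne
      · refine Eventually.of_forall fun ω => ?_
        have := ((θt τ hτ').const_sub (v τ (ω.1 + r * ω.2))).mul_const
          (φt τ ω.1 * (1 - |ω.2|) * c τ (ω.1 + r * ω.2)
          + φ τ ω.1 * (1 - |ω.2|) * ct τ (ω.1 + r * ω.2))
        simpa using this
  have bnd3 : ∀ τ, ∀ ω ∈ K, ∀ n,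
      ‖φ τ ω.1 * (1 - |ω.2|) * Sn n τ (ω.1 + r * ω.2)‖ ≤ B * 1 * B := by
    intro τ ω hω n
    rw [Real.norm_eq_abs, abs_mul, abs_mul]
    have := hσK ω hω
    have := bφ τ ω.1
    have := hB n τ (ω.1 + r * ω.2)
    gcongr
  have mS : ∀ n, Continuous (fun q : ℝ × (ℝ × ℝ) => φ q.1 q.2.1 * (1 - |q.2.2|) *
      Sn n q.1 (q.2.1 + r * q.2.2)) := fun n => by
    have := cS n; fun_prop
  have Td : Tendsto (fun n => ∫ τ in s..t, ∫ ω in K,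
        φ τ ω.1 * (1 - |ω.2|) * Sn n τ (ω.1 + r * ω.2)) atTop
      (𝓝 (∫ τ in s..t, ∫ ω in K, φ τ ω.1 * (1 - |ω.2|) * S τ (ω.1 + r * ω.2))) := by
    apply intervalIntegral.tendsto_integral_filter_of_dominated_convergence
      (fun _ => B * 1 * B * (volume K).toReal)
    · refine Eventually.of_forall fun n => ?_
      exact ((mS n).measurable.stronglyMeasurable.integral_prod_right'
        (ν := volume.restrict K)).aestronglyMeasurable
    · refine Eventually.of_forall fun n => ?_
      refine Eventually.of_forall fun τ hτ => ?_
      exact norm_setIntegral_le_of_norm_le_const hKfin (fun ω hω => bnd3 τ ω hω n)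
    · exact intervalIntegrable_const
    · refine Eventually.of_forall fun τ hτ => ?_
      rw [uIoc_of_le hst] at hτ
      have hτ' := hIT τ (Ioc_subset_Icc_self hτ)
      apply tendsto_integral_filter_of_dominated_convergence (fun _ => B * 1 * B)
      · refine Eventually.of_forall fun n => ?_
        exact ((mS n).measurable.comp measurable_prodMk_left).aestronglyMeasurable
      · refine Eventually.of_forall fun n => ?_
        exact (ae_restrict_iff' hKm).2 (Eventually.of_forall fun ω hω => bnd3 τ ω hω n)
      · exact integrableOn_const hKfin.ne
      · refine (ae_restrict_iff' hKm).2 (Eventually.of_forall fun ω hω => ?_)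
        apply Tendsto.const_mul
        rw [Metric.tendsto_nhds]
        intro e he
        filter_upwards [hS τ hτ' (e/2) (by linarith)] with n hn
        rw [Real.dist_eq]
        linarith [hn _ (mem ω hω)]
  refine le_of_tendsto (((((Tb t (right_mem_Icc.2 hst)).sub (Tb s (left_mem_Icc.2 hst))).sub Tc).sub
    Td).const_mul (r ^ 2)) (Eventually.of_forall fun n => ?_)
  refine (A0 n).trans (le_of_eq ?_)
  congr 1; ext τ; congr 1; ext x; ring

lemma tm_dct2 {Ω : Type*} [MeasurableSpace Ω] (ν : Measure Ω) [IsFiniteMeasure ν]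
    (F : ℝ → ℝ → Ω → ℝ) (F0 : ℝ → Ω → ℝ) (s t B : ℝ) (hst : s ≤ t)
    (hm : ∀ᶠ r in 𝓝[>] (0:ℝ), Measurable (fun p : ℝ × Ω => F r p.1 p.2))
    (hb : ∀ᶠ r in 𝓝[>] (0:ℝ), ∀ τ ∈ Icc s t, ∀ᵐ ω ∂ν, |F r τ ω| ≤ B)
    (hl : ∀ τ ∈ Icc s t, ∀ᵐ ω ∂ν, Tendsto (fun r => F r τ ω) (𝓝[>] 0) (𝓝 (F0 τ ω))) :
    Tendsto (fun r => ∫ τ in s..t, ∫ ω, F r τ ω ∂ν) (𝓝[>] 0) (𝓝 (∫ τ in s..t, ∫ ω, F0 τ ω ∂ν)) := by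
  apply intervalIntegral.tendsto_integral_filter_of_dominated_convergence
    (bound := fun _ => B * (ν univ).toReal)
  · filter_upwards [hm] with r hr
    exact (hr.stronglyMeasurable.integral_prod_right').aestronglyMeasurable
  · filter_upwards [hb] with r hr
    refine Eventually.of_forall fun τ hτ => ?_
    rw [uIoc_of_le hst] at hτ
    have := norm_integral_le_of_norm_le_const (μ := ν) (f := F r τ) (C := B)
      (hr τ ⟨hτ.1.le, hτ.2⟩)
    simpa [Measure.real] using this
  · exact intervalIntegrable_const
  · refine Eventually.of_forall fun τ hτ => ?_
    rw [uIoc_of_le hst] at hτ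
    have hτ' : τ ∈ Icc s t := ⟨hτ.1.le, hτ.2⟩
    apply tendsto_integral_filter_of_dominated_convergence (bound := fun _ => B)
    · filter_upwards [hm] with r hr
      exact (hr.comp measurable_prodMk_left).aestronglyMeasurable
    · filter_upwards [hb] with r hr
      exact hr τ hτ'
    · exact integrable_const _
    · exact hl τ hτ'

lemma tm_hat (h : ℝ → ℝ) (Y0 Y1 : ℝ) :
    ∫ ω in Icc Y0 Y1 ×ˢ Icc (-1:ℝ) 1, h ω.1 * (1 - |ω.2|) = ∫ x in Icc Y0 Y1, h x := by
  have : (volume : Measure (ℝ × ℝ)) = (volume : Measure ℝ).prod volume := rfl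
  rw [this, setIntegral_prod_mul (f := h) (g := fun σ : ℝ => 1 - |σ|)]
  have : ∫ σ in Icc (-1:ℝ) 1, (1 - |σ|) = 1 := by
    rw [integral_Icc_eq_integral_Ioc, ← intervalIntegral.integral_of_le (by norm_num)]
    rw [← intervalIntegral.integral_add_adjacent_intervals (b := 0)
      (Continuous.intervalIntegrable (by fun_prop) _ _)
      (Continuous.intervalIntegrable (by fun_prop) _ _)]
    have e1 : ∫ σ in (-1:ℝ)..0, (1 - |σ|) = ∫ σ in (-1:ℝ)..0, (1 + σ) := by
      apply intervalIntegral.integral_congr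
      intro σ hσ
      rw [uIcc_of_le (by norm_num)] at hσ
      simp only [abs_of_nonpos hσ.2]; ring
    have e2 : ∫ σ in (0:ℝ)..1, (1 - |σ|) = ∫ σ in (0:ℝ)..1, (1 - σ) := by
      apply intervalIntegral.integral_congr
      intro σ hσ
      rw [uIcc_of_le (by norm_num)] at hσ
      simp only [abs_of_nonneg hσ.1]
    rw [e1, e2, intervalIntegral.integral_add (by simp) (by simp),
      intervalIntegral.integral_sub (by simp) (by simp)]
    simp
    norm_num
  rw [this, mul_one]

lemma tm_sbp (φ v : ℝ → ℝ) (hφ : Continuous φ) (hv : Continuous v) (Y0 Y1 X0 X1 r : ℝ)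
    (hr : 0 < r) (hX0 : X0 < Y0 - r) (hX1 : Y1 < X1)
    (hs : ∀ x, x ∉ Icc Y0 Y1 → φ x = 0) :
    ∫ x in Icc Y0 Y1, φ x * (v (x + r) + v (x - r) - 2 * v x) =
      - ∫ x in Ioo X0 X1, (φ (x + r) - φ x) * (v (x + r) - v x) := by
  have hcs : HasCompactSupport φ := HasCompactSupport.intro isCompact_Icc hs
  have i1 : Integrable (fun x => φ x * (v (x + r) - v x)) :=
    (show Continuous (fun x => φ x * (v (x + r) - v x)) by fun_prop).integrable_of_hasCompactSupport
      (hcs.mul_right)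
  have i2 : Integrable (fun x => φ x * (v x - v (x - r))) :=
    (show Continuous (fun x => φ x * (v x - v (x - r))) by fun_prop).integrable_of_hasCompactSupport
      (hcs.mul_right)
  have i3 : Integrable (fun x => φ (x + r) * (v (x + r) - v x)) := by
    have := i2.comp_add_right r
    simpa using this
  have e1 : ∫ x in Icc Y0 Y1, φ x * (v (x + r) + v (x - r) - 2 * v x) =
      ∫ x, φ x * (v (x + r) + v (x - r) - 2 * v x) :=
    setIntegral_eq_integral_of_forall_compl_eq_zero (fun x hx => by rw [hs x hx, zero_mul])
  have e2 : ∫ x in Ioo X0 X1, (φ (x + r) - φ x) * (v (x + r) - v x) =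
      ∫ x, (φ (x + r) - φ x) * (v (x + r) - v x) := by
    apply setIntegral_eq_integral_of_forall_compl_eq_zero
    intro x hx
    have : x ≤ X0 ∨ X1 ≤ x := by
      by_contra h; push Not at h; exact hx ⟨h.1, h.2⟩
    rw [hs x (fun h => by rcases this with h' | h' <;> linarith [h.1, h.2]),
      hs (x + r) (fun h => by rcases this with h' | h' <;> linarith [h.1, h.2])]
    ring
  rw [e1, e2]
  have e3 : ∫ x, φ x * (v (x + r) + v (x - r) - 2 * v x) =
      (∫ x, φ x * (v (x + r) - v x)) - ∫ x, φ x * (v x - v (x - r)) := by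
    rw [← integral_sub i1 i2]; congr 1; ext x; ring
  have e4 : ∫ x, (φ (x + r) - φ x) * (v (x + r) - v x) =
      (∫ x, φ (x + r) * (v (x + r) - v x)) - ∫ x, φ x * (v (x + r) - v x) := by
    rw [← integral_sub i3 i1]; congr 1; ext x; ring
  have e5 : ∫ x, φ x * (v x - v (x - r)) = ∫ x, φ (x + r) * (v (x + r) - v x) := by
    rw [← integral_add_right_eq_self _ r]
    simp
  rw [e3, e4, e5, neg_sub]

lemma tm_A2le (v vt c S φ φt ct vx φx : ℝ → ℝ → ℝ) (Sn : ℕ → ℝ → ℝ → ℝ)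
    (hv : Continuous (fun p : ℝ × ℝ => v p.1 p.2))
    (hc : Continuous (fun p : ℝ × ℝ => c p.1 p.2))
    (hSn : ∀ n, Continuous (fun p : ℝ × ℝ => Sn n p.1 p.2)) (c0 : ℝ) (hc00 : 0 < c0)
    (hc0 : ∀ t x, c0 ≤ c t x)
    (hφ : Continuous (fun p : ℝ × ℝ => φ p.1 p.2)) (φ0 : ∀ t x, 0 ≤ φ t x)
    (T0 T1 X0 X1 Y0 Y1 s0 s t Lc Lφ : ℝ) (hs0 : T0 < s0) (hss : s0 < s) (hst : s ≤ t)
    (ht1 : t < T1) (hX0 : X0 < Y0) (hX1 : Y1 < X1) (hY : Y0 ≤ Y1)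
    (hL0 : 0 ≤ Lc) (hLφ0 : 0 ≤ Lφ)
    (hL : ∀ t ∈ Icc T0 T1, ∀ t' ∈ Icc T0 T1, ∀ x ∈ Icc X0 X1, |c t x - c t' x| ≤ Lc * |t - t'|)
    (hLφ : ∀ τ ∈ Icc s0 t, ∀ t' ∈ Icc s0 t, ∀ x ∈ Icc Y0 Y1, |φ τ x - φ t' x| ≤ Lφ * |τ - t'|)
    (hct : ∀ τ ∈ Icc s t, ∀ x ∈ Icc X0 X1, HasDerivAt (fun τ => c τ x) (ct τ x) τ)
    (hφt : ∀ τ ∈ Icc s t, ∀ x ∈ Icc Y0 Y1, HasDerivAt (fun τ => φ τ x) (φt τ x) τ)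
    (mct : Measurable (fun p : ℝ × ℝ => ct p.1 p.2))
    (mφt : Measurable (fun p : ℝ × ℝ => φt p.1 p.2))
    (mS : Measurable (fun p : ℝ × ℝ => S p.1 p.2))
    (B : ℝ) (hB : ∀ n t x, |Sn n t x| ≤ B)
    (bct : ∀ t x, |ct t x| ≤ B) (bφt : ∀ t x, |φt t x| ≤ B)
    (bv : ∀ t x, |v t x| ≤ B) (bc : ∀ t x, |c t x| ≤ B) (bφ : ∀ t x, |φ t x| ≤ B)
    (bS : ∀ t x, |S t x| ≤ B)
    (hS : ∀ t ∈ Icc T0 T1, ∀ e > 0, ∀ᶠ n in atTop, ∀ x ∈ Icc X0 X1, |Sn n t x - S t x| ≤ e)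
    (hvt : ∀ s ∈ Ioo T0 T1, ∀ x ∈ Ioo X0 X1, HasDerivAt (fun τ => v τ x) (vt s x) s)
    (hφs : ∀ t x, x ∉ Icc Y0 Y1 → φ t x = 0)
    (hφL : ∀ t x y, |φ t x - φ t y| ≤ B * |x - y|)
    (hvL : ∀ t x y, |v t x - v t y| ≤ B * |x - y|)
    (hφx : ∀ τ ∈ Icc s t, ∀ x ∈ Ioo X0 X1, HasDerivAt (φ τ) (φx τ x) x)
    (hvx : ∀ τ ∈ Icc s t, ∀ x ∈ Ioo X0 X1, HasDerivAt (v τ) (vx τ x) x)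
    (ctc : ∀ τ ∈ Icc s t, ∀ x ∈ Icc Y0 Y1, ContinuousAt (ct τ) x)
    (Sc : ∀ τ ∈ Icc s t, ∀ x ∈ Icc Y0 Y1, ContinuousAt (S τ) x)
    (hv2 : ∀ s ∈ Ioo T0 T1, ∀ x ∈ Ioo X0 X1, ∀ δ > 0, ∀ᶠ η in 𝓝[>] (0:ℝ),
        (c s x * vt s x - S s x - δ) * η ^ 2 ≤ v s (x + η) + v s (x - η) - 2 * v s x) :
    ((∫ x in Icc Y0 Y1, φ t x * c t x * v t x) - (∫ x in Icc Y0 Y1, φ s x * c s x * v s x)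
      - ∫ τ in s..t, ∫ x in Icc Y0 Y1, v τ x * (φt τ x * c τ x + φ τ x * ct τ x))
      - (∫ τ in s..t, ∫ x in Icc Y0 Y1, φ τ x * S τ x) ≤
    - ∫ τ in s..t, ∫ x in Ioo X0 X1, φx τ x * vx τ x := by
  have hK : IsCompact (Icc Y0 Y1 ×ˢ Icc (-1:ℝ) 1) := isCompact_Icc.prod isCompact_Icc
  have hB0 : 0 ≤ B := (abs_nonneg _).trans (bv 0 0)
  have hfin : IsFiniteMeasure ((volume : Measure (ℝ × ℝ)).restrict (Icc Y0 Y1 ×ˢ Icc (-1:ℝ) 1)) :=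
    ⟨by rw [Measure.restrict_apply_univ]; exact hK.measure_lt_top⟩
  have haeK : ∀ Q : ℝ × ℝ → Prop, (∀ ω ∈ Icc Y0 Y1 ×ˢ Icc (-1:ℝ) 1, Q ω) →
      ∀ᵐ ω ∂((volume : Measure (ℝ × ℝ)).restrict (Icc Y0 Y1 ×ˢ Icc (-1:ℝ) 1)), Q ω := fun Q h =>
    (ae_restrict_mem hK.measurableSet).mono h
  have hσK : ∀ ω ∈ Icc Y0 Y1 ×ˢ Icc (-1:ℝ) 1, |(1 - |ω.2| : ℝ)| ≤ 1 := fun ω hω => by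
    have := abs_le.2 hω.2
    rw [abs_le]; constructor <;> linarith [abs_nonneg ω.2]
  have hr0 : ∀ y σ : ℝ, Tendsto (fun r : ℝ => y + r * σ) (𝓝[>] 0) (𝓝 y) := fun y σ => by
    have : Continuous (fun r : ℝ => y + r * σ) := by fun_prop
    simpa using (this.tendsto 0).mono_left nhdsWithin_le_nhds
  have hvτ : ∀ τ, Continuous (v τ) := fun τ => hv.comp (Continuous.prodMk_right τ)
  have hcτ : ∀ τ, Continuous (c τ) := fun τ => hc.comp (Continuous.prodMk_right τ)
  have hφτ : ∀ τ, Continuous (φ τ) := fun τ => hφ.comp (Continuous.prodMk_right τ)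
  have l1 : ∀ τ, Tendsto (fun r : ℝ => ∫ ω in Icc Y0 Y1 ×ˢ Icc (-1:ℝ) 1,
        φ τ ω.1 * (1 - |ω.2|) * c τ (ω.1 + r * ω.2) * v τ (ω.1 + r * ω.2)) (𝓝[>] 0)
        (𝓝 (∫ x in Icc Y0 Y1, φ τ x * c τ x * v τ x)) := by
    intro τ
    have a1 := hvτ τ
    have a2 := hcτ τ
    have a3 := hφτ τ
    have : Continuous (fun r : ℝ => ∫ ω in Icc Y0 Y1 ×ˢ Icc (-1:ℝ) 1,
        φ τ ω.1 * (1 - |ω.2|) * c τ (ω.1 + r * ω.2) * v τ (ω.1 + r * ω.2)) :=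
      continuous_parametric_integral_of_continuous (f := fun (r : ℝ) (ω : ℝ × ℝ) =>
        φ τ ω.1 * (1 - |ω.2|) * c τ (ω.1 + r * ω.2) * v τ (ω.1 + r * ω.2))
        (by simp only [Function.uncurry_def]; fun_prop) hK
    have := (this.tendsto 0).mono_left (nhdsWithin_le_nhds (s := Ioi 0))
    rw [← tm_hat]
    convert this using 4 with ω
    simp; ring
  have l2 : Tendsto (fun r : ℝ => ∫ τ in s..t, ∫ ω in Icc Y0 Y1 ×ˢ Icc (-1:ℝ) 1, v τ (ω.1 + r * ω.2) *
         (φt τ ω.1 * (1 - |ω.2|) * c τ (ω.1 + r * ω.2)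
          + φ τ ω.1 * (1 - |ω.2|) * ct τ (ω.1 + r * ω.2))) (𝓝[>] 0)
      (𝓝 (∫ τ in s..t, ∫ x in Icc Y0 Y1, v τ x * (φt τ x * c τ x + φ τ x * ct τ x))) := by
    have := tm_dct2 ((volume : Measure (ℝ × ℝ)).restrict (Icc Y0 Y1 ×ˢ Icc (-1:ℝ) 1))
      (fun r τ ω => v τ (ω.1 + r * ω.2) *
         (φt τ ω.1 * (1 - |ω.2|) * c τ (ω.1 + r * ω.2)
          + φ τ ω.1 * (1 - |ω.2|) * ct τ (ω.1 + r * ω.2)))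
      (fun τ ω => v τ ω.1 *
         (φt τ ω.1 * (1 - |ω.2|) * c τ ω.1
          + φ τ ω.1 * (1 - |ω.2|) * ct τ ω.1)) s t (B * (B * 1 * B + B * 1 * B)) hst
      (Eventually.of_forall fun r => ?_) (Eventually.of_forall fun r τ hτ => haeK _ fun ω hω => ?_)
      (fun τ hτ => haeK _ fun ω hω => ?_)
    · have e : ∀ τ, ∫ ω in Icc Y0 Y1 ×ˢ Icc (-1:ℝ) 1, v τ ω.1 *
         (φt τ ω.1 * (1 - |ω.2|) * c τ ω.1
          + φ τ ω.1 * (1 - |ω.2|) * ct τ ω.1) =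
          ∫ x in Icc Y0 Y1, v τ x * (φt τ x * c τ x + φ τ x * ct τ x) := fun τ => by
        rw [← tm_hat]
        congr 1; ext ω; ring
      simp only [e] at this
      exact this
    · have m1 : Measurable (fun p : ℝ × ℝ × ℝ => (p.1, p.2.1 + r * p.2.2)) := by fun_prop
      have m2 : Measurable (fun p : ℝ × ℝ × ℝ => (p.1, p.2.1)) := by fun_prop
      have k1 := hv.measurable.comp m1
      have k2 := hc.measurable.comp m1
      have k3 := hφ.measurable.comp m2
      have k4 := mct.comp m1
      have k5 := mφt.comp m2
      have k6 : Measurable (fun p : ℝ × ℝ × ℝ => 1 - |p.2.2|) :=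
        (show Continuous (fun p : ℝ × ℝ × ℝ => 1 - |p.2.2|) by fun_prop).measurable
      exact k1.mul (((k5.mul k6).mul k2).add ((k3.mul k6).mul k4))
    · have := hσK ω hω
      simp only [abs_mul]
      refine mul_le_mul (bv _ _) ((abs_add_le _ _).trans ?_) (abs_nonneg _) hB0
      simp only [abs_mul]
      gcongr <;> first | exact bφt _ _ | exact bc _ _ | exact bφ _ _ | exact bct _ _
    · have a1 := (hvτ τ).continuousAt (x := ω.1) |>.tendsto.comp (hr0 ω.1 ω.2)
      have a2 := (hcτ τ).continuousAt (x := ω.1) |>.tendsto.comp (hr0 ω.1 ω.2)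
      have a3 := (ctc τ hτ ω.1 hω.1).tendsto.comp (hr0 ω.1 ω.2)
      exact a1.mul ((a2.const_mul _).add (a3.const_mul _))
  have l3 : Tendsto (fun r : ℝ => ∫ τ in s..t, ∫ ω in Icc Y0 Y1 ×ˢ Icc (-1:ℝ) 1,
        φ τ ω.1 * (1 - |ω.2|) * S τ (ω.1 + r * ω.2)) (𝓝[>] 0)
      (𝓝 (∫ τ in s..t, ∫ x in Icc Y0 Y1, φ τ x * S τ x)) := by
    have := tm_dct2 ((volume : Measure (ℝ × ℝ)).restrict (Icc Y0 Y1 ×ˢ Icc (-1:ℝ) 1))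
      (fun r τ ω => φ τ ω.1 * (1 - |ω.2|) * S τ (ω.1 + r * ω.2))
      (fun τ ω => φ τ ω.1 * (1 - |ω.2|) * S τ ω.1) s t (B * 1 * B) hst
      (Eventually.of_forall fun r => ?_) (Eventually.of_forall fun r τ hτ => haeK _ fun ω hω => ?_)
      (fun τ hτ => haeK _ fun ω hω => ?_)
    · have e : ∀ τ, ∫ ω in Icc Y0 Y1 ×ˢ Icc (-1:ℝ) 1,
           φ τ ω.1 * (1 - |ω.2|) * S τ ω.1 =
          ∫ x in Icc Y0 Y1, φ τ x * S τ x := fun τ => by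
        rw [← tm_hat]
        congr 1; ext ω; ring
      simp only [e] at this
      exact this
    · have m1 : Measurable (fun p : ℝ × ℝ × ℝ => (p.1, p.2.1 + r * p.2.2)) := by fun_prop
      have m2 : Measurable (fun p : ℝ × ℝ × ℝ => (p.1, p.2.1)) := by fun_prop
      have k3 := hφ.measurable.comp m2
      have k4 := mS.comp m1
      have k6 : Measurable (fun p : ℝ × ℝ × ℝ => 1 - |p.2.2|) :=
        (show Continuous (fun p : ℝ × ℝ × ℝ => 1 - |p.2.2|) by fun_prop).measurable
      exact (k3.mul k6).mul k4
    · have := hσK ω hω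
      simp only [abs_mul]
      gcongr <;> first | exact bφ _ _ | exact bS _ _
    · have a3 := (Sc τ hτ ω.1 hω.1).tendsto.comp (hr0 ω.1 ω.2)
      exact a3.const_mul _
  have hfin2 : IsFiniteMeasure ((volume : Measure ℝ).restrict (Ioo X0 X1)) :=
    ⟨by rw [Measure.restrict_apply_univ]; exact measure_Ioo_lt_top⟩
  have l4 : Tendsto (fun r : ℝ => ∫ τ in s..t, ∫ x in Ioo X0 X1,
        ((φ τ (x + r) - φ τ x) / r) * ((v τ (x + r) - v τ x) / r)) (𝓝[>] 0)
      (𝓝 (∫ τ in s..t, ∫ x in Ioo X0 X1, φx τ x * vx τ x)) := by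
    have quo : ∀ g : ℝ → ℝ, (∀ x y, |g x - g y| ≤ B * |x - y|) → ∀ r > 0, ∀ x,
        |(g (x + r) - g x) / r| ≤ B := fun g hg r hr x => by
      rw [abs_div, abs_of_pos hr, div_le_iff₀ hr]
      simpa [abs_of_pos hr] using hg (x + r) x
    have lim : ∀ (g : ℝ → ℝ) g' x, HasDerivAt g g' x →
        Tendsto (fun r => (g (x + r) - g x) / r) (𝓝[>] 0) (𝓝 g') := fun g g' x h => by
      have := h.tendsto_slope_zero_right
      refine this.congr fun r => ?_
      rw [smul_eq_mul]; ring
    have hpos : ∀ᶠ r in 𝓝[>] (0:ℝ), 0 < r := eventually_mem_nhdsWithin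
    refine tm_dct2 _ _ _ s t (B * B) hst (Eventually.of_forall fun r => ?_)
      (hpos.mono fun r hr τ hτ => Eventually.of_forall fun x => ?_)
      (fun τ hτ => (ae_restrict_mem measurableSet_Ioo).mono fun x hx => ?_)
    · have m1 : Measurable (fun p : ℝ × ℝ => (p.1, p.2 + r)) := by fun_prop
      have k1 := hv.measurable.comp m1
      have k3 := hφ.measurable.comp m1
      exact ((k3.sub hφ.measurable).div_const r).mul ((k1.sub hv.measurable).div_const r)
    · rw [abs_mul]
      exact mul_le_mul (quo _ (hφL τ) r hr x) (quo _ (hvL τ) r hr x) (abs_nonneg _) hB0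
    · exact (lim _ _ _ (hφx τ hτ x hx)).mul (lim _ _ _ (hvx τ hτ x hx))
  refine le_of_tendsto_of_tendsto ((((l1 t).sub (l1 s)).sub l2).sub l3) l4.neg ?_
  have e1 : ∀ᶠ r in 𝓝[>] (0:ℝ), r < min (Y0 - X0) (X1 - Y1) :=
    eventually_nhdsWithin_of_eventually_nhds
      (eventually_lt_nhds (lt_min (by linarith) (by linarith)))
  filter_upwards [e1, (eventually_mem_nhdsWithin : ∀ᶠ r in 𝓝[>] (0:ℝ), r ∈ Ioi 0)] with r hr hr1
  have hr1 : 0 < r := hr1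
  have hr2 := lt_min_iff.1 hr
  have := tm_A1 v vt c S φ φt ct Sn hv hc hSn c0 hc00 hc0 hφ φ0 T0 T1 X0 X1 Y0 Y1 r s0 s t Lc Lφ
    hs0 hss hst ht1 hr1 (by linarith) (by linarith) hY hL0 hLφ0 hL hLφ hct hφt mct mφt B hB bct bφt
    bv bc bφ hS hvt hv2
  have e2 : ∀ τ, ∫ x in Icc Y0 Y1, φ τ x * (v τ (x + r) + v τ (x - r) - 2 * v τ x) =
      r ^ 2 * (- ∫ x in Ioo X0 X1, ((φ τ (x + r) - φ τ x) / r) * ((v τ (x + r) - v τ x) / r)) := by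
    intro τ
    rw [tm_sbp _ _ (hφτ τ) (hvτ τ) Y0 Y1 X0 X1 r hr1 (by linarith) (by linarith) (hφs τ),
      mul_neg, ← integral_const_mul]
    congr 2; ext x
    field_simp
  simp only [e2] at this
  rw [intervalIntegral.integral_const_mul, intervalIntegral.integral_neg] at this
  exact le_of_mul_le_mul_left this (by positivity)

lemma tm_lip (f f' : ℝ → ℝ) (A B L : ℝ) (hf : ∀ x ∈ Icc A B, HasDerivAt f (f' x) x)
    (hL : ∀ x ∈ Icc A B, |f' x| ≤ L) : ∀ x ∈ Icc A B, ∀ y ∈ Icc A B, |f x - f y| ≤ L * |x - y| := by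
  intro x hx y hy
  exact (convex_Icc A B).norm_image_sub_le_of_norm_hasDerivWithin_le
    (fun z hz => (hf z hz).hasDerivWithinAt) hL hy hx

lemma tm_d2 (v vx : ℝ → ℝ) (x m : ℝ) (h1 : ∀ᶠ y in 𝓝 x, HasDerivAt v (vx y) y)
    (h2 : HasDerivAt vx m x) (δ : ℝ) (hδ : 0 < δ) :
    ∀ᶠ η in 𝓝[>] (0:ℝ), |v (x + η) + v (x - η) - 2 * v x - m * η ^ 2| ≤ δ * η ^ 2 := by
  have h3 := h2.isLittleO.def (show (0:ℝ) < δ / 2 by linarith)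
  obtain ⟨d, hd, hd2⟩ := Metric.eventually_nhds_iff_ball.1 (h1.and h3)
  have : ∀ᶠ η in 𝓝[>] (0:ℝ), η < d :=
    eventually_nhdsWithin_of_eventually_nhds (eventually_lt_nhds hd)
  filter_upwards [this, (eventually_mem_nhdsWithin : ∀ᶠ r in 𝓝[>] (0:ℝ), r ∈ Ioi 0)] with η hη hη0
  have hη0 : 0 < η := hη0
  have key := tm_lip (fun z => v (x + z) + v (x - z) - m * z ^ 2)
    (fun z => vx (x + z) - vx (x - z) - m * (2 * z)) 0 η (δ * η) ?_ ?_ η ⟨hη0.le, le_rfl⟩ 0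
    ⟨le_rfl, hη0.le⟩
  · simp only [add_zero, sub_zero, abs_of_pos hη0] at key
    rw [show v (x + η) + v (x - η) - 2 * v x - m * η ^ 2 =
      v (x + η) + v (x - η) - m * η ^ 2 - (v x + v x - m * 0 ^ 2) by ring]
    refine key.trans (le_of_eq (by ring))
  · intro z hz
    have b1 := (hd2 (x + z) (by rw [Metric.mem_ball, Real.dist_eq, abs_lt]; constructor <;> linarith [hz.1, hz.2])).1
    have b2 := (hd2 (x - z) (by rw [Metric.mem_ball, Real.dist_eq, abs_lt]; constructor <;> linarith [hz.1, hz.2])).1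
    have c1 : HasDerivAt (fun z => v (x + z)) (vx (x + z)) z := by
      simpa using b1.comp_const_add x z
    have c2 : HasDerivAt (fun z => v (x - z)) (-vx (x - z)) z := by
      simpa using b2.comp_const_sub x z
    have c3 : HasDerivAt (fun z : ℝ => m * z ^ 2) (m * (2 * z)) z := by
      simpa using (hasDerivAt_pow 2 z).const_mul m
    exact (c1.add c2).sub c3
  · intro z hz
    have b1 := (hd2 (x + z) (by rw [Metric.mem_ball, Real.dist_eq, abs_lt]; constructor <;> linarith [hz.1, hz.2])).2
    have b2 := (hd2 (x - z) (by rw [Metric.mem_ball, Real.dist_eq, abs_lt]; constructor <;> linarith [hz.1, hz.2])).2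
    simp only [smul_eq_mul, Real.norm_eq_abs, add_sub_cancel_left, sub_sub_cancel_left, abs_neg,
      abs_of_nonneg hz.1] at b1 b2
    rw [show vx (x + z) - vx (x - z) - m * (2 * z) =
      (vx (x + z) - vx x - z * m) - (vx (x - z) - vx x - -z * m) by ring]
    refine (abs_sub _ _).trans ?_
    nlinarith [hz.2]

noncomputable def tm_cl (A B x : ℝ) : ℝ := max A (min B x)

lemma tm_cl_cont (A B : ℝ) : Continuous (tm_cl A B) := by unfold tm_cl; fun_prop

lemma tm_cl_mem (A B x : ℝ) (h : A ≤ B) : tm_cl A B x ∈ Icc A B :=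
  ⟨le_max_left _ _, max_le h (min_le_left _ _)⟩

lemma tm_cl_id (A B x : ℝ) (h : x ∈ Icc A B) : tm_cl A B x = x := by
  unfold tm_cl; rw [min_eq_right h.2, max_eq_right h.1]

lemma tm_cl_lip (A B x y : ℝ) : |tm_cl A B x - tm_cl A B y| ≤ |x - y| := by
  unfold tm_cl
  have h1 := abs_max_sub_max_le_max A (min B x) A (min B y)
  have h2 := abs_min_sub_min_le_max B x B y
  simp only [sub_self, abs_zero, abs_nonneg, max_eq_right] at h1 h2
  exact h1.trans h2

lemma tm_dq (q q' : ℝ → ℝ) (X0 X1 Z0 Z1 : ℝ) (h0 : X0 < Z0) (h1 : Z1 < X1)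
    (hq : ∀ x ∈ Icc X0 X1, HasDerivAt q (q' x) x) (hc : ContinuousOn q' (Icc X0 X1)) (e : ℝ)
    (he : 0 < e) :
    ∀ᶠ n : ℕ in atTop, ∀ x ∈ Icc Z0 Z1,
      |((n:ℝ) + 1) * (q (tm_cl X0 X1 (x + 1 / ((n:ℝ) + 1))) - q (tm_cl X0 X1 x)) - q' x| ≤ e := by
  have huc := isCompact_Icc.uniformContinuousOn_of_continuous hc
  obtain ⟨d, hd, hd2⟩ := Metric.uniformContinuousOn_iff.1 huc e he
  have : ∀ᶠ n : ℕ in atTop, 1 / ((n:ℝ) + 1) < min d (X1 - Z1) :=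
    tendsto_one_div_add_atTop_nhds_zero_nat.eventually
      (eventually_lt_nhds (lt_min hd (by linarith)))
  filter_upwards [this] with n hn x hx
  obtain ⟨hn1, hn2⟩ := lt_min_iff.1 hn
  have hp : (0:ℝ) < 1 / ((n:ℝ) + 1) := by positivity
  set η := 1 / ((n:ℝ) + 1) with hη
  have hn3 : (n:ℝ) + 1 = 1 / η := by rw [hη]; field_simp
  rw [tm_cl_id _ _ _ ⟨by linarith [hx.1], by linarith [hx.2]⟩,
    tm_cl_id _ _ _ ⟨by linarith [hx.1], by linarith [hx.2]⟩, hn3]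
  have key := tm_lip (fun y => q y - q' x * y) (fun y => q' y - q' x) x (x + η) e ?_ ?_ (x + η)
    ⟨by linarith, le_rfl⟩ x ⟨le_rfl, by linarith⟩
  · simp only [add_sub_cancel_left, abs_of_pos hp] at key
    rw [show 1 / η * (q (x + η) - q x) - q' x =
      (q (x + η) - q' x * (x + η) - (q x - q' x * x)) / η by field_simp; ring, abs_div, abs_of_pos hp,
      div_le_iff₀ hp]
    exact key
  · intro y hy
    have := (hq y ⟨by linarith [hx.1, hy.1], by linarith [hx.2, hy.2]⟩).sub
      ((hasDerivAt_id y).const_mul (q' x))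
    rw [mul_one] at this
    exact this
  · intro y hy
    have := hd2 y ⟨by linarith [hx.1, hy.1], by linarith [hx.2, hy.2]⟩ x
      ⟨by linarith [hx.1, hy.1], by linarith [hx.2, hy.2]⟩
      (by rw [Real.dist_eq, abs_lt]; constructor <;> linarith [hy.1, hy.2])
    rw [Real.dist_eq] at this
    exact this.le

lemma tm_A2 (v vt c S φ φt ct vx φx : ℝ → ℝ → ℝ) (Sn : ℕ → ℝ → ℝ → ℝ)
    (hv : Continuous (fun p : ℝ × ℝ => v p.1 p.2))
    (hc : Continuous (fun p : ℝ × ℝ => c p.1 p.2))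
    (hSn : ∀ n, Continuous (fun p : ℝ × ℝ => Sn n p.1 p.2)) (c0 : ℝ) (hc00 : 0 < c0)
    (hc0 : ∀ t x, c0 ≤ c t x)
    (hφ : Continuous (fun p : ℝ × ℝ => φ p.1 p.2)) (φ0 : ∀ t x, 0 ≤ φ t x)
    (T0 T1 X0 X1 Y0 Y1 s0 s t Lc Lφ : ℝ) (hs0 : T0 < s0) (hss : s0 < s) (hst : s ≤ t)
    (ht1 : t < T1) (hX0 : X0 < Y0) (hX1 : Y1 < X1) (hY : Y0 ≤ Y1)
    (hL0 : 0 ≤ Lc) (hLφ0 : 0 ≤ Lφ)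
    (hL : ∀ t ∈ Icc T0 T1, ∀ t' ∈ Icc T0 T1, ∀ x ∈ Icc X0 X1, |c t x - c t' x| ≤ Lc * |t - t'|)
    (hLφ : ∀ τ ∈ Icc s0 t, ∀ t' ∈ Icc s0 t, ∀ x ∈ Icc Y0 Y1, |φ τ x - φ t' x| ≤ Lφ * |τ - t'|)
    (hct : ∀ τ ∈ Icc s t, ∀ x ∈ Icc X0 X1, HasDerivAt (fun τ => c τ x) (ct τ x) τ)
    (hφt : ∀ τ ∈ Icc s t, ∀ x ∈ Icc Y0 Y1, HasDerivAt (fun τ => φ τ x) (φt τ x) τ)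
    (mct : Measurable (fun p : ℝ × ℝ => ct p.1 p.2))
    (mφt : Measurable (fun p : ℝ × ℝ => φt p.1 p.2))
    (mS : Measurable (fun p : ℝ × ℝ => S p.1 p.2))
    (B : ℝ) (hB : ∀ n t x, |Sn n t x| ≤ B)
    (bct : ∀ t x, |ct t x| ≤ B) (bφt : ∀ t x, |φt t x| ≤ B)
    (bv : ∀ t x, |v t x| ≤ B) (bc : ∀ t x, |c t x| ≤ B) (bφ : ∀ t x, |φ t x| ≤ B)
    (bS : ∀ t x, |S t x| ≤ B)
    (hS : ∀ t ∈ Icc T0 T1, ∀ e > 0, ∀ᶠ n in atTop, ∀ x ∈ Icc X0 X1, |Sn n t x - S t x| ≤ e)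
    (hvt : ∀ s ∈ Ioo T0 T1, ∀ x ∈ Ioo X0 X1, HasDerivAt (fun τ => v τ x) (vt s x) s)
    (hφs : ∀ t x, x ∉ Icc Y0 Y1 → φ t x = 0)
    (hφL : ∀ t x y, |φ t x - φ t y| ≤ B * |x - y|)
    (hvL : ∀ t x y, |v t x - v t y| ≤ B * |x - y|)
    (hφx : ∀ τ ∈ Icc s t, ∀ x ∈ Ioo X0 X1, HasDerivAt (φ τ) (φx τ x) x)
    (hvx : ∀ τ ∈ Icc s t, ∀ x ∈ Ioo X0 X1, HasDerivAt (v τ) (vx τ x) x)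
    (ctc : ∀ τ ∈ Icc s t, ∀ x ∈ Icc Y0 Y1, ContinuousAt (ct τ) x)
    (Sc : ∀ τ ∈ Icc s t, ∀ x ∈ Icc Y0 Y1, ContinuousAt (S τ) x)
    (hv2 : ∀ s ∈ Ioo T0 T1, ∀ x ∈ Ioo X0 X1, ∀ δ > 0, ∀ᶠ η in 𝓝[>] (0:ℝ),
        |v s (x + η) + v s (x - η) - 2 * v s x - (c s x * vt s x - S s x) * η ^ 2| ≤ δ * η ^ 2) :
    ((∫ x in Icc Y0 Y1, φ t x * c t x * v t x) - (∫ x in Icc Y0 Y1, φ s x * c s x * v s x)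
      - ∫ τ in s..t, ∫ x in Icc Y0 Y1, v τ x * (φt τ x * c τ x + φ τ x * ct τ x))
      - (∫ τ in s..t, ∫ x in Icc Y0 Y1, φ τ x * S τ x) =
    - ∫ τ in s..t, ∫ x in Ioo X0 X1, φx τ x * vx τ x := by
  apply le_antisymm
  · exact tm_A2le v vt c S φ φt ct vx φx Sn hv hc hSn c0 hc00 hc0 hφ φ0 T0 T1 X0 X1 Y0 Y1 s0 s t Lc Lφ
      hs0 hss hst ht1 hX0 hX1 hY hL0 hLφ0 hL hLφ hct hφt mct mφt mS B hB bct bφt bv bc bφ bS hS hvt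
      hφs hφL hvL hφx hvx ctc Sc (fun s hs x hx δ hδ => (hv2 s hs x hx δ hδ).mono fun η h => by
        have := (abs_le.1 h).1; nlinarith)
  · have := tm_A2le (fun t x => -v t x) (fun t x => -vt t x) c (fun t x => -S t x) φ φt ct
      (fun t x => -vx t x) φx (fun n t x => -Sn n t x) hv.neg hc (fun n => (hSn n).neg) c0 hc00 hc0 hφ φ0
      T0 T1 X0 X1 Y0 Y1 s0 s t Lc Lφ
      hs0 hss hst ht1 hX0 hX1 hY hL0 hLφ0 hL hLφ hct hφt mct mφt mS.neg B
      (fun n t x => by rw [abs_neg]; exact hB n t x) bct bφt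
      (fun t x => by rw [abs_neg]; exact bv t x) bc bφ
      (fun t x => by rw [abs_neg]; exact bS t x)
      (fun t ht e he => (hS t ht e he).mono fun n h x hx => by
        have := h x hx
        rwa [neg_sub_neg, abs_sub_comm])
      (fun s hs x hx => (hvt s hs x hx).neg)
      hφs hφL (fun t x y => by
        have := hvL t x y
        rwa [neg_sub_neg, abs_sub_comm]) hφx (fun τ hτ x hx => (hvx τ hτ x hx).neg) ctc
      (fun τ hτ x hx => (Sc τ hτ x hx).neg) (fun s hs x hx δ hδ => (hv2 s hs x hx δ hδ).mono fun η h => by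
        have := (abs_le.1 h).2; nlinarith)
    simp only [mul_neg, neg_mul, integral_neg, intervalIntegral.integral_neg] at this
    linarith

structure TmLaw (P μ P1 μ1 : ℝ → ℝ) : Prop where
  dP : ∀ y, 0 < y → HasDerivAt P (P1 y) y
  dμ : ∀ y, 0 < y → HasDerivAt μ (μ1 y) y
  cP1 : ContinuousOn P1 (Ioi 0)
  cμ1 : ContinuousOn μ1 (Ioi 0)
  μpos : ∀ y, 0 < y → 0 < μ y

structure TmRect (P μ : ℝ → ℝ) (ρ v ρt ρx vt vx : ℝ → ℝ → ℝ) (T0 T1 X0 X1 N : ℝ) : Prop where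
  hT : T0 < T1
  hX : X0 < X1
  ρ_pos : ∀ t ∈ Icc T0 T1, ∀ x ∈ Icc X0 X1, 0 < ρ t x
  ρ_cont : ContinuousOn (fun p : ℝ × ℝ => ρ p.1 p.2) (Icc T0 T1 ×ˢ Icc X0 X1)
  v_cont : ContinuousOn (fun p : ℝ × ℝ => v p.1 p.2) (Icc T0 T1 ×ˢ Icc X0 X1)
  hρt : ∀ t ∈ Icc T0 T1, ∀ x ∈ Icc X0 X1, HasDerivAt (fun s => ρ s x) (ρt t x) t
  hρx : ∀ t ∈ Icc T0 T1, ∀ x ∈ Icc X0 X1, HasDerivAt (fun y => ρ t y) (ρx t x) x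
  hvt : ∀ t ∈ Icc T0 T1, ∀ x ∈ Icc X0 X1, HasDerivAt (fun s => v s x) (vt t x) t
  hvx : ∀ t ∈ Icc T0 T1, ∀ x ∈ Icc X0 X1, HasDerivAt (fun y => v t y) (vx t x) x
  ρx_cont : ∀ t ∈ Icc T0 T1, ContinuousOn (ρx t) (Icc X0 X1)
  vx_cont : ∀ t ∈ Icc T0 T1, ContinuousOn (vx t) (Icc X0 X1)
  bρx : ∀ t ∈ Icc T0 T1, ∀ x ∈ Icc X0 X1, |ρx t x| ≤ N
  bvx : ∀ t ∈ Icc T0 T1, ∀ x ∈ Icc X0 X1, |vx t x| ≤ N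
  mass : ∀ t ∈ Icc T0 T1, ∀ x ∈ Icc X0 X1, ρt t x + (ρx t x * v t x + ρ t x * vx t x) = 0
  mom : ∀ t ∈ Icc T0 T1, ∀ x ∈ Icc X0 X1,
    HasDerivAt (fun y => μ (ρ t y) * vx t y - P (ρ t y)) (ρ t x * (vt t x + v t x * vx t x)) x

def TmBd {α : Type*} (f : α → ℝ) : Prop := ∃ B, ∀ a, |f a| ≤ B

lemma TmBd.mul {α : Type*} {f g : α → ℝ} (hf : TmBd f) (hg : TmBd g) :
    TmBd (fun a => f a * g a) := by
  obtain ⟨B, hB⟩ := hf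
  obtain ⟨C, hC⟩ := hg
  exact ⟨B * C, fun a => by
    rw [abs_mul]
    exact mul_le_mul (hB a) (hC a) (abs_nonneg _) ((abs_nonneg _).trans (hB a))⟩

lemma TmBd.add {α : Type*} {f g : α → ℝ} (hf : TmBd f) (hg : TmBd g) :
    TmBd (fun a => f a + g a) := by
  obtain ⟨B, hB⟩ := hf
  obtain ⟨C, hC⟩ := hg
  exact ⟨B + C, fun a => (abs_add_le _ _).trans (add_le_add (hB a) (hC a))⟩

lemma TmBd.neg {α : Type*} {f : α → ℝ} (hf : TmBd f) : TmBd (fun a => - f a) := by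
  obtain ⟨B, hB⟩ := hf
  exact ⟨B, fun a => by rw [abs_neg]; exact hB a⟩

lemma TmBd.sub {α : Type*} {f g : α → ℝ} (hf : TmBd f) (hg : TmBd g) :
    TmBd (fun a => f a - g a) := by
  simpa only [sub_eq_add_neg] using hf.add hg.neg

lemma TmBd.comp {α β : Type*} {f : α → ℝ} (hf : TmBd f) (g : β → α) : TmBd (fun a => f (g a)) := by
  obtain ⟨B, hB⟩ := hf
  exact ⟨B, fun a => hB (g a)⟩

lemma tm_cl_bd (q : ℝ × ℝ → ℝ) (T0 T1 X0 X1 : ℝ) (hT : T0 ≤ T1) (hX : X0 ≤ X1)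
    (hq : ContinuousOn q (Icc T0 T1 ×ˢ Icc X0 X1)) :
    TmBd (fun p : ℝ × ℝ => q (tm_cl T0 T1 p.1, tm_cl X0 X1 p.2)) := by
  obtain ⟨B, hB⟩ := (isCompact_Icc.prod isCompact_Icc).exists_bound_of_continuousOn hq
  exact ⟨B, fun p => hB _ ⟨tm_cl_mem _ _ _ hT, tm_cl_mem _ _ _ hX⟩⟩

lemma tm_cl_cts (q : ℝ × ℝ → ℝ) (T0 T1 X0 X1 : ℝ) (hT : T0 ≤ T1) (hX : X0 ≤ X1)
    (hq : ContinuousOn q (Icc T0 T1 ×ˢ Icc X0 X1)) :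
    Continuous (fun p : ℝ × ℝ => q (tm_cl T0 T1 p.1, tm_cl X0 X1 p.2)) :=
  hq.comp_continuous (((tm_cl_cont _ _).comp continuous_fst).prodMk
    ((tm_cl_cont _ _).comp continuous_snd)) fun _ => ⟨tm_cl_mem _ _ _ hT, tm_cl_mem _ _ _ hX⟩

lemma tm_ii {Ω : Type*} [MeasurableSpace Ω] (ν : Measure Ω) [IsFiniteMeasure ν] (F : ℝ → Ω → ℝ)
    (hm : Measurable (fun p : ℝ × Ω => F p.1 p.2)) (hb : TmBd (fun p : ℝ × Ω => F p.1 p.2))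
    (s t : ℝ) :
    IntervalIntegrable (fun τ => ∫ ω, F τ ω ∂ν) volume s t := by
  obtain ⟨B, hB⟩ := hb
  apply (intervalIntegrable_const (c := B * (ν univ).toReal)).mono_fun
  · exact (hm.stronglyMeasurable.integral_prod_right').aestronglyMeasurable
  · refine Eventually.of_forall fun τ => ?_
    have := norm_integral_le_of_norm_le_const (μ := ν) (f := F τ) (C := B)
      (Eventually.of_forall fun ω => hB (τ, ω))
    refine le_trans ?_ (le_abs_self _)
    simpa [Measure.real] using this

lemma tm_lim_ext (q : ℝ → ℝ → ℝ) (q' : ℝ → ℝ → ℝ) (T0 T1 X0 X1 Z0 Z1 N : ℝ) (hT : T0 ≤ T1)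
    (h0 : X0 < Z0) (h1 : Z1 < X1) (hZ : Z0 ≤ Z1)
    (hqc : ContinuousOn (fun p : ℝ × ℝ => q p.1 p.2) (Icc T0 T1 ×ˢ Icc X0 X1))
    (hq : ∀ t ∈ Icc T0 T1, ∀ x ∈ Icc X0 X1, HasDerivAt (fun y => q t y) (q' t x) x)
    (hc : ∀ t ∈ Icc T0 T1, ContinuousOn (q' t) (Icc X0 X1))
    (hN : ∀ t ∈ Icc T0 T1, ∀ x ∈ Icc X0 X1, |q' t x| ≤ N) :
    ∃ pn : ℕ → ℝ → ℝ → ℝ, (∀ n, Continuous (fun p : ℝ × ℝ => pn n p.1 p.2)) ∧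
      (∀ n t x, |pn n t x| ≤ N) ∧
      (∀ t, ∀ e > 0, ∀ᶠ n in atTop, ∀ x,
         |pn n t x - q' (tm_cl T0 T1 t) (tm_cl Z0 Z1 x)| ≤ e) ∧
      Measurable (fun p : ℝ × ℝ => q' (tm_cl T0 T1 p.1) (tm_cl Z0 Z1 p.2)) ∧
      (∀ t x y, |q (tm_cl T0 T1 t) (tm_cl X0 X1 x) - q (tm_cl T0 T1 t) (tm_cl X0 X1 y)|
        ≤ N * |x - y|) := by
  have hX : X0 ≤ X1 := by linarith
  have hlip : ∀ t x y, |q (tm_cl T0 T1 t) (tm_cl X0 X1 x) - q (tm_cl T0 T1 t) (tm_cl X0 X1 y)|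
        ≤ N * |x - y| := fun t x y => by
    have ht := tm_cl_mem T0 T1 t hT
    have hN0 : 0 ≤ N := (abs_nonneg _).trans (hN _ ht X0 ⟨le_rfl, hX⟩)
    exact (tm_lip _ _ X0 X1 N (hq _ ht) (hN _ ht) _ (tm_cl_mem _ _ x hX) _
      (tm_cl_mem _ _ y hX)).trans (mul_le_mul_of_nonneg_left (tm_cl_lip _ _ _ _) hN0)
  have hcts := tm_cl_cts _ T0 T1 X0 X1 hT hX hqc
  set pn : ℕ → ℝ → ℝ → ℝ := fun n t x => ((n:ℝ) + 1) *
    (q (tm_cl T0 T1 t) (tm_cl X0 X1 (tm_cl Z0 Z1 x + 1 / ((n:ℝ) + 1))) -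
     q (tm_cl T0 T1 t) (tm_cl X0 X1 (tm_cl Z0 Z1 x))) with hpn
  have hclZ := tm_cl_cont Z0 Z1
  have c1 : ∀ n, Continuous (fun p : ℝ × ℝ => pn n p.1 p.2) := fun n => by
    have a1 := hcts.comp (show Continuous (fun p : ℝ × ℝ => (p.1, tm_cl Z0 Z1 p.2 + 1 / ((n:ℝ) + 1)))
      by fun_prop)
    have a2 := hcts.comp (show Continuous (fun p : ℝ × ℝ => (p.1, tm_cl Z0 Z1 p.2))
      by fun_prop)
    exact (a1.sub a2).const_mul _
  have c2 : ∀ t, ∀ e > 0, ∀ᶠ n in atTop, ∀ x,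
         |pn n t x - q' (tm_cl T0 T1 t) (tm_cl Z0 Z1 x)| ≤ e := fun t e he => by
    have ht := tm_cl_mem T0 T1 t hT
    filter_upwards [tm_dq _ _ X0 X1 Z0 Z1 h0 h1 (hq _ ht) (hc _ ht) e he] with n hn x
    exact hn _ (tm_cl_mem _ _ _ hZ)
  refine ⟨pn, c1, fun n t x => ?_, c2, ?_, hlip⟩
  · have hp : (0:ℝ) < (n:ℝ) + 1 := by positivity
    have := hlip t (tm_cl Z0 Z1 x + 1 / ((n:ℝ) + 1)) (tm_cl Z0 Z1 x)
    rw [add_sub_cancel_left, abs_of_pos (show (0:ℝ) < 1 / ((n:ℝ) + 1) by positivity)] at this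
    simp only [hpn]
    rw [abs_mul, abs_of_pos hp]
    calc _ ≤ ((n:ℝ) + 1) * (N * (1 / ((n:ℝ) + 1))) := mul_le_mul_of_nonneg_left this hp.le
      _ = N := by field_simp
  · refine measurable_of_tendsto_metrizable (fun n => (c1 n).measurable) ?_
    rw [tendsto_pi_nhds]
    intro p
    rw [Metric.tendsto_nhds]
    intro e he
    filter_upwards [c2 p.1 (e/2) (by linarith)] with n hn
    rw [Real.dist_eq]
    exact (hn p.2).trans_lt (by linarith)

lemma tm_vxx {P μ P1 μ1 : ℝ → ℝ} (hl : TmLaw P μ P1 μ1) {ρ v ρx vt vx : ℝ → ℝ → ℝ}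
    (t x : ℝ) (hpos : 0 < ρ t x) (hρx : HasDerivAt (fun y => ρ t y) (ρx t x) x)
    (hpe : ∀ᶠ y in 𝓝 x, 0 < ρ t y)
    (hm : HasDerivAt (fun y => μ (ρ t y) * vx t y - P (ρ t y)) (ρ t x * (vt t x + v t x * vx t x)) x) :
    HasDerivAt (vx t) ((ρ t x / μ (ρ t x)) * vt t x - ((μ1 (ρ t x) / μ (ρ t x)) * ρx t x * vx t x
       - (P1 (ρ t x) / μ (ρ t x)) * ρx t x - (ρ t x * v t x / μ (ρ t x)) * vx t x)) x := by
  have hμx := hl.μpos _ hpos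
  have d1 : HasDerivAt (fun y => P (ρ t y)) (P1 (ρ t x) * ρx t x) x :=
    (hl.dP _ hpos).comp x hρx
  have d2 : HasDerivAt (fun y => μ (ρ t y)) (μ1 (ρ t x) * ρx t x) x :=
    (hl.dμ _ hpos).comp x hρx
  have d3 := (hm.add d1).div d2 hμx.ne'
  refine (d3.congr_of_eventuallyEq ?_).congr_deriv ?_
  · filter_upwards [hpe] with y hy
    have := (hl.μpos _ hy).ne'
    simp only [Pi.div_apply, Pi.add_apply]
    field_simp; ring
  · simp only [Pi.add_apply]
    field_simp; ring

lemma tm_A3 {P μ P1 μ1 : ℝ → ℝ} (hl : TmLaw P μ P1 μ1) {ρ v ρt ρx vt vx : ℝ → ℝ → ℝ}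
    {T0 T1 X0 X1 N : ℝ} (h : TmRect P μ ρ v ρt ρx vt vx T0 T1 X0 X1 N)
    (ψ ψt ψx : ℝ → ℝ → ℝ) (Y0 Y1 s t Bψ : ℝ) (hs : T0 < s) (hst : s ≤ t) (ht : t < T1)
    (hX0 : X0 < Y0) (hX1 : Y1 < X1) (hY : Y0 ≤ Y1)
    (cψ : Continuous (fun p : ℝ × ℝ => ψ p.1 p.2))
    (cψt : Continuous (fun p : ℝ × ℝ => ψt p.1 p.2))
    (cψx : Continuous (fun p : ℝ × ℝ => ψx p.1 p.2))
    (ψ0 : ∀ t x, 0 ≤ ψ t x)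
    (bψ : ∀ t x, |ψ t x| ≤ Bψ) (bψt : ∀ t x, |ψt t x| ≤ Bψ) (bψx : ∀ t x, |ψx t x| ≤ Bψ)
    (hψs : ∀ t x, x ∉ Ioo Y0 Y1 → ψ t x = 0) (hψxs : ∀ t x, x ∉ Ioo Y0 Y1 → ψx t x = 0)
    (hψt : ∀ τ ∈ Ioo T0 T1, ∀ x, HasDerivAt (fun τ => ψ τ x) (ψt τ x) τ)
    (hψx : ∀ τ x, HasDerivAt (ψ τ) (ψx τ x) x) :
    (∫ x in Icc Y0 Y1, ρ t x * v t x * ψ t x) - (∫ x in Icc Y0 Y1, ρ s x * v s x * ψ s x)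
     = ∫ τ in s..t, ∫ x in Icc Y0 Y1, (ρ τ x * v τ x * ψt τ x
        - (μ (ρ τ x) * vx τ x - P (ρ τ x) - ρ τ x * v τ x ^ 2) * ψx τ x) := by
  obtain ⟨Z0, hZ0, hZ0'⟩ := exists_between hX0
  obtain ⟨Z1, hZ1', hZ1⟩ := exists_between hX1
  have hT := h.hT.le
  have hX := h.hX.le
  have hZ : Z0 ≤ Z1 := by linarith
  obtain ⟨pn, pnc, pnb, pnl, pm, plip⟩ := tm_lim_ext ρ ρx T0 T1 X0 X1 Z0 Z1 N hT hZ0 hZ1 hZ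
    h.ρ_cont h.hρx h.ρx_cont h.bρx
  obtain ⟨zn, znc, znb, znl, zm, zlip⟩ := tm_lim_ext v vx T0 T1 X0 X1 Z0 Z1 N hT hZ0 hZ1 hZ
    h.v_cont h.hvx h.vx_cont h.bvx
  set r : ℝ → ℝ → ℝ := fun t x => ρ (tm_cl T0 T1 t) (tm_cl X0 X1 x) with hr
  set w : ℝ → ℝ → ℝ := fun t x => v (tm_cl T0 T1 t) (tm_cl X0 X1 x) with hw
  set p : ℝ → ℝ → ℝ := fun t x => ρx (tm_cl T0 T1 t) (tm_cl Z0 Z1 x) with hp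
  set z : ℝ → ℝ → ℝ := fun t x => vx (tm_cl T0 T1 t) (tm_cl Z0 Z1 x) with hz
  have mT : ∀ t, tm_cl T0 T1 t ∈ Icc T0 T1 := fun t => tm_cl_mem _ _ _ hT
  have mX : ∀ x, tm_cl X0 X1 x ∈ Icc X0 X1 := fun x => tm_cl_mem _ _ _ hX
  have mZ : ∀ x, tm_cl Z0 Z1 x ∈ Icc X0 X1 := fun x =>
    ⟨hZ0.le.trans (tm_cl_mem _ _ _ hZ).1, (tm_cl_mem _ _ _ hZ).2.trans hZ1.le⟩
  have rpos : ∀ t x, 0 < r t x := fun t x => h.ρ_pos _ (mT t) _ (mX x)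
  have μr : ∀ t x, 0 < μ (r t x) := fun t x => hl.μpos _ (rpos t x)
  have cμ : ContinuousOn μ (Ioi 0) := fun y hy => (hl.dμ y hy).continuousAt.continuousWithinAt
  have cP : ContinuousOn P (Ioi 0) := fun y hy => (hl.dP y hy).continuousAt.continuousWithinAt
  have comp : ∀ f : ℝ → ℝ, ContinuousOn f (Ioi 0) →
      Continuous (fun p : ℝ × ℝ => f (r p.1 p.2)) ∧ TmBd (fun p : ℝ × ℝ => f (r p.1 p.2)) := by
    intro f hf
    have : ContinuousOn (fun p : ℝ × ℝ => f (ρ p.1 p.2)) (Icc T0 T1 ×ˢ Icc X0 X1) :=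
      hf.comp h.ρ_cont fun p hp => h.ρ_pos _ hp.1 _ hp.2
    exact ⟨tm_cl_cts _ _ _ _ _ hT hX this, tm_cl_bd _ _ _ _ _ hT hX this⟩
  have cid := comp (fun y => y) continuousOn_id
  have cμ' := comp μ cμ
  have cμ1' := comp μ1 hl.cμ1
  have ccc := comp (fun y => y / μ y) (continuousOn_id.div cμ fun y hy => (hl.μpos y hy).ne')
  have cci := comp (fun y => μ y / y) (cμ.div continuousOn_id fun y hy => (ne_of_gt hy))
  have cα := comp (fun y => μ1 y / μ y) (hl.cμ1.div cμ fun y hy => (hl.μpos y hy).ne')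
  have cβ := comp (fun y => P1 y / μ y) (hl.cP1.div cμ fun y hy => (hl.μpos y hy).ne')
  have cγ := comp (fun y => (μ y - y * μ1 y) / μ y ^ 2) ((cμ.sub (continuousOn_id.mul hl.cμ1)).div
    (cμ.pow 2) fun y hy => (pow_pos (hl.μpos y hy) 2).ne')
  have cw : Continuous (fun p : ℝ × ℝ => w p.1 p.2) := tm_cl_cts _ _ _ _ _ hT hX h.v_cont
  have bw : TmBd (fun p : ℝ × ℝ => w p.1 p.2) := tm_cl_bd _ _ _ _ _ hT hX h.v_cont
  have bp : TmBd (fun q : ℝ × ℝ => p q.1 q.2) := ⟨N, fun q => h.bρx _ (mT _) _ (mZ _)⟩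
  have bz : TmBd (fun q : ℝ × ℝ => z q.1 q.2) := ⟨N, fun q => h.bvx _ (mT _) _ (mZ _)⟩
  have bψ' : TmBd (fun q : ℝ × ℝ => ψ q.1 q.2) := ⟨Bψ, fun q => bψ _ _⟩
  have bψt' : TmBd (fun q : ℝ × ℝ => ψt q.1 q.2) := ⟨Bψ, fun q => bψt _ _⟩
  have bψx' : TmBd (fun q : ℝ × ℝ => ψx q.1 q.2) := ⟨Bψ, fun q => bψx _ _⟩
  set rt : ℝ → ℝ → ℝ := fun t x => -(p t x * w t x + r t x * z t x) with hrt
  have mrt : Measurable (fun q : ℝ × ℝ => rt q.1 q.2) :=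
    ((pm.mul cw.measurable).add (cid.1.measurable.mul zm)).neg
  have brt : TmBd (fun q : ℝ × ℝ => rt q.1 q.2) := ((bp.mul bw).add (cid.2.mul bz)).neg
  set c : ℝ → ℝ → ℝ := fun t x => r t x / μ (r t x) with hc
  set ct : ℝ → ℝ → ℝ := fun t x => (μ (r t x) - r t x * μ1 (r t x)) / μ (r t x) ^ 2 * rt t x with hct
  set φ : ℝ → ℝ → ℝ := fun t x => μ (r t x) * ψ t x with hφ
  set φt : ℝ → ℝ → ℝ := fun t x => μ1 (r t x) * rt t x * ψ t x + μ (r t x) * ψt t x with hφt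
  set φx : ℝ → ℝ → ℝ := fun t x => μ1 (r t x) * p t x * ψ t x + μ (r t x) * ψx t x with hφx
  set S : ℝ → ℝ → ℝ := fun t x => μ1 (r t x) / μ (r t x) * p t x * z t x
       - P1 (r t x) / μ (r t x) * p t x - r t x / μ (r t x) * w t x * z t x with hS
  set Sn : ℕ → ℝ → ℝ → ℝ := fun n t x => μ1 (r t x) / μ (r t x) * pn n t x * zn n t x
       - P1 (r t x) / μ (r t x) * pn n t x - r t x / μ (r t x) * w t x * zn n t x with hSn
  have bSn : TmBd (fun q : ℕ × ℝ × ℝ => Sn q.1 q.2.1 q.2.2) := by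
    have e1 : TmBd (fun q : ℕ × ℝ × ℝ => pn q.1 q.2.1 q.2.2) := ⟨N, fun q => pnb _ _ _⟩
    have e2 : TmBd (fun q : ℕ × ℝ × ℝ => zn q.1 q.2.1 q.2.2) := ⟨N, fun q => znb _ _ _⟩
    have f1 := cα.2.comp (fun q : ℕ × ℝ × ℝ => q.2)
    have f2 := cβ.2.comp (fun q : ℕ × ℝ × ℝ => q.2)
    have f3 := ccc.2.comp (fun q : ℕ × ℝ × ℝ => q.2)
    have f4 := bw.comp (fun q : ℕ × ℝ × ℝ => q.2)
    exact (((f1.mul e1).mul e2).sub (f2.mul e1)).sub ((f3.mul f4).mul e2)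
  have bS : TmBd (fun q : ℝ × ℝ => S q.1 q.2) :=
    (((cα.2.mul bp).mul bz).sub (cβ.2.mul bp)).sub ((ccc.2.mul bw).mul bz)
  have mS : Measurable (fun q : ℝ × ℝ => S q.1 q.2) :=
    (((cα.1.measurable.mul pm).mul zm).sub (cβ.1.measurable.mul pm)).sub
      ((ccc.1.measurable.mul cw.measurable).mul zm)
  have bct : TmBd (fun q : ℝ × ℝ => ct q.1 q.2) := cγ.2.mul brt
  have mct : Measurable (fun q : ℝ × ℝ => ct q.1 q.2) := cγ.1.measurable.mul mrt
  have bφ : TmBd (fun q : ℝ × ℝ => φ q.1 q.2) := cμ'.2.mul bψ'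
  have bφt : TmBd (fun q : ℝ × ℝ => φt q.1 q.2) :=
    ((cμ1'.2.mul brt).mul bψ').add (cμ'.2.mul bψt')
  have mφt : Measurable (fun q : ℝ × ℝ => φt q.1 q.2) :=
    ((cμ1'.1.measurable.mul mrt).mul cψ.measurable).add (cμ'.1.measurable.mul cψt.measurable)
  have bφx : TmBd (fun q : ℝ × ℝ => φx q.1 q.2) :=
    ((cμ1'.2.mul bp).mul bψ').add (cμ'.2.mul bψx')
  have mφx : Measurable (fun q : ℝ × ℝ => φx q.1 q.2) :=
    ((cμ1'.1.measurable.mul pm).mul cψ.measurable).add (cμ'.1.measurable.mul cψx.measurable)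
  have rid : ∀ τ ∈ Icc T0 T1, ∀ x ∈ Icc X0 X1, r τ x = ρ τ x := fun τ hτ x hx => by
    simp only [hr, tm_cl_id _ _ _ hτ, tm_cl_id _ _ _ hx]
  have wid : ∀ τ ∈ Icc T0 T1, ∀ x ∈ Icc X0 X1, w τ x = v τ x := fun τ hτ x hx => by
    simp only [hw, tm_cl_id _ _ _ hτ, tm_cl_id _ _ _ hx]
  have pid : ∀ τ ∈ Icc T0 T1, ∀ x ∈ Icc Z0 Z1, p τ x = ρx τ x := fun τ hτ x hx => by
    simp only [hp, tm_cl_id _ _ _ hτ, tm_cl_id _ _ _ hx]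
  have zid : ∀ τ ∈ Icc T0 T1, ∀ x ∈ Icc Z0 Z1, z τ x = vx τ x := fun τ hτ x hx => by
    simp only [hz, tm_cl_id _ _ _ hτ, tm_cl_id _ _ _ hx]
  have ZX : ∀ x ∈ Icc Z0 Z1, x ∈ Icc X0 X1 := fun x hx => ⟨hZ0.le.trans hx.1, hx.2.trans hZ1.le⟩
  have YZ : ∀ x ∈ Icc Y0 Y1, x ∈ Ioo Z0 Z1 := fun x hx => ⟨hZ0'.trans_le hx.1, hx.2.trans_lt hZ1'⟩
  have rtid : ∀ τ ∈ Icc T0 T1, ∀ x ∈ Icc Z0 Z1, rt τ x = ρt τ x := fun τ hτ x hx => by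
    simp only [hrt, rid τ hτ x (ZX x hx), wid τ hτ x (ZX x hx), pid τ hτ x hx, zid τ hτ x hx]
    linarith [h.mass τ hτ x (ZX x hx)]
  have drt : ∀ τ ∈ Ioo T0 T1, ∀ x ∈ Icc Z0 Z1, HasDerivAt (fun τ => r τ x) (rt τ x) τ := by
    intro τ hτ x hx
    rw [rtid τ (Ioo_subset_Icc_self hτ) x hx]
    refine (h.hρt τ (Ioo_subset_Icc_self hτ) x (ZX x hx)).congr_of_eventuallyEq ?_
    filter_upwards [Ioo_mem_nhds hτ.1 hτ.2] with τ' hτ'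
    exact rid τ' (Ioo_subset_Icc_self hτ') x (ZX x hx)
  have dct : ∀ τ ∈ Ioo T0 T1, ∀ x ∈ Icc Z0 Z1, HasDerivAt (fun τ => c τ x) (ct τ x) τ := by
    intro τ hτ x hx
    have e1 := drt τ hτ x hx
    have e2 : HasDerivAt (fun τ => μ (r τ x)) (μ1 (r τ x) * rt τ x) τ :=
      (hl.dμ _ (rpos τ x)).comp τ e1
    refine (e1.div e2 (μr τ x).ne').congr_deriv ?_
    simp only [hct]; ring
  have dφt : ∀ τ ∈ Ioo T0 T1, ∀ x ∈ Icc Z0 Z1, HasDerivAt (fun τ => φ τ x) (φt τ x) τ := by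
    intro τ hτ x hx
    have e1 := drt τ hτ x hx
    have e2 : HasDerivAt (fun τ => μ (r τ x)) (μ1 (r τ x) * rt τ x) τ :=
      (hl.dμ _ (rpos τ x)).comp τ e1
    exact e2.mul (hψt τ hτ x)
  have xev : ∀ x ∈ Ioo Z0 Z1, ∀ᶠ y in 𝓝 x, y ∈ Icc X0 X1 := fun x hx => by
    filter_upwards [Ioo_mem_nhds hx.1 hx.2] with y hy
    exact ZX y (Ioo_subset_Icc_self hy)
  have drx : ∀ τ ∈ Icc T0 T1, ∀ x ∈ Ioo Z0 Z1, HasDerivAt (r τ) (p τ x) x := by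
    intro τ hτ x hx
    have hx' := Ioo_subset_Icc_self hx
    rw [pid τ hτ x hx']
    refine (h.hρx τ hτ x (ZX x hx')).congr_of_eventuallyEq ?_
    filter_upwards [xev x hx] with y hy using rid τ hτ y hy
  have dwx : ∀ τ ∈ Icc T0 T1, ∀ x ∈ Ioo Z0 Z1, HasDerivAt (w τ) (z τ x) x := by
    intro τ hτ x hx
    have hx' := Ioo_subset_Icc_self hx
    rw [zid τ hτ x hx']
    refine (h.hvx τ hτ x (ZX x hx')).congr_of_eventuallyEq ?_
    filter_upwards [xev x hx] with y hy using wid τ hτ y hy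
  have dφx : ∀ τ ∈ Icc T0 T1, ∀ x ∈ Ioo Z0 Z1, HasDerivAt (φ τ) (φx τ x) x := by
    intro τ hτ x hx
    have e2 : HasDerivAt (fun x => μ (r τ x)) (μ1 (r τ x) * p τ x) x :=
      (hl.dμ _ (rpos τ x)).comp x (drx τ hτ x hx)
    exact e2.mul (hψx τ x)
  obtain ⟨Bα, hBα⟩ := cα.2
  obtain ⟨Bβ, hBβ⟩ := cβ.2
  obtain ⟨Bγ, hBγ⟩ := ccc.2.mul bw
  obtain ⟨B1, hB1⟩ := cμ1'.2
  obtain ⟨B2, hB2⟩ := cμ'.2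
  have hN0 : 0 ≤ N := (abs_nonneg _).trans (pnb 0 0 0)
  have hBα0 : 0 ≤ Bα := (abs_nonneg _).trans (hBα 0)
  have hBβ0 : 0 ≤ Bβ := (abs_nonneg _).trans (hBβ 0)
  have hBγ0 : 0 ≤ Bγ := (abs_nonneg _).trans (hBγ 0)
  have hB10 : 0 ≤ B1 := (abs_nonneg _).trans (hB1 0)
  have hB20 : 0 ≤ B2 := (abs_nonneg _).trans (hB2 0)
  have hBψ0 : 0 ≤ Bψ := (abs_nonneg _).trans (bψ 0 0)
  have Slim : ∀ t, ∀ e > 0, ∀ᶠ n in atTop, ∀ x, |Sn n t x - S t x| ≤ e := by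
    intro t e he
    set D := Bα * (2 * N) + Bβ + Bγ + 1 with hD
    have hDp : 0 < D := by positivity
    filter_upwards [pnl t (e / D) (by positivity), znl t (e / D) (by positivity)] with n h1 h2 x
    have a1 := h1 x
    have a2 := h2 x
    rw [show Sn n t x - S t x = μ1 (r t x) / μ (r t x) * (pn n t x * (zn n t x - z t x) +
      (pn n t x - p t x) * z t x) - P1 (r t x) / μ (r t x) * (pn n t x - p t x) -
      r t x / μ (r t x) * w t x * (zn n t x - z t x) by simp only [hSn, hS]; ring]
    have k1 : |pn n t x * (zn n t x - z t x) + (pn n t x - p t x) * z t x| ≤ N * (e / D) + (e / D) * N := by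
      refine (abs_add_le _ _).trans (add_le_add ?_ ?_)
      · rw [abs_mul]; exact mul_le_mul (pnb n t x) a2 (abs_nonneg _) hN0
      · rw [abs_mul]; exact mul_le_mul a1 (h.bvx _ (mT _) _ (mZ _)) (abs_nonneg _) (by positivity)
    refine (abs_sub _ _).trans ?_
    refine (add_le_add (abs_sub _ _) le_rfl).trans ?_
    rw [abs_mul, abs_mul, abs_mul (r t x / μ (r t x) * w t x)]
    calc _ ≤ Bα * (N * (e / D) + (e / D) * N) + Bβ * (e / D) + Bγ * (e / D) :=
          add_le_add (add_le_add (mul_le_mul (hBα (t, x)) k1 (abs_nonneg _) hBα0)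
            (mul_le_mul (hBβ (t, x)) a1 (abs_nonneg _) hBβ0))
            (mul_le_mul (hBγ (t, x)) a2 (abs_nonneg _) hBγ0)
      _ = (D - 1) * (e / D) := by rw [hD]; ring
      _ ≤ D * (e / D) := by gcongr; linarith
      _ = e := by field_simp
  have φlip : ∀ t x y, |φ t x - φ t y| ≤ (B2 * Bψ + B1 * N * Bψ) * |x - y| := by
    intro t x y
    have e1 : |ψ t x - ψ t y| ≤ Bψ * |x - y| :=
      tm_lip (ψ t) (ψx t) (min x y) (max x y) Bψ (fun z _ => hψx t z) (fun z _ => bψx t z) x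
        ⟨min_le_left _ _, le_max_left _ _⟩ y ⟨min_le_right _ _, le_max_right _ _⟩
    have e2 : |μ (r t x) - μ (r t y)| ≤ B1 * N * |x - y| := by
      refine (tm_lip (fun y => μ (ρ (tm_cl T0 T1 t) y))
        (fun y => μ1 (ρ (tm_cl T0 T1 t) y) * ρx (tm_cl T0 T1 t) y) X0 X1 (B1 * N) ?_ ?_ _ (mX x) _
        (mX y)).trans (mul_le_mul_of_nonneg_left (tm_cl_lip _ _ _ _) (by positivity))
      · intro y hy
        exact (hl.dμ _ (h.ρ_pos _ (mT t) _ hy)).comp y (h.hρx _ (mT t) _ hy)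
      · intro y hy
        rw [abs_mul]
        have := hB1 (t, y)
        simp only [hr, tm_cl_id _ _ _ hy] at this
        exact mul_le_mul this (h.bρx _ (mT t) _ hy) (abs_nonneg _) hB10
    rw [show φ t x - φ t y = μ (r t x) * (ψ t x - ψ t y) + (μ (r t x) - μ (r t y)) * ψ t y by
      simp only [hφ]; ring]
    refine (abs_add_le _ _).trans ?_
    rw [abs_mul, abs_mul]
    calc _ ≤ B2 * (Bψ * |x - y|) + (B1 * N * |x - y|) * Bψ :=
          add_le_add (mul_le_mul (hB2 (t, x)) e1 (abs_nonneg _) hB20)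
            (mul_le_mul e2 (bψ t y) (abs_nonneg _) (by positivity))
      _ = _ := by ring
  obtain ⟨C1, hC1⟩ := bSn
  obtain ⟨C2, hC2⟩ := bct
  obtain ⟨C3, hC3⟩ := bφt
  obtain ⟨C4, hC4⟩ := bw
  obtain ⟨C5, hC5⟩ := ccc.2
  obtain ⟨C6, hC6⟩ := bφ
  obtain ⟨C7, hC7⟩ := bS
  obtain ⟨C8, hC8⟩ := cci.2
  have hC10 : 0 ≤ C1 := (abs_nonneg _).trans (hC1 0)
  have hC20 : 0 ≤ C2 := (abs_nonneg _).trans (hC2 0)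
  have hC30 : 0 ≤ C3 := (abs_nonneg _).trans (hC3 0)
  have hC40 : 0 ≤ C4 := (abs_nonneg _).trans (hC4 0)
  have hC50 : 0 ≤ C5 := (abs_nonneg _).trans (hC5 0)
  have hC60 : 0 ≤ C6 := (abs_nonneg _).trans (hC6 0)
  have hC70 : 0 ≤ C7 := (abs_nonneg _).trans (hC7 0)
  have hC80 : 0 ≤ C8 := (abs_nonneg _).trans (hC8 0)
  have hC9 : 0 ≤ B2 * Bψ + B1 * N * Bψ := by positivity
  obtain ⟨B, hBdef⟩ : ∃ B, B = C1 + C2 + C3 + C4 + C5 + C6 + C7 + N + (B2 * Bψ + B1 * N * Bψ) :=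
    ⟨_, rfl⟩
  have hs1 : T0 < (2 * T0 + s) / 3 := by linarith
  have ht1 : (t + T1) / 2 < T1 := by linarith
  have sub1 : ∀ τ ∈ Icc ((2 * T0 + s) / 3) ((t + T1) / 2), τ ∈ Ioo T0 T1 := fun τ hτ =>
    ⟨hs1.trans_le hτ.1, hτ.2.trans_lt ht1⟩
  have sub2 : ∀ τ ∈ Icc s t, τ ∈ Ioo T0 T1 := fun τ hτ =>
    ⟨hs.trans_le hτ.1, hτ.2.trans_lt ht⟩
  have pzc : ∀ τ ∈ Icc T0 T1, ∀ x, ContinuousAt (p τ) x ∧ ContinuousAt (z τ) x := by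
    intro τ hτ x
    have a1 : Continuous (p τ) := (h.ρx_cont _ (mT τ)).comp_continuous (tm_cl_cont Z0 Z1) mZ
    have a2 : Continuous (z τ) := (h.vx_cont _ (mT τ)).comp_continuous (tm_cl_cont Z0 Z1) mZ
    exact ⟨a1.continuousAt, a2.continuousAt⟩
  have sec : ∀ (f : ℝ × ℝ → ℝ), Continuous f → ∀ τ x, ContinuousAt (fun x => f (τ, x)) x :=
    fun f hf τ x => (hf.comp (Continuous.prodMk_right τ)).continuousAt
  have key := tm_A2 w vt c S φ φt ct z φx Sn cw ccc.1
    (fun n => (((cα.1.mul (pnc n)).mul (znc n)).sub (cβ.1.mul (pnc n))).sub ((ccc.1.mul cw).mul (znc n)))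
    (1 / (C8 + 1)) (by positivity) (fun t x => by
      have a1 := (abs_le.1 (hC8 (t, x))).2
      have a2 := rpos t x
      have a3 := μr t x
      simp only at a1
      simp only [hc]
      rw [div_le_div_iff₀ (by positivity) a3, one_mul]
      rw [div_le_iff₀ a2] at a1
      nlinarith) (cμ'.1.mul cψ) (fun t x => mul_nonneg (μr t x).le (ψ0 t x))
    ((2 * T0 + s) / 3) ((t + T1) / 2) Z0 Z1 Y0 Y1 ((T0 + 2 * s) / 3) s t C2 C3 (by linarith)
    (by linarith) hst (by linarith) hZ0' hZ1' hY hC20 hC30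
    (fun τ hτ τ' hτ' x hx => tm_lip _ _ _ _ _ (fun y hy => dct y (sub1 y hy) x hx)
      (fun y hy => hC2 (y, x)) τ hτ τ' hτ')
    (fun τ hτ τ' hτ' x hx => tm_lip _ _ _ _ _ (fun y hy => dφt y
        ⟨by linarith [hy.1], by linarith [hy.2]⟩ x (Ioo_subset_Icc_self (YZ x hx)))
      (fun y hy => hC3 (y, x)) τ hτ τ' hτ')
    (fun τ hτ x hx => dct τ (sub2 τ hτ) x hx)
    (fun τ hτ x hx => dφt τ (sub2 τ hτ) x (Ioo_subset_Icc_self (YZ x hx)))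
    mct mφt mS B
    (fun n t x => (hC1 (n, t, x)).trans (by linarith))
    (fun t x => (hC2 (t, x)).trans (by linarith))
    (fun t x => (hC3 (t, x)).trans (by linarith))
    (fun t x => (hC4 (t, x)).trans (by linarith))
    (fun t x => (hC5 (t, x)).trans (by linarith))
    (fun t x => (hC6 (t, x)).trans (by linarith))
    (fun t x => (hC7 (t, x)).trans (by linarith))
    (fun t _ e he => (Slim t e he).mono fun n hn x _ => hn x)
    (fun τ hτ x hx => by
      have hτ' := sub1 τ (Ioo_subset_Icc_self hτ)
      have hx' := ZX x (Ioo_subset_Icc_self hx)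
      refine (h.hvt τ (Ioo_subset_Icc_self hτ') x hx').congr_of_eventuallyEq ?_
      filter_upwards [Ioo_mem_nhds hτ'.1 hτ'.2] with τ' hτ''
      exact wid τ' (Ioo_subset_Icc_self hτ'') x hx')
    (fun t x hx => by
      simp only [hφ]; rw [hψs t x (fun h => hx (Ioo_subset_Icc_self h)), mul_zero])
    (fun t x y => (φlip t x y).trans (mul_le_mul_of_nonneg_right (by linarith) (abs_nonneg _)))
    (fun t x y => (zlip t x y).trans (mul_le_mul_of_nonneg_right (by linarith) (abs_nonneg _)))
    (fun τ hτ x hx => dφx τ (Ioo_subset_Icc_self (sub2 τ hτ)) x hx)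
    (fun τ hτ x hx => dwx τ (Ioo_subset_Icc_self (sub2 τ hτ)) x hx)
    (fun τ hτ x hx => by
      have hpz := pzc τ (Ioo_subset_Icc_self (sub2 τ hτ)) x
      exact (sec _ cγ.1 τ x).mul (((hpz.1.mul (sec _ cw τ x)).add ((sec _ cid.1 τ x).mul hpz.2)).neg))
    (fun τ hτ x hx => by
      have hpz := pzc τ (Ioo_subset_Icc_self (sub2 τ hτ)) x
      exact ((((sec _ cα.1 τ x).mul hpz.1).mul hpz.2).sub ((sec _ cβ.1 τ x).mul hpz.1)).sub
        (((sec _ ccc.1 τ x).mul (sec _ cw τ x)).mul hpz.2))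
    (fun τ hτ x hx δ hδ => by
      have hτ' := Ioo_subset_Icc_self (sub1 τ (Ioo_subset_Icc_self hτ))
      have hxZ := Ioo_subset_Icc_self hx
      have hx' := ZX x hxZ
      have a1 := tm_vxx hl (v := v) (vt := vt) (vx := vx) τ x (h.ρ_pos τ hτ' x hx') (h.hρx τ hτ' x hx')
        ((xev x hx).mono fun y hy => h.ρ_pos τ hτ' y hy) (h.mom τ hτ' x hx')
      have a2 := tm_d2 (v τ) (vx τ) x _ ((xev x hx).mono fun y hy => h.hvx τ hτ' y hy) a1 δ hδ
      have e1 : ∀ᶠ η in 𝓝[>] (0:ℝ), x + η ∈ Icc X0 X1 := by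
        have : Tendsto (fun η : ℝ => x + η) (𝓝[>] 0) (𝓝 x) := by
          have : Continuous (fun η : ℝ => x + η) := by fun_prop
          simpa using (this.tendsto 0).mono_left nhdsWithin_le_nhds
        exact this.eventually (xev x hx)
      have e2 : ∀ᶠ η in 𝓝[>] (0:ℝ), x - η ∈ Icc X0 X1 := by
        have : Tendsto (fun η : ℝ => x - η) (𝓝[>] 0) (𝓝 x) := by
          have : Continuous (fun η : ℝ => x - η) := by fun_prop
          simpa using (this.tendsto 0).mono_left nhdsWithin_le_nhds
        exact this.eventually (xev x hx)
      filter_upwards [a2, e1, e2] with η b1 b2 b3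
      rw [wid τ hτ' _ b2, wid τ hτ' _ b3, wid τ hτ' _ hx']
      simp only [hc, hS, rid τ hτ' x hx', wid τ hτ' x hx', pid τ hτ' x hxZ, zid τ hτ' x hxZ]
      convert b1 using 5
      ring)
  have bw' : TmBd (fun p : ℝ × ℝ => w p.1 p.2) := ⟨C4, hC4⟩
  have bS' : TmBd (fun p : ℝ × ℝ => S p.1 p.2) := ⟨C7, hC7⟩
  have bφ' : TmBd (fun p : ℝ × ℝ => φ p.1 p.2) := ⟨C6, hC6⟩
  have bct' : TmBd (fun p : ℝ × ℝ => ct p.1 p.2) := ⟨C2, hC2⟩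
  have bφt' : TmBd (fun p : ℝ × ℝ => φt p.1 p.2) := ⟨C3, hC3⟩
  have mφ : Measurable (fun p : ℝ × ℝ => φ p.1 p.2) := (cμ'.1.mul cψ).measurable
  have cPr := comp P cP
  have cP1r := comp P1 hl.cP1
  have iF1 := tm_ii (volume.restrict (Icc Y0 Y1)) (fun τ x => w τ x * (φt τ x * c τ x + φ τ x * ct τ x))
    (cw.measurable.mul ((mφt.mul ccc.1.measurable).add (mφ.mul mct)))
    (bw'.mul ((bφt'.mul ccc.2).add (bφ'.mul bct'))) s t
  have iF2 := tm_ii (volume.restrict (Icc Y0 Y1)) (fun τ x => φ τ x * S τ x)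
    (mφ.mul mS) (bφ'.mul bS') s t
  have iF3 := tm_ii (volume.restrict (Ioo Z0 Z1)) (fun τ x => φx τ x * z τ x)
    (mφx.mul zm) (bφx.mul bz) s t
  have YX : ∀ x ∈ Icc Y0 Y1, x ∈ Icc X0 X1 := fun x hx => ZX x (Ioo_subset_Icc_self (YZ x hx))
  have ends : ∀ τ ∈ Icc s t, (∫ x in Icc Y0 Y1, φ τ x * c τ x * w τ x) =
      ∫ x in Icc Y0 Y1, ρ τ x * v τ x * ψ τ x := by
    intro τ hτ
    have hτ' := Ioo_subset_Icc_self (sub2 τ hτ)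
    refine setIntegral_congr_fun measurableSet_Icc fun x hx => ?_
    have e1 := μr τ x
    simp only [hφ, hc]
    rw [← rid τ hτ' x (YX x hx), ← wid τ hτ' x (YX x hx)]
    field_simp
  have slice : ∀ τ ∈ Icc s t, (∫ x in Icc Y0 Y1, (ρ τ x * v τ x * ψt τ x
        - (μ (ρ τ x) * vx τ x - P (ρ τ x) - ρ τ x * v τ x ^ 2) * ψx τ x)) =
      (∫ x in Icc Y0 Y1, w τ x * (φt τ x * c τ x + φ τ x * ct τ x)) +
      (∫ x in Icc Y0 Y1, φ τ x * S τ x) - ∫ x in Ioo Z0 Z1, φx τ x * z τ x := by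
    intro τ hτ
    have hτ' := Ioo_subset_Icc_self (sub2 τ hτ)
    have sec' : ∀ (f : ℝ × ℝ → ℝ), Continuous f → Continuous (fun x => f (τ, x)) :=
      fun f hf => hf.comp (Continuous.prodMk_right τ)
    have kp : Continuous (p τ) := continuous_iff_continuousAt.2 fun x => (pzc τ hτ' x).1
    have kz : Continuous (z τ) := continuous_iff_continuousAt.2 fun x => (pzc τ hτ' x).2
    have kw : Continuous (w τ) := sec' _ cw
    have kr : Continuous (r τ) := sec' _ cid.1
    have kμ : Continuous (fun x => μ (r τ x)) := sec' _ cμ'.1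
    have kμ1 : Continuous (fun x => μ1 (r τ x)) := sec' _ cμ1'.1
    have kP : Continuous (fun x => P (r τ x)) := sec' _ cPr.1
    have kP1 : Continuous (fun x => P1 (r τ x)) := sec' _ cP1r.1
    have kψ : Continuous (ψ τ) := sec' _ cψ
    have kψt : Continuous (ψt τ) := sec' _ cψt
    have kψx : Continuous (ψx τ) := sec' _ cψx
    have krt : Continuous (rt τ) := ((kp.mul kw).add (kr.mul kz)).neg
    have kc : Continuous (c τ) := sec' _ ccc.1
    have kφ : Continuous (φ τ) := kμ.mul kψ
    have kφt : Continuous (φt τ) := ((kμ1.mul krt).mul kψ).add (kμ.mul kψt)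
    have kφx : Continuous (φx τ) := ((kμ1.mul kp).mul kψ).add (kμ.mul kψx)
    have kct : Continuous (ct τ) := (sec' _ cγ.1).mul krt
    have kS : Continuous (S τ) := ((((sec' _ cα.1).mul kp).mul kz).sub ((sec' _ cβ.1).mul kp)).sub
      (((sec' _ ccc.1).mul kw).mul kz)
    set D : ℝ → ℝ := fun x => (p τ x * w τ x ^ 2 + 2 * r τ x * w τ x * z τ x + P1 (r τ x) * p τ x) * ψ τ x
      + (r τ x * w τ x ^ 2 + P (r τ x)) * ψx τ x with hD
    have kD : Continuous D := by
      refine ((((kp.mul (kw.pow 2)).add (((continuous_const.mul kr).mul kw).mul kz)).add (kP1.mul kp)).mul kψ).add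
        (((kr.mul (kw.pow 2)).add kP).mul kψx)
    have iD : ∫ x in Icc Y0 Y1, D x = 0 := by
      rw [integral_Icc_eq_integral_Ioc, ← intervalIntegral.integral_of_le hY]
      rw [intervalIntegral.integral_eq_sub_of_hasDerivAt
        (f := fun x => (r τ x * w τ x ^ 2 + P (r τ x)) * ψ τ x) ?_ (kD.intervalIntegrable _ _)]
      · simp only [hψs τ Y0 (fun h => lt_irrefl _ h.1), hψs τ Y1 (fun h => lt_irrefl _ h.2)]
        ring
      · intro x hx
        rw [uIcc_of_le hY] at hx
        have d1 := drx τ hτ' x (YZ x hx)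
        have d2 := dwx τ hτ' x (YZ x hx)
        have d3 : HasDerivAt (fun x => P (r τ x)) (P1 (r τ x) * p τ x) x :=
          (hl.dP _ (rpos τ x)).comp x d1
        refine (((d1.mul (d2.pow 2)).add d3).mul (hψx τ x)).congr_deriv ?_
        simp only [hD, Pi.mul_apply, Pi.add_apply, Pi.pow_apply]
        push_cast; ring
    have i3 : (∫ x in Ioo Z0 Z1, φx τ x * z τ x) = ∫ x in Icc Y0 Y1, φx τ x * z τ x := by
      refine setIntegral_eq_of_subset_of_forall_diff_eq_zero measurableSet_Ioo (fun x hx => YZ x hx) ?_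
      intro x hx
      have : x ∉ Ioo Y0 Y1 := fun h => hx.2 (Ioo_subset_Icc_self h)
      simp only [hφx, hψs τ x this, hψxs τ x this]; ring
    have I1 : IntegrableOn (fun x => w τ x * (φt τ x * c τ x + φ τ x * ct τ x)) (Icc Y0 Y1) :=
      (kw.mul ((kφt.mul kc).add (kφ.mul kct))).integrableOn_Icc
    have I2 : IntegrableOn (fun x => φ τ x * S τ x) (Icc Y0 Y1) := (kφ.mul kS).integrableOn_Icc
    have I3 : IntegrableOn (fun x => φx τ x * z τ x) (Icc Y0 Y1) := (kφx.mul kz).integrableOn_Icc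
    have I4 : IntegrableOn D (Icc Y0 Y1) := kD.integrableOn_Icc
    have I12 : IntegrableOn (fun x => w τ x * (φt τ x * c τ x + φ τ x * ct τ x) + φ τ x * S τ x) (Icc Y0 Y1) :=
      I1.add I2
    have I13 : IntegrableOn (fun x => w τ x * (φt τ x * c τ x + φ τ x * ct τ x) + φ τ x * S τ x
      - φx τ x * z τ x) (Icc Y0 Y1) := I12.sub I3
    rw [i3, ← add_zero (_ - _), ← iD, ← integral_add I1 I2, ← integral_sub I12 I3,
      ← integral_add I13 I4]
    refine setIntegral_congr_fun measurableSet_Icc fun x hx => ?_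
    have e1 := (μr τ x).ne'
    simp only [Pi.add_apply, Pi.sub_apply, hD, hφ, hφt, hφx, hS, hct, hc]
    rw [← rid τ hτ' x (YX x hx), ← wid τ hτ' x (YX x hx),
      ← zid τ hτ' x (Ioo_subset_Icc_self (YZ x hx)), hrt]
    field_simp
    ring
  rw [ends t ⟨hst, le_rfl⟩, ends s ⟨le_rfl, hst⟩] at key
  rw [intervalIntegral.integral_congr (g := fun τ => (∫ x in Icc Y0 Y1, w τ x * (φt τ x * c τ x + φ τ x * ct τ x)) +
      (∫ x in Icc Y0 Y1, φ τ x * S τ x) - ∫ x in Ioo Z0 Z1, φx τ x * z τ x)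
      (fun τ hτ => slice τ (by rwa [uIcc_of_le hst] at hτ)),
    intervalIntegral.integral_sub (iF1.add iF2) iF3, intervalIntegral.integral_add iF1 iF2]
  linarith

lemma tm_bint (f : ℝ → ℝ) (hf : Measurable f) (B : ℝ) (hb : ∀ x, |f x| ≤ B) (s t : ℝ) :
    IntervalIntegrable f volume s t := by
  apply (intervalIntegrable_const (c := B)).mono_fun hf.aestronglyMeasurable
  exact Eventually.of_forall fun x => (hb x).trans (le_abs_self _)

lemma tm_glue (Φ k : ℝ → ℝ) (s t : ℝ) (hst : s ≤ t)
    (h : ∀ x ∈ Icc s t, ∀ᶠ y in 𝓝[Icc s t] x, IntervalIntegrable k volume x y ∧ Φ y - Φ x = ∫ τ in x..y, k τ) :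
    IntervalIntegrable k volume s t ∧ Φ t - Φ s = ∫ τ in s..t, k τ := by
  refine isPreconnected_Icc.induction₂' (fun x y => IntervalIntegrable k volume x y ∧ Φ y - Φ x = ∫ τ in x..y, k τ)
    (fun x hx => (h x hx).mono fun y hy => ⟨hy, hy.1.symm, ?_⟩) (fun x y z _ _ _ h1 h2 => ⟨h1.1.trans h2.1, ?_⟩)
    ⟨le_rfl, hst⟩ ⟨hst, le_rfl⟩
  · rw [intervalIntegral.integral_symm, ← hy.2]; ring
  · rw [← intervalIntegral.integral_add_adjacent_intervals h1.1 h2.1, ← h1.2, ← h2.2]; ring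

lemma tm_chain (q G : ℝ → ℝ → ℝ) (X X' qX : ℝ → ℝ) (s t T1 N L : ℝ) (hst : s ≤ t) (htT : t < T1)
    (hN : 0 ≤ N) (hL : 0 ≤ L)
    (hq : Continuous (fun p : ℝ × ℝ => q p.1 p.2))
    (hqN : ∀ τ x y, |q τ x - q τ y| ≤ N * |x - y|)
    (hG : Measurable (fun p : ℝ × ℝ => G p.1 p.2)) (hGN : ∀ τ x, |G τ x| ≤ N)
    (hGc : ∀ τ ∈ Ioo s t, ContinuousAt (G τ) (X τ))
    (hI : ∀ τ τ' x, s ≤ τ → τ ≤ τ' → τ' ≤ T1 → q τ' x - q τ x = ∫ σ in τ..τ', G σ x)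
    (hX : Continuous X) (hXL : ∀ τ τ', |X τ - X τ'| ≤ L * |τ - τ'|)
    (hX' : ∀ τ ∈ Ioo s t, HasDerivAt X (X' τ) τ)
    (hqX : ∀ τ ∈ Ioo s t, HasDerivAt (q τ) (qX τ) (X τ)) :
    IntervalIntegrable (fun τ => G τ (X τ) + qX τ * X' τ) volume s t ∧
    q t (X t) - q s (X s) = ∫ τ in s..t, (G τ (X τ) + qX τ * X' τ) := by
  have hae : ∀ᵐ τ : ℝ, τ ∈ uIoc s t → τ ∈ Ioo s t := by
    filter_upwards [Measure.ae_ne volume t] with τ h1 h2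
    rw [uIoc_of_le hst] at h2
    exact ⟨h2.1, lt_of_le_of_ne h2.2 h1⟩
  have cφ : Continuous (fun τ => q τ (X τ)) := hq.comp (continuous_id.prodMk hX)
  have hqs : ∀ h, Continuous (fun τ => q τ (X (τ + h))) := fun h =>
    hq.comp (continuous_id.prodMk (hX.comp (continuous_id.add continuous_const)))
  have dl : ∀ τ ∈ Ioo s t, Tendsto (fun h => (q τ (X (τ + h)) - q τ (X τ)) / h) (𝓝[>] 0)
      (𝓝 (qX τ * X' τ)) := by
    intro τ hτ
    have := ((hqX τ hτ).comp τ (hX' τ hτ)).tendsto_slope_zero_right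
    refine this.congr fun h => ?_
    simp [div_eq_inv_mul]
  have dB : ∀ h > 0, ∀ τ, |(q τ (X (τ + h)) - q τ (X τ)) / h| ≤ N * L := by
    intro h hh τ
    rw [abs_div, abs_of_pos hh, div_le_iff₀ hh]
    calc _ ≤ N * |X (τ + h) - X τ| := hqN _ _ _
      _ ≤ N * (L * |τ + h - τ|) := mul_le_mul_of_nonneg_left (hXL _ _) hN
      _ = N * L * h := by rw [add_sub_cancel_left, abs_of_pos hh]; ring
  have mk : Measurable (fun τ => G τ (X τ)) := hG.comp (measurable_id.prodMk hX.measurable)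
  have ik : IntervalIntegrable (fun τ => G τ (X τ)) volume s t := tm_bint _ mk N (fun τ => hGN _ _) _ _
  have ms : AEStronglyMeasurable (fun τ => qX τ * X' τ) (volume.restrict (uIoc s t)) := by
    refine aestronglyMeasurable_of_tendsto_ae (𝓝[>] (0:ℝ))
      (f := fun h τ => (q τ (X (τ + h)) - q τ (X τ)) / h)
      (fun h => (((hqs h).sub cφ).div_const h).aestronglyMeasurable) ?_
    rw [ae_restrict_iff' measurableSet_uIoc]
    filter_upwards [hae] with τ h1 h2 using dl τ (h1 h2)
  have ij : IntervalIntegrable (fun τ => qX τ * X' τ) volume s t := by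
    apply (intervalIntegrable_const (c := N * L)).mono_fun ms
    rw [EventuallyLE, ae_restrict_iff' measurableSet_uIoc]
    filter_upwards [hae] with τ h1 h2
    have := le_of_tendsto (dl τ (h1 h2)).abs
      (eventually_nhdsWithin_of_forall fun h hh => dB h hh τ)
    exact this.trans (le_abs_self _)
  refine ⟨ik.add ij, ?_⟩
  rw [intervalIntegral.integral_add ik ij]
  have L2 : Tendsto (fun h => ∫ τ in s..t, (q τ (X (τ + h)) - q τ (X τ)) / h) (𝓝[>] 0)
      (𝓝 (∫ τ in s..t, qX τ * X' τ)) := by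
    refine intervalIntegral.tendsto_integral_filter_of_dominated_convergence (fun _ => N * L)
      (Eventually.of_forall fun h => (((hqs h).sub cφ).div_const h).aestronglyMeasurable)
      (eventually_nhdsWithin_of_forall fun h hh => Eventually.of_forall fun τ _ => dB h hh τ)
      intervalIntegrable_const ?_
    filter_upwards [hae] with τ h1 h2 using dl τ (h1 h2)
  have L0 : Tendsto (fun h => ∫ τ in s..t, (q (τ + h) (X (τ + h)) - q τ (X τ)) / h) (𝓝[>] 0)
      (𝓝 (q t (X t) - q s (X s))) := by
    set φ : ℝ → ℝ := fun τ => q τ (X τ) with hφ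
    have d : ∀ u, Tendsto (fun h : ℝ => h⁻¹ * ∫ τ in u..(u + h), φ τ) (𝓝[>] 0) (𝓝 (φ u)) := by
      intro u
      have := (intervalIntegral.integral_hasDerivAt_right (cφ.intervalIntegrable u u)
        (cφ.stronglyMeasurableAtFilter _ _) cφ.continuousAt).tendsto_slope_zero_right
      simpa using this
    refine ((d t).sub (d s)).congr' ?_
    filter_upwards [self_mem_nhdsWithin] with h hh
    have ii := fun a b => cφ.intervalIntegrable (μ := volume) a b
    have i1 : Continuous (fun τ => q (τ + h) (X (τ + h))) :=
      hq.comp (show Continuous (fun τ : ℝ => (τ + h, X (τ + h))) by fun_prop)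
    rw [intervalIntegral.integral_div, intervalIntegral.integral_sub (i1.intervalIntegrable _ _) (ii _ _)]
    have e1 : ∫ τ in s..t, q (τ + h) (X (τ + h)) = ∫ τ in (s+h)..(t+h), φ τ :=
      intervalIntegral.integral_comp_add_right φ h
    have e2 := intervalIntegral.integral_add_adjacent_intervals (ii s t) (ii t (t+h))
    have e3 := intervalIntegral.integral_add_adjacent_intervals (ii s (s+h)) (ii (s+h) (t+h))
    have hne : h ≠ 0 := ne_of_gt hh
    rw [e1]
    field_simp
    linarith
  have L1 : Tendsto (fun h => ∫ τ in s..t, (q (τ + h) (X (τ + h)) - q τ (X (τ + h))) / h) (𝓝[>] 0)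
      (𝓝 (∫ τ in s..t, G τ (X τ))) := by
    have e0 : ∀ᶠ h in 𝓝[>] (0:ℝ), (∫ θ in (0:ℝ)..1, ∫ τ in s..t, G (τ + h * θ) (X (τ + h))) =
        ∫ τ in s..t, (q (τ + h) (X (τ + h)) - q τ (X (τ + h))) / h := by
      filter_upwards [self_mem_nhdsWithin, Ioo_mem_nhdsGT (sub_pos.2 htT)] with h hh hh2
      have hh : 0 < h := hh
      rw [intervalIntegral_intervalIntegral_swap]
      · refine intervalIntegral.integral_congr fun τ hτ => ?_
        rw [uIcc_of_le hst] at hτ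
        rw [hI τ (τ + h) (X (τ + h)) hτ.1 (by linarith) (by linarith [hτ.2, hh2.2]),
          intervalIntegral.integral_comp_add_mul (fun σ => G σ (X (τ + h))) hh.ne']
        simp [div_eq_inv_mul]
      · refine Measure.integrableOn_of_bounded (M := N) ?_ ?_ ?_
        · rw [Measure.volume_eq_prod, Measure.prod_prod, uIoc_of_le hst, uIoc_of_le zero_le_one]
          simp [ENNReal.mul_eq_top]
        · have : Measurable (fun p : ℝ × ℝ => G (p.2 + h * p.1) (X (p.2 + h))) :=
            hG.comp (show Measurable (fun p : ℝ × ℝ => (p.2 + h * p.1, X (p.2 + h))) by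
              have := hX.measurable
              fun_prop)
          exact this.aestronglyMeasurable
        · exact Eventually.of_forall fun p => hGN _ _
    refine Tendsto.congr' e0 ?_
    rw [show (∫ τ in s..t, G τ (X τ)) = ∫ θ in (0:ℝ)..1, ∫ τ in s..t, G τ (X τ) by simp]
    refine intervalIntegral.tendsto_integral_filter_of_dominated_convergence (fun _ => N * |t - s|)
      (Eventually.of_forall fun h => ?_) (Eventually.of_forall fun h => Eventually.of_forall fun θ _ => ?_)
      intervalIntegrable_const (Eventually.of_forall fun θ hθ => ?_)
    · simp_rw [intervalIntegral.integral_of_le hst]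
      have : Measurable (fun p : ℝ × ℝ => G (p.2 + h * p.1) (X (p.2 + h))) :=
            hG.comp (show Measurable (fun p : ℝ × ℝ => (p.2 + h * p.1, X (p.2 + h))) by
              have := hX.measurable
              fun_prop)
      exact (this.stronglyMeasurable.integral_prod_right' (ν := volume.restrict (Ioc s t))).aestronglyMeasurable
    · exact intervalIntegral.norm_integral_le_of_norm_le_const fun τ _ => hGN _ _
    · rw [uIoc_of_le zero_le_one] at hθ
      have f1 : ∀ h, (∫ τ in s..t, G (τ + h * θ) (X (τ + h))) =
          ∫ τ in (s + h * θ)..(t + h * θ), G τ (X (τ + h * (1 - θ))) := by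
        intro h
        rw [← intervalIntegral.integral_comp_add_right (fun τ => G τ (X (τ + h * (1 - θ)))) (h * θ)]
        refine intervalIntegral.integral_congr fun τ _ => ?_
        congr 2; ring
      have mm : ∀ h, Measurable (fun τ => G τ (X (τ + h * (1 - θ)))) := fun h =>
        hG.comp (measurable_id.prodMk (hX.measurable.comp (measurable_id.add_const _)))
      have mi : ∀ h u u', IntervalIntegrable (fun τ => G τ (X (τ + h * (1 - θ)))) volume u u' :=
        fun h u u' => tm_bint _ (mm h) N (fun _ => hGN _ _) _ _
      have f2 : ∀ h, (∫ τ in s..t, G (τ + h * θ) (X (τ + h))) =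
          (∫ τ in s..t, G τ (X (τ + h * (1 - θ)))) +
          ((∫ τ in t..(t + h * θ), G τ (X (τ + h * (1 - θ)))) -
          ∫ τ in s..(s + h * θ), G τ (X (τ + h * (1 - θ)))) := by
        intro h
        rw [f1]
        have g1 := intervalIntegral.integral_add_adjacent_intervals (mi h s t) (mi h t (t+h*θ))
        have g2 := intervalIntegral.integral_add_adjacent_intervals (mi h s (s+h*θ)) (mi h (s+h*θ) (t+h*θ))
        linarith
      simp_rw [f2]
      have z0 : ∀ u, Tendsto (fun h => ∫ τ in u..(u + h * θ), G τ (X (τ + h * (1 - θ)))) (𝓝[>] 0) (𝓝 0) := by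
        intro u
        have c : Tendsto (fun h : ℝ => N * |h * θ|) (𝓝[>] 0) (𝓝 0) := by
          have : Continuous (fun h : ℝ => N * |h * θ|) := by fun_prop
          simpa using (this.tendsto 0).mono_left nhdsWithin_le_nhds
        refine squeeze_zero_norm (fun h => ?_) c
        refine (intervalIntegral.norm_integral_le_of_norm_le_const (C := N) fun τ _ => hGN _ _).trans ?_
        rw [add_sub_cancel_left]
      have m0 : Tendsto (fun h => ∫ τ in s..t, G τ (X (τ + h * (1 - θ)))) (𝓝[>] 0)
          (𝓝 (∫ τ in s..t, G τ (X τ))) := by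
        refine intervalIntegral.tendsto_integral_filter_of_dominated_convergence (fun _ => N)
          (Eventually.of_forall fun h => (mm h).aestronglyMeasurable)
          (Eventually.of_forall fun h => Eventually.of_forall fun τ _ => hGN _ _)
          intervalIntegrable_const ?_
        filter_upwards [hae] with τ h1 h2
        have c1 : Tendsto (fun h => X (τ + h * (1 - θ))) (𝓝[>] 0) (𝓝 (X τ)) := by
          have : Continuous (fun h : ℝ => X (τ + h * (1 - θ))) := by fun_prop
          simpa using (this.tendsto 0).mono_left nhdsWithin_le_nhds
        exact (hGc τ (h1 h2)).tendsto.comp c1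
      simpa using m0.add ((z0 t).sub (z0 s))
  have L3 := L1.add L2
  refine tendsto_nhds_unique L0 (L3.congr' ?_)
  filter_upwards [self_mem_nhdsWithin] with h hh
  have i1 : Continuous (fun τ => q (τ + h) (X (τ + h))) :=
      hq.comp (show Continuous (fun τ : ℝ => (τ + h, X (τ + h))) by fun_prop)
  have j1 : Continuous (fun τ => (q (τ + h) (X (τ + h)) - q τ (X (τ + h))) / h) := (i1.sub (hqs h)).div_const h
  have j2 : Continuous (fun τ => (q τ (X (τ + h)) - q τ (X τ)) / h) := ((hqs h).sub cφ).div_const h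
  rw [← intervalIntegral.integral_add (j1.intervalIntegrable _ _) (j2.intervalIntegrable _ _)]
  refine intervalIntegral.integral_congr fun τ _ => ?_
  ring

structure TmNice (F : ℝ → ℝ → ℝ) : Prop where
  m : Measurable (fun p : ℝ × ℝ => F p.1 p.2)
  b : TmBd (fun p : ℝ × ℝ => F p.1 p.2)
  c : ∀ τ, Continuous (F τ)

lemma TmNice.mul {F G : ℝ → ℝ → ℝ} (hF : TmNice F) (hG : TmNice G) : TmNice (fun τ x => F τ x * G τ x) :=
  ⟨hF.m.mul hG.m, hF.b.mul hG.b, fun τ => (hF.c τ).mul (hG.c τ)⟩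
lemma TmNice.add {F G : ℝ → ℝ → ℝ} (hF : TmNice F) (hG : TmNice G) : TmNice (fun τ x => F τ x + G τ x) :=
  ⟨hF.m.add hG.m, hF.b.add hG.b, fun τ => (hF.c τ).add (hG.c τ)⟩
lemma TmNice.sub {F G : ℝ → ℝ → ℝ} (hF : TmNice F) (hG : TmNice G) : TmNice (fun τ x => F τ x - G τ x) :=
  ⟨hF.m.sub hG.m, hF.b.sub hG.b, fun τ => (hF.c τ).sub (hG.c τ)⟩
lemma TmNice.neg {F : ℝ → ℝ → ℝ} (hF : TmNice F) : TmNice (fun τ x => - F τ x) :=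
  ⟨hF.m.neg, hF.b.neg, fun τ => (hF.c τ).neg⟩

section
variable {P μ P1 μ1 : ℝ → ℝ} {ρ v ρt ρx vt vx : ℝ → ℝ → ℝ} {T0 T1 X0 X1 N : ℝ}

lemma tm_nice_cts (h : TmRect P μ ρ v ρt ρx vt vx T0 T1 X0 X1 N) {Z0 Z1 : ℝ} (h0 : X0 < Z0) (h1 : Z1 < X1)
    (hZ : Z0 ≤ Z1) (q : ℝ → ℝ → ℝ)
    (hq : ContinuousOn (fun p : ℝ × ℝ => q p.1 p.2) (Icc T0 T1 ×ˢ Icc X0 X1)) :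
    TmNice (fun τ x => q (tm_cl T0 T1 τ) (tm_cl Z0 Z1 x)) ∧
    Continuous (fun p : ℝ × ℝ => q (tm_cl T0 T1 p.1) (tm_cl Z0 Z1 p.2)) := by
  have hq' := hq.mono (prod_mono (Subset.refl (Icc T0 T1)) (Icc_subset_Icc h0.le h1.le))
  have c := tm_cl_cts _ T0 T1 Z0 Z1 h.hT.le hZ hq'
  exact ⟨⟨c.measurable, tm_cl_bd _ T0 T1 Z0 Z1 h.hT.le hZ hq', fun τ => c.comp (Continuous.prodMk_right τ)⟩, c⟩

lemma tm_nice_ρ (h : TmRect P μ ρ v ρt ρx vt vx T0 T1 X0 X1 N) {Z0 Z1 : ℝ} (h0 : X0 < Z0) (h1 : Z1 < X1)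
    (hZ : Z0 ≤ Z1) (f : ℝ → ℝ) (hf : ContinuousOn f (Ioi 0)) :
    TmNice (fun τ x => f (ρ (tm_cl T0 T1 τ) (tm_cl Z0 Z1 x))) :=
  (tm_nice_cts h h0 h1 hZ (fun τ x => f (ρ τ x))
    (hf.comp h.ρ_cont fun p hp => h.ρ_pos _ hp.1 _ hp.2)).1

lemma tm_nice_x (h : TmRect P μ ρ v ρt ρx vt vx T0 T1 X0 X1 N) {Z0 Z1 : ℝ} (h0 : X0 < Z0) (h1 : Z1 < X1)
    (hZ : Z0 ≤ Z1) : TmNice (fun τ x => ρx (tm_cl T0 T1 τ) (tm_cl Z0 Z1 x)) ∧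
      TmNice (fun τ x => vx (tm_cl T0 T1 τ) (tm_cl Z0 Z1 x)) := by
  have mT : ∀ t, tm_cl T0 T1 t ∈ Icc T0 T1 := fun t => tm_cl_mem _ _ _ h.hT.le
  have mZ : ∀ x, tm_cl Z0 Z1 x ∈ Icc X0 X1 := fun x =>
    ⟨h0.le.trans (tm_cl_mem _ _ _ hZ).1, (tm_cl_mem _ _ _ hZ).2.trans h1.le⟩
  obtain ⟨-, -, -, -, pm, -⟩ := tm_lim_ext ρ ρx T0 T1 X0 X1 Z0 Z1 N h.hT.le h0 h1 hZ
    h.ρ_cont h.hρx h.ρx_cont h.bρx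
  obtain ⟨-, -, -, -, zm, -⟩ := tm_lim_ext v vx T0 T1 X0 X1 Z0 Z1 N h.hT.le h0 h1 hZ
    h.v_cont h.hvx h.vx_cont h.bvx
  exact ⟨⟨pm, ⟨N, fun q => h.bρx _ (mT _) _ (mZ _)⟩, fun τ =>
    (h.ρx_cont _ (mT τ)).comp_continuous (tm_cl_cont Z0 Z1) mZ⟩,
    ⟨zm, ⟨N, fun q => h.bvx _ (mT _) _ (mZ _)⟩, fun τ =>
    (h.vx_cont _ (mT τ)).comp_continuous (tm_cl_cont Z0 Z1) mZ⟩⟩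

lemma tm_nice_g (hl : TmLaw P μ P1 μ1) (h : TmRect P μ ρ v ρt ρx vt vx T0 T1 X0 X1 N) {Z0 Z1 : ℝ}
    (h0 : X0 < Z0) (h1 : Z1 < X1) (hZ : Z0 ≤ Z1) (g : ℝ → ℝ → ℝ)
    (hg : g = fun τ x => μ (ρ τ x) * vx τ x - P (ρ τ x) - ρ τ x * v τ x ^ 2) :
    TmNice (fun τ x => g (tm_cl T0 T1 τ) (tm_cl Z0 Z1 x)) := by
  have cμ : ContinuousOn μ (Ioi 0) := fun y hy => (hl.dμ y hy).continuousAt.continuousWithinAt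
  have cP : ContinuousOn P (Ioi 0) := fun y hy => (hl.dP y hy).continuousAt.continuousWithinAt
  have a1 := tm_nice_ρ h h0 h1 hZ μ cμ
  have a2 := tm_nice_ρ h h0 h1 hZ P cP
  have a3 := tm_nice_ρ h h0 h1 hZ (fun y => y) continuousOn_id
  have a4 := (tm_nice_cts h h0 h1 hZ v h.v_cont).1
  have a5 := (tm_nice_x h h0 h1 hZ).2
  have := ((a1.mul a5).sub a2).sub (a3.mul (a4.mul a4))
  subst hg
  simpa only [sq] using this
end

noncomputable def tm_J (z : ℝ) : ℝ := ∫ y in (-1:ℝ)..z, max 0 (1 - |y|)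

lemma tm_hatc : Continuous (fun y : ℝ => max 0 (1 - |y|)) := by fun_prop

lemma tm_J_deriv (z : ℝ) : HasDerivAt tm_J (max 0 (1 - |z|)) z :=
  intervalIntegral.integral_hasDerivAt_right (tm_hatc.intervalIntegrable _ _)
    (tm_hatc.stronglyMeasurableAtFilter _ _) tm_hatc.continuousAt

lemma tm_J_cont : Continuous tm_J := continuous_iff_continuousAt.2 fun z => (tm_J_deriv z).continuousAt

lemma tm_hat1 : ∫ y in Icc (-1:ℝ) 1, (1 - |y|) = 1 := by
  rw [integral_Icc_eq_integral_Ioc, ← intervalIntegral.integral_of_le (by norm_num)]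
  have c : Continuous (fun y : ℝ => 1 - |y|) := by fun_prop
  rw [← intervalIntegral.integral_add_adjacent_intervals (b := 0) (c.intervalIntegrable _ _) (c.intervalIntegrable _ _)]
  have e1 : ∫ y in (-1:ℝ)..0, (1 - |y|) = ∫ y in (-1:ℝ)..0, (1 + y) := by
    refine intervalIntegral.integral_congr fun y hy => ?_
    rw [uIcc_of_le (by norm_num)] at hy
    simp only [abs_of_nonpos hy.2]; ring
  have e2 : ∫ y in (0:ℝ)..1, (1 - |y|) = ∫ y in (0:ℝ)..1, (1 - y) := by
    refine intervalIntegral.integral_congr fun y hy => ?_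
    rw [uIcc_of_le (by norm_num)] at hy
    simp only [abs_of_nonneg hy.1]
  rw [e1, e2, intervalIntegral.integral_add (by simp) (by simp), intervalIntegral.integral_sub (by simp) (by simp)]
  norm_num [integral_id]

lemma tm_J_mono : Monotone tm_J := by
  apply monotone_of_deriv_nonneg (fun z => (tm_J_deriv z).differentiableAt)
  intro z; rw [(tm_J_deriv z).deriv]; exact le_max_left _ _

lemma tm_J_lo {z : ℝ} (hz : z ≤ -1) : tm_J z = 0 := by
  unfold tm_J
  rw [intervalIntegral.integral_symm, neg_eq_zero]
  rw [intervalIntegral.integral_congr (g := fun _ => 0)]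
  · simp
  · intro y hy
    rw [uIcc_of_le hz] at hy
    simp only
    rw [abs_of_nonpos (by linarith [hy.2])]
    exact max_eq_left (by linarith [hy.2])

lemma tm_J_hi {z : ℝ} (hz : 1 ≤ z) : tm_J z = 1 := by
  have a : tm_J 1 = 1 := by
    refine Eq.trans ?_ tm_hat1
    rw [integral_Icc_eq_integral_Ioc, ← intervalIntegral.integral_of_le (by norm_num)]
    unfold tm_J
    refine intervalIntegral.integral_congr fun y hy => ?_
    rw [uIcc_of_le (by norm_num)] at hy
    exact max_eq_right (by linarith [abs_le.2 hy])
  have b : tm_J z - tm_J 1 = 0 := by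
    unfold tm_J
    rw [intervalIntegral.integral_interval_sub_left (tm_hatc.intervalIntegrable _ _) (tm_hatc.intervalIntegrable _ _)]
    rw [intervalIntegral.integral_congr (g := fun _ => 0)]
    · simp
    · intro y hy
      rw [uIcc_of_le hz] at hy
      simp only
      rw [abs_of_nonneg (by linarith [hy.1])]
      exact max_eq_left (by linarith [hy.1])
  linarith

lemma tm_J_bd (z : ℝ) : 0 ≤ tm_J z ∧ tm_J z ≤ 1 := by
  constructor
  · rw [← tm_J_lo (min_le_right z (-1))]; exact tm_J_mono (min_le_left _ _)
  · rw [← tm_J_hi (le_max_right z 1)]; exact tm_J_mono (le_max_left _ _)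

lemma tm_hat_sub (k : ℝ → ℝ) (hk : Continuous k) (x δ Y0 Y1 : ℝ) (hδ : 0 < δ) (h0 : Y0 < x - δ) (h1 : x + δ < Y1) :
    ∫ y in Icc Y0 Y1, k y * ((max 0 (1 - |(y - x) / δ|)) / δ) =
      ∫ y in Icc (-1:ℝ) 1, k (x + δ * y) * (1 - |y|) := by
  have e1 : ∫ y in Icc Y0 Y1, k y * ((max 0 (1 - |(y - x) / δ|)) / δ) =
      ∫ y in Icc (x - δ) (x + δ), k y * ((max 0 (1 - |(y - x) / δ|)) / δ) := by
    refine setIntegral_eq_of_subset_of_forall_diff_eq_zero measurableSet_Icc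
      (Icc_subset_Icc h0.le h1.le) fun y hy => ?_
    have : 1 ≤ |(y - x) / δ| := by
      rw [abs_div, abs_of_pos hδ, le_div_iff₀ hδ, one_mul]
      by_contra hc
      push Not at hc
      rw [abs_lt] at hc
      exact hy.2 ⟨by linarith, by linarith⟩
    rw [max_eq_left (by linarith)]; simp
  rw [e1, integral_Icc_eq_integral_Ioc, ← intervalIntegral.integral_of_le (by linarith),
    integral_Icc_eq_integral_Ioc, ← intervalIntegral.integral_of_le (by norm_num)]
  have := intervalIntegral.smul_integral_comp_add_mul (a := -1) (b := 1)
    (fun y => k y * ((max 0 (1 - |(y - x) / δ|)) / δ)) δ x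
  rw [show x - δ = x + δ * (-1) by ring, show x + δ = x + δ * 1 by ring, ← this,
    ← intervalIntegral.integral_smul]
  refine intervalIntegral.integral_congr fun y hy => ?_
  rw [uIcc_of_le (by norm_num)] at hy
  simp only [smul_eq_mul, add_sub_cancel_left]
  rw [mul_div_cancel_left₀ _ hδ.ne', max_eq_right (by linarith [abs_le.2 hy])]
  field_simp

lemma tm_A4 {P μ P1 μ1 : ℝ → ℝ} (hl : TmLaw P μ P1 μ1) {ρ v ρt ρx vt vx : ℝ → ℝ → ℝ}
    {T0 T1 X0 X1 N : ℝ} (h : TmRect P μ ρ v ρt ρx vt vx T0 T1 X0 X1 N)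
    (s t x1 x2 : ℝ) (hs : T0 < s) (hst : s ≤ t) (ht : t < T1) (hX0 : X0 < x1) (h12 : x1 ≤ x2) (hX1 : x2 < X1)
    (g : ℝ → ℝ → ℝ)
    (hg : g = fun τ x => μ (ρ τ x) * vx τ x - P (ρ τ x) - ρ τ x * v τ x ^ 2) :
    (∫ x in x1..x2, ρ t x * v t x) - (∫ x in x1..x2, ρ s x * v s x) = ∫ τ in s..t, (g τ x2 - g τ x1) := by
  obtain ⟨Y0, hY0, hY0'⟩ := exists_between hX0
  obtain ⟨Y1, hY1', hY1⟩ := exists_between hX1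
  have hY : Y0 ≤ Y1 := by linarith
  have ng := tm_nice_g hl h hY0 hY1 hY g hg
  set G : ℝ → ℝ → ℝ := fun τ x => g (tm_cl T0 T1 τ) (tm_cl Y0 Y1 x) with hG
  have Gid : ∀ τ ∈ Icc s t, ∀ x ∈ Icc Y0 Y1, G τ x = g τ x := fun τ hτ x hx => by
    simp only [hG]
    rw [tm_cl_id _ _ _ hx, tm_cl_id T0 T1 τ ⟨hs.le.trans hτ.1, hτ.2.trans ht.le⟩]
  set ψ : ℝ → ℝ → ℝ := fun δ x => tm_J ((x - x1) / δ) - tm_J ((x - x2) / δ) with hψ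
  set ψx : ℝ → ℝ → ℝ := fun δ x => (max 0 (1 - |(x - x1) / δ|)) / δ - (max 0 (1 - |(x - x2) / δ|)) / δ with hψx
  have ψb : ∀ δ x, |ψ δ x| ≤ 1 := fun δ x => by
    have a1 := tm_J_bd ((x - x1) / δ)
    have a2 := tm_J_bd ((x - x2) / δ)
    simp only [hψ]; rw [abs_le]; constructor <;> linarith
  obtain ⟨d0, hd0, hd1, hd2⟩ : ∃ d0 > 0, Y0 < x1 - d0 ∧ x2 + d0 < Y1 :=
    ⟨min (x1 - Y0) (Y1 - x2) / 2, by have := lt_min (sub_pos.2 hY0') (sub_pos.2 hY1'); linarith,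
      by linarith [min_le_left (x1 - Y0) (Y1 - x2), lt_min (sub_pos.2 hY0') (sub_pos.2 hY1')],
      by linarith [min_le_right (x1 - Y0) (Y1 - x2), lt_min (sub_pos.2 hY0') (sub_pos.2 hY1')]⟩
  have key : ∀ δ, 0 < δ → δ < d0 →
      (∫ x in Icc Y0 Y1, ρ t x * v t x * ψ δ x) - (∫ x in Icc Y0 Y1, ρ s x * v s x * ψ δ x) =
      ∫ τ in s..t, ∫ y in Icc (-1:ℝ) 1, (G τ (x2 + δ * y) - G τ (x1 + δ * y)) * (1 - |y|) := by
    intro δ hδ hδ0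
    have cψ : Continuous (ψ δ) := by
      have := tm_J_cont
      simp only [hψ]; fun_prop
    have cψx : Continuous (ψx δ) := by
      simp only [hψx]; fun_prop
    have hz : ∀ x x0, x ∉ Ioo (x0 - δ) (x0 + δ) → max 0 (1 - |(x - x0) / δ|) = 0 := by
      intro x x0 hx
      apply max_eq_left
      rw [abs_div, abs_of_pos hδ, sub_nonpos, le_div_iff₀ hδ, one_mul]
      by_contra hc
      push Not at hc
      rw [abs_lt] at hc
      exact hx ⟨by linarith, by linarith⟩
    have := tm_A3 hl h (fun _ => ψ δ) (fun _ _ => 0) (fun _ => ψx δ) Y0 Y1 s t (1 + 2 / δ) hs hst ht hY0 hY1 hY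
      (cψ.comp continuous_snd) continuous_const (cψx.comp continuous_snd)
      (fun _ x => sub_nonneg.2 (tm_J_mono (by gcongr)))
      (fun _ x => (ψb δ x).trans (by have : 0 < 2 / δ := by positivity
                                     linarith))
      (fun _ _ => by simp; positivity)
      (fun _ x => by
        have b : ∀ u, 0 ≤ (max 0 (1 - |u|)) / δ ∧ (max 0 (1 - |u|)) / δ ≤ 1 / δ := fun u =>
          ⟨by positivity, by
            gcongr
            exact max_le (by norm_num) (by linarith [abs_nonneg u])⟩
        have b1 := b ((x - x1) / δ)
        have b2 := b ((x - x2) / δ)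
        have b3 : 2 / δ = 1 / δ + 1 / δ := by ring
        have b4 : 0 < 1 / δ := by positivity
        simp only [hψx]
        rw [b3, abs_le]; constructor <;> linarith)
      (fun _ x hx => by
        simp only [hψ]
        by_cases hc : x ≤ Y0
        · rw [tm_J_lo, tm_J_lo, sub_self]
          · rw [div_le_iff₀ hδ]; linarith
          · rw [div_le_iff₀ hδ]; linarith
        · have : Y1 ≤ x := by
            by_contra h'
            exact hx ⟨not_le.1 hc, not_le.1 h'⟩
          rw [tm_J_hi, tm_J_hi, sub_self]
          · rw [le_div_iff₀ hδ]; linarith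
          · rw [le_div_iff₀ hδ]; linarith)
      (fun _ x hx => by
        simp only [hψx]
        rw [hz, hz]
        · simp
        · exact fun h' => hx ⟨by linarith [h'.1], by linarith [h'.2]⟩
        · exact fun h' => hx ⟨by linarith [h'.1], by linarith [h'.2]⟩)
      (fun τ _ x => hasDerivAt_const _ _)
      (fun τ x => by
        have e : ∀ x0, HasDerivAt (fun x => tm_J ((x - x0) / δ)) ((max 0 (1 - |(x - x0) / δ|)) / δ) x := by
          intro x0
          have := (tm_J_deriv ((x - x0) / δ)).comp x (((hasDerivAt_id x).sub_const x0).div_const δ)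
          refine this.congr_deriv ?_
          ring
        exact (e x1).sub (e x2))
    rw [this]
    refine intervalIntegral.integral_congr fun τ hτ => ?_
    rw [uIcc_of_le hst] at hτ
    have gc := ng.c τ
    have gi : ∀ x0, IntegrableOn (fun x => G τ x * ((max 0 (1 - |(x - x0) / δ|)) / δ)) (Icc Y0 Y1) := fun x0 =>
      (Continuous.integrableOn_Icc (by fun_prop))
    have gj : ∀ x0, IntegrableOn (fun y => G τ (x0 + δ * y) * (1 - |y|)) (Icc (-1:ℝ) 1) := fun x0 =>
      (Continuous.integrableOn_Icc (by fun_prop))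
    have e1 : (∫ x in Icc Y0 Y1, (ρ τ x * v τ x * 0
        - (μ (ρ τ x) * vx τ x - P (ρ τ x) - ρ τ x * v τ x ^ 2) * ψx δ x)) =
        ∫ x in Icc Y0 Y1, (G τ x * ((max 0 (1 - |(x - x2) / δ|)) / δ) -
          G τ x * ((max 0 (1 - |(x - x1) / δ|)) / δ)) := by
      refine setIntegral_congr_fun measurableSet_Icc fun x hx => ?_
      simp only [hψx]
      rw [Gid τ hτ x hx, hg]
      ring
    rw [e1, integral_sub (gi x2) (gi x1), tm_hat_sub _ gc x2 δ Y0 Y1 hδ (by linarith) (by linarith),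
      tm_hat_sub _ gc x1 δ Y0 Y1 hδ (by linarith) (by linarith), ← integral_sub (gj x2) (gj x1)]
    refine setIntegral_congr_fun measurableSet_Icc fun x hx => ?_
    ring
  obtain ⟨B, hB⟩ := ng.b
  have hB0 : 0 ≤ B := (abs_nonneg _).trans (hB 0)
  have R := tm_dct2 (volume.restrict (Icc (-1:ℝ) 1))
    (fun δ τ y => (G τ (x2 + δ * y) - G τ (x1 + δ * y)) * (1 - |y|))
    (fun τ y => (G τ x2 - G τ x1) * (1 - |y|)) s t (2 * B) hst
    (Eventually.of_forall fun δ => by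
      have a : ∀ x0, Measurable (fun p : ℝ × ℝ => G p.1 (x0 + δ * p.2)) := fun x0 =>
        ng.m.comp (show Measurable (fun p : ℝ × ℝ => (p.1, x0 + δ * p.2)) by fun_prop)
      exact ((a x2).sub (a x1)).mul (by fun_prop))
    (Eventually.of_forall fun δ τ _ => by
      rw [ae_restrict_iff' measurableSet_Icc]
      refine Eventually.of_forall fun y hy => ?_
      have a1 := hB (τ, x2 + δ * y)
      have a2 := hB (τ, x1 + δ * y)
      have a3 : |G τ (x2 + δ * y) - G τ (x1 + δ * y)| ≤ 2 * B := (abs_sub _ _).trans (by simp only at a1 a2; linarith)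
      have a4 : |(1 - |y| : ℝ)| ≤ 1 := by
        have := abs_le.2 hy
        rw [abs_of_nonneg (by linarith)]; linarith [abs_nonneg y]
      rw [abs_mul]
      calc _ ≤ 2 * B * 1 := mul_le_mul a3 a4 (abs_nonneg _) (by linarith)
        _ = _ := by ring)
    (fun τ _ => Eventually.of_forall fun y => by
      have gc := ng.c τ
      have : Continuous (fun δ => (G τ (x2 + δ * y) - G τ (x1 + δ * y)) * (1 - |y|)) := by fun_prop
      simpa using (this.tendsto 0).mono_left (nhdsWithin_le_nhds (s := Ioi 0)))
  have R' : (∫ τ in s..t, ∫ y in Icc (-1:ℝ) 1, (G τ x2 - G τ x1) * (1 - |y|)) = ∫ τ in s..t, (g τ x2 - g τ x1) := by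
    refine intervalIntegral.integral_congr fun τ hτ => ?_
    rw [uIcc_of_le hst] at hτ
    rw [integral_const_mul, tm_hat1, mul_one, Gid τ hτ x2 ⟨by linarith, by linarith⟩,
      Gid τ hτ x1 ⟨by linarith, by linarith⟩]
  rw [R'] at R
  have Lf : ∀ τ ∈ Icc s t, Tendsto (fun δ => ∫ x in Icc Y0 Y1, ρ τ x * v τ x * ψ δ x) (𝓝[>] 0)
      (𝓝 (∫ x in x1..x2, ρ τ x * v τ x)) := by
    intro τ hτ
    have hτ' : τ ∈ Icc T0 T1 := ⟨hs.le.trans hτ.1, hτ.2.trans ht.le⟩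
    have cf : ContinuousOn (fun x => ρ τ x * v τ x) (Icc Y0 Y1) := by
      have : ContinuousOn (fun p : ℝ × ℝ => ρ p.1 p.2 * v p.1 p.2) (Icc T0 T1 ×ˢ Icc X0 X1) := h.ρ_cont.mul h.v_cont
      exact this.comp (Continuous.prodMk_right τ).continuousOn fun x hx => ⟨hτ', by linarith [hx.1], by linarith [hx.2]⟩
    obtain ⟨C, hC⟩ := isCompact_Icc.exists_bound_of_continuousOn cf
    have e1 : ∫ x in x1..x2, ρ τ x * v τ x = ∫ x in Icc Y0 Y1, (Ioc x1 x2).indicator (fun x => ρ τ x * v τ x) x := by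
      rw [intervalIntegral.integral_of_le h12, setIntegral_indicator measurableSet_Ioc,
        inter_eq_self_of_subset_right]
      exact fun x hx => ⟨by linarith [hx.1], by linarith [hx.2]⟩
    rw [e1]
    refine tendsto_integral_filter_of_dominated_convergence (fun _ => C) ?_ ?_ ?_ ?_
    · refine Eventually.of_forall fun δ => (cf.mul (Continuous.continuousOn ?_)).aestronglyMeasurable measurableSet_Icc
      have := tm_J_cont
      simp only [hψ]; fun_prop
    · refine Eventually.of_forall fun δ => ?_
      rw [ae_restrict_iff' measurableSet_Icc]
      refine Eventually.of_forall fun x hx => ?_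
      rw [norm_mul]
      calc _ ≤ C * 1 := mul_le_mul (hC x hx) (ψb δ x) (abs_nonneg _) ((norm_nonneg _).trans (hC x hx))
        _ = C := mul_one C
    · exact integrable_const C
    · filter_upwards [ae_restrict_of_ae (Measure.ae_ne volume x1), ae_restrict_of_ae (Measure.ae_ne volume x2)] with x n1 n2
      refine tendsto_const_nhds.congr' ?_
      have lo : ∀ x0, x < x0 → ∀ᶠ δ in 𝓝[>] (0:ℝ), tm_J ((x - x0) / δ) = 0 := by
        intro x0 hx
        filter_upwards [self_mem_nhdsWithin, Ioo_mem_nhdsGT (sub_pos.2 hx)] with δ hδ hδ2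
        have hδ : 0 < δ := hδ
        apply tm_J_lo
        rw [div_le_iff₀ hδ]; linarith [hδ2.2]
      have hi : ∀ x0, x0 < x → ∀ᶠ δ in 𝓝[>] (0:ℝ), tm_J ((x - x0) / δ) = 1 := by
        intro x0 hx
        filter_upwards [self_mem_nhdsWithin, Ioo_mem_nhdsGT (sub_pos.2 hx)] with δ hδ hδ2
        have hδ : 0 < δ := hδ
        apply tm_J_hi
        rw [le_div_iff₀ hδ]; linarith [hδ2.2]
      rcases lt_or_gt_of_ne n1 with a | a
      · filter_upwards [lo x1 a, lo x2 (by linarith)] with δ b1 b2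
        simp only [hψ, b1, b2]
        rw [indicator_of_notMem (fun hh => by linarith [hh.1])]; ring
      rcases lt_or_gt_of_ne n2 with b | b
      · filter_upwards [hi x1 a, lo x2 b] with δ b1 b2
        simp only [hψ, b1, b2]
        rw [indicator_of_mem (show x ∈ Ioc x1 x2 from ⟨a, b.le⟩)]; ring
      · filter_upwards [hi x1 a, hi x2 b] with δ b1 b2
        simp only [hψ, b1, b2]
        rw [indicator_of_notMem (fun hh => by linarith [hh.2])]; ring
  refine tendsto_nhds_unique ((Lf t ⟨hst, le_rfl⟩).sub (Lf s ⟨le_rfl, hst⟩)) (R.congr' ?_)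
  filter_upwards [Ioo_mem_nhdsGT hd0] with δ hδ using (key δ hδ.1 hδ.2).symm

section
variable {P μ P1 μ1 : ℝ → ℝ} {ρ v ρt ρx vt vx : ℝ → ℝ → ℝ} {T0 T1 X0 X1 N : ℝ}

lemma tm_lipc (X : ℝ → ℝ) (s t L : ℝ) (hst : s ≤ t) (hL0 : 0 ≤ L)
    (hL : ∀ τ ∈ Icc s t, ∀ τ' ∈ Icc s t, |X τ - X τ'| ≤ L * |τ - τ'|) :
    (∀ τ τ', |X (tm_cl s t τ) - X (tm_cl s t τ')| ≤ L * |τ - τ'|) ∧ Continuous (fun τ => X (tm_cl s t τ)) := by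
  have a : ∀ τ τ', |X (tm_cl s t τ) - X (tm_cl s t τ')| ≤ L * |τ - τ'| := fun τ τ' =>
    (hL _ (tm_cl_mem _ _ _ hst) _ (tm_cl_mem _ _ _ hst)).trans
      (mul_le_mul_of_nonneg_left (tm_cl_lip _ _ _ _) hL0)
  refine ⟨a, ?_⟩
  have : LipschitzWith ⟨L, hL0⟩ (fun τ => X (tm_cl s t τ)) := by
    refine LipschitzWith.of_dist_le_mul fun x y => ?_
    rw [Real.dist_eq, Real.dist_eq]; exact a x y
  exact this.continuous

lemma tm_cons1 (h : TmRect P μ ρ v ρt ρx vt vx T0 T1 X0 X1 N) {Z0 Z1 : ℝ} (h0 : X0 < Z0) (h1 : Z1 < X1)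
    (hZ : Z0 ≤ Z1) (k g : ℝ → ℝ → ℝ)
    (hk : ContinuousOn (fun p : ℝ × ℝ => k p.1 p.2) (Icc T0 T1 ×ˢ Icc X0 X1))
    (ng : TmNice (fun τ x => g (tm_cl T0 T1 τ) (tm_cl Z0 Z1 x)))
    (hcl : ∀ s t x, T0 < s → s ≤ t → t < T1 → x ∈ Icc Z0 Z1 →
      (∫ y in Z0..x, k t y) - (∫ y in Z0..x, k s y) = ∫ τ in s..t, (g τ x - g τ Z0))
    (s t L : ℝ) (hs : T0 < s) (hst : s ≤ t) (ht : t < T1) (hL0 : 0 ≤ L) (X X' : ℝ → ℝ)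
    (hL : ∀ τ ∈ Icc s t, ∀ τ' ∈ Icc s t, |X τ - X τ'| ≤ L * |τ - τ'|)
    (hX : ∀ τ ∈ Icc s t, X τ ∈ Ioo Z0 Z1) (hX' : ∀ τ ∈ Ioo s t, HasDerivAt X (X' τ) τ) :
    IntervalIntegrable (fun τ => (g τ (X τ) - g τ Z0) + k τ (X τ) * X' τ) volume s t ∧
    (∫ y in Z0..(X t), k t y) - (∫ y in Z0..(X s), k s y) =
      ∫ τ in s..t, ((g τ (X τ) - g τ Z0) + k τ (X τ) * X' τ) := by
  obtain ⟨nk, ck⟩ := tm_nice_cts h h0 h1 hZ k hk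
  set K : ℝ → ℝ → ℝ := fun τ x => k (tm_cl T0 T1 τ) (tm_cl Z0 Z1 x) with hK
  obtain ⟨lipX, cX⟩ := tm_lipc X s t L hst hL0 hL
  set q : ℝ → ℝ → ℝ := fun τ x => ∫ y in Z0..(tm_cl Z0 Z1 x), K τ y with hq
  have cq : Continuous (fun p : ℝ × ℝ => q p.1 p.2) := by
    have a1 : Continuous (fun p : ℝ × ℝ × ℝ => K p.1 p.2.2) := ck.comp (show Continuous (fun p : ℝ × ℝ × ℝ => (p.1, p.2.2)) by fun_prop)
    have := intervalIntegral.continuous_parametric_intervalIntegral_of_continuous (μ := volume) (a₀ := Z0)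
      (f := fun (p : ℝ × ℝ) y => K p.1 y) (s := fun p => tm_cl Z0 Z1 p.2)
      (ck.comp (show Continuous (fun p : (ℝ × ℝ) × ℝ => (p.1.1, p.2)) by fun_prop))
      ((tm_cl_cont Z0 Z1).comp continuous_snd)
    exact this
  obtain ⟨B1, hB1⟩ := nk.b
  obtain ⟨B2, hB2⟩ := ng.b
  have hB10 : 0 ≤ B1 := (abs_nonneg _).trans (hB1 0)
  have hB20 : 0 ≤ B2 := (abs_nonneg _).trans (hB2 0)
  obtain ⟨T2, hT2, hT2'⟩ := exists_between ht
  have idT : ∀ τ ∈ Icc s T2, tm_cl T0 T1 τ = τ := fun τ hτ => tm_cl_id _ _ _ ⟨hs.le.trans hτ.1, hτ.2.trans hT2'.le⟩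
  have qe : ∀ τ ∈ Icc s T2, ∀ x ∈ Icc Z0 Z1, q τ x = ∫ y in Z0..x, k τ y := by
    intro τ hτ x hx
    simp only [hq, hK, idT τ hτ, tm_cl_id _ _ _ hx]
    refine intervalIntegral.integral_congr fun y hy => ?_
    rw [uIcc_of_le hx.1] at hy
    simp only [tm_cl_id Z0 Z1 y ⟨hy.1, hy.2.trans hx.2⟩]
  have sub3 : ∀ τ ∈ Icc s t, τ ∈ Icc s T2 := fun τ hτ => ⟨hτ.1, hτ.2.trans hT2.le⟩
  have main := tm_chain q (fun τ x => g (tm_cl T0 T1 τ) (tm_cl Z0 Z1 x) - g (tm_cl T0 T1 τ) (tm_cl Z0 Z1 Z0))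
    (fun τ => X (tm_cl s t τ)) X' (fun τ => K τ (X τ)) s t T2 (B1 + 2 * B2) L hst hT2 (by linarith) hL0 cq
    (fun τ x y => by
      have kc := nk.c τ
      have e : q τ x - q τ y = ∫ z in (tm_cl Z0 Z1 y)..(tm_cl Z0 Z1 x), K τ z := by
        simp only [hq]
        rw [intervalIntegral.integral_interval_sub_left (kc.intervalIntegrable _ _) (kc.intervalIntegrable _ _)]
      rw [e]
      refine (intervalIntegral.norm_integral_le_of_norm_le_const (C := B1) (f := fun z => K τ z) fun z _ => hB1 (τ, z)).trans ?_
      exact mul_le_mul (by linarith) (tm_cl_lip _ _ _ _) (abs_nonneg _) (by linarith))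
    (ng.m.sub (ng.m.comp (show Measurable (fun p : ℝ × ℝ => (p.1, Z0)) by fun_prop)))
    (fun τ x => (abs_sub _ _).trans (by
      have a1 := hB2 (τ, x)
      have a2 := hB2 (τ, Z0)
      simp only at a1 a2
      linarith))
    (fun τ hτ => ((ng.c τ).sub continuous_const).continuousAt)
    (fun τ τ' x h1 h2 h3 => by
      have hx := tm_cl_mem Z0 Z1 x hZ
      have a1 : ∀ τ ∈ Icc s T2, q τ x = ∫ y in Z0..(tm_cl Z0 Z1 x), k τ y := fun τ hτ => by
        rw [← qe τ hτ _ hx]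
        simp only [hq]; rw [tm_cl_id _ _ _ hx]
      rw [a1 τ ⟨h1, h2.trans h3⟩, a1 τ' ⟨h1.trans h2, h3⟩,
        hcl τ τ' _ (hs.trans_le h1) h2 (h3.trans_lt hT2') hx]
      refine intervalIntegral.integral_congr fun σ hσ => ?_
      rw [uIcc_of_le h2] at hσ
      simp only [idT σ ⟨h1.trans hσ.1, hσ.2.trans h3⟩, tm_cl_id Z0 Z1 Z0 ⟨le_rfl, hZ⟩])
    cX lipX
    (fun τ hτ => by
      refine (hX' τ hτ).congr_of_eventuallyEq ?_
      filter_upwards [Ioo_mem_nhds hτ.1 hτ.2] with y hy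
      rw [tm_cl_id _ _ _ (Ioo_subset_Icc_self hy)])
    (fun τ hτ => by
      rw [tm_cl_id _ _ _ (Ioo_subset_Icc_self hτ)]
      have hx := hX τ (Ioo_subset_Icc_self hτ)
      have kc := nk.c τ
      have := intervalIntegral.integral_hasDerivAt_right (kc.intervalIntegrable Z0 (X τ))
        (kc.stronglyMeasurableAtFilter _ _) kc.continuousAt
      refine this.congr_of_eventuallyEq ?_
      filter_upwards [Ioo_mem_nhds hx.1 hx.2] with y hy
      simp only [hq]
      rw [tm_cl_id _ _ _ (Ioo_subset_Icc_self hy)])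
  have ge : ∀ τ ∈ Icc s t, g (tm_cl T0 T1 τ) (tm_cl Z0 Z1 (X (tm_cl s t τ))) - g (tm_cl T0 T1 τ) (tm_cl Z0 Z1 Z0)
      + K τ (X τ) * X' τ = (g τ (X τ) - g τ Z0) + k τ (X τ) * X' τ := by
    intro τ hτ
    simp only [hK]
    rw [tm_cl_id s t τ hτ, idT τ (sub3 τ hτ), tm_cl_id _ _ _ (Ioo_subset_Icc_self (hX τ hτ)),
      tm_cl_id Z0 Z1 Z0 ⟨le_rfl, hZ⟩]
  rw [tm_cl_id s t t ⟨hst, le_rfl⟩, tm_cl_id s t s ⟨le_rfl, hst⟩,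
    qe t (sub3 t ⟨hst, le_rfl⟩) _ (Ioo_subset_Icc_self (hX t ⟨hst, le_rfl⟩)),
    qe s (sub3 s ⟨le_rfl, hst⟩) _ (Ioo_subset_Icc_self (hX s ⟨le_rfl, hst⟩))] at main
  refine ⟨main.1.congr fun τ hτ => ?_, main.2.trans (intervalIntegral.integral_congr fun τ hτ => ?_)⟩
  · rw [uIoc_of_le hst] at hτ
    exact ge τ (Ioc_subset_Icc_self hτ)
  · rw [uIcc_of_le hst] at hτ
    exact ge τ hτ

lemma tm_cons2 (h : TmRect P μ ρ v ρt ρx vt vx T0 T1 X0 X1 N) {Z0 Z1 : ℝ} (h0 : X0 < Z0) (h1 : Z1 < X1)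
    (hZ : Z0 ≤ Z1) (k g : ℝ → ℝ → ℝ)
    (hk : ContinuousOn (fun p : ℝ × ℝ => k p.1 p.2) (Icc T0 T1 ×ˢ Icc X0 X1))
    (ng : TmNice (fun τ x => g (tm_cl T0 T1 τ) (tm_cl Z0 Z1 x)))
    (hcl : ∀ s t x, T0 < s → s ≤ t → t < T1 → x ∈ Icc Z0 Z1 →
      (∫ y in Z0..x, k t y) - (∫ y in Z0..x, k s y) = ∫ τ in s..t, (g τ x - g τ Z0))
    (s t L : ℝ) (hs : T0 < s) (hst : s ≤ t) (ht : t < T1) (hL0 : 0 ≤ L) (X X' Y Y' : ℝ → ℝ)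
    (hL : ∀ τ ∈ Icc s t, ∀ τ' ∈ Icc s t, |X τ - X τ'| ≤ L * |τ - τ'|)
    (hX : ∀ τ ∈ Icc s t, X τ ∈ Ioo Z0 Z1) (hX' : ∀ τ ∈ Ioo s t, HasDerivAt X (X' τ) τ)
    (hLY : ∀ τ ∈ Icc s t, ∀ τ' ∈ Icc s t, |Y τ - Y τ'| ≤ L * |τ - τ'|)
    (hY : ∀ τ ∈ Icc s t, Y τ ∈ Ioo Z0 Z1) (hY' : ∀ τ ∈ Ioo s t, HasDerivAt Y (Y' τ) τ) :
    IntervalIntegrable (fun τ => (g τ (Y τ) + k τ (Y τ) * Y' τ) - (g τ (X τ) + k τ (X τ) * X' τ)) volume s t ∧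
    (∫ y in (X t)..(Y t), k t y) - (∫ y in (X s)..(Y s), k s y) =
      ∫ τ in s..t, ((g τ (Y τ) + k τ (Y τ) * Y' τ) - (g τ (X τ) + k τ (X τ) * X' τ)) := by
  obtain ⟨a1, a2⟩ := tm_cons1 h h0 h1 hZ k g hk ng hcl s t L hs hst ht hL0 X X' hL hX hX'
  obtain ⟨b1, b2⟩ := tm_cons1 h h0 h1 hZ k g hk ng hcl s t L hs hst ht hL0 Y Y' hLY hY hY'
  have kc : ∀ τ ∈ Icc s t, ∀ x ∈ Icc Z0 Z1, IntervalIntegrable (k τ) volume Z0 x := by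
    intro τ hτ x hx
    apply ContinuousOn.intervalIntegrable
    rw [uIcc_of_le hx.1]
    exact hk.comp (Continuous.prodMk_right τ).continuousOn fun y hy =>
      ⟨⟨hs.le.trans hτ.1, hτ.2.trans ht.le⟩, h0.le.trans hy.1, (hy.2.trans hx.2).trans h1.le⟩
  have e : ∀ τ ∈ Icc s t, (∫ y in (X τ)..(Y τ), k τ y) = (∫ y in Z0..(Y τ), k τ y) - ∫ y in Z0..(X τ), k τ y :=
    fun τ hτ => by
      rw [intervalIntegral.integral_interval_sub_left (kc τ hτ _ (Ioo_subset_Icc_self (hY τ hτ)))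
        (kc τ hτ _ (Ioo_subset_Icc_self (hX τ hτ)))]
  have f : (fun τ => ((g τ (Y τ) - g τ Z0) + k τ (Y τ) * Y' τ) - ((g τ (X τ) - g τ Z0) + k τ (X τ) * X' τ)) =
    fun τ => (g τ (Y τ) + k τ (Y τ) * Y' τ) - (g τ (X τ) + k τ (X τ) * X' τ) := by
    funext τ; ring
  have i := b1.sub a1
  have j := intervalIntegral.integral_sub b1 a1
  rw [f] at j
  constructor
  · rw [← f]; exact i
  · rw [j, ← a2, ← b2, e t ⟨hst, le_rfl⟩, e s ⟨le_rfl, hst⟩]; ring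

lemma tm_R1 (hl : TmLaw P μ P1 μ1) (h : TmRect P μ ρ v ρt ρx vt vx T0 T1 X0 X1 N) {Z0 Z1 : ℝ} (h0 : X0 < Z0) (h1 : Z1 < X1)
    (hZ : Z0 ≤ Z1)
    (s t L : ℝ) (hs : T0 < s) (hst : s ≤ t) (ht : t < T1) (hL0 : 0 ≤ L) (X X' Y Y' : ℝ → ℝ)
    (hL : ∀ τ ∈ Icc s t, ∀ τ' ∈ Icc s t, |X τ - X τ'| ≤ L * |τ - τ'|)
    (hX : ∀ τ ∈ Icc s t, X τ ∈ Ioo Z0 Z1) (hX' : ∀ τ ∈ Ioo s t, HasDerivAt X (X' τ) τ)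
    (hLY : ∀ τ ∈ Icc s t, ∀ τ' ∈ Icc s t, |Y τ - Y τ'| ≤ L * |τ - τ'|)
    (hY : ∀ τ ∈ Icc s t, Y τ ∈ Ioo Z0 Z1) (hY' : ∀ τ ∈ Ioo s t, HasDerivAt Y (Y' τ) τ)
    (g : ℝ → ℝ → ℝ) (hg : g = fun τ x => μ (ρ τ x) * vx τ x - P (ρ τ x) - ρ τ x * v τ x ^ 2) :
    IntervalIntegrable (fun τ => (g τ (Y τ) + ρ τ (Y τ) * v τ (Y τ) * Y' τ) - (g τ (X τ) + ρ τ (X τ) * v τ (X τ) * X' τ)) volume s t ∧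
    (∫ y in (X t)..(Y t), ρ t y * v t y) - (∫ y in (X s)..(Y s), ρ s y * v s y) =
      ∫ τ in s..t, ((g τ (Y τ) + ρ τ (Y τ) * v τ (Y τ) * Y' τ) - (g τ (X τ) + ρ τ (X τ) * v τ (X τ) * X' τ)) :=
  tm_cons2 h h0 h1 hZ (fun τ x => ρ τ x * v τ x) g (h.ρ_cont.mul h.v_cont) (tm_nice_g hl h h0 h1 hZ g hg)
    (fun s t x a b c d => tm_A4 hl h s t Z0 x a b c h0 d.1 (d.2.trans_lt h1) g hg) s t L hs hst ht hL0 X X' Y Y' hL hX hX' hLY hY hY'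

lemma tm_R0 (h : TmRect P μ ρ v ρt ρx vt vx T0 T1 X0 X1 N) {Z0 Z1 : ℝ} (h0 : X0 < Z0) (h1 : Z1 < X1)
    (hZ : Z0 ≤ Z1)
    (s t L : ℝ) (hs : T0 < s) (hst : s ≤ t) (ht : t < T1) (hL0 : 0 ≤ L) (X X' Y Y' : ℝ → ℝ)
    (hL : ∀ τ ∈ Icc s t, ∀ τ' ∈ Icc s t, |X τ - X τ'| ≤ L * |τ - τ'|)
    (hX : ∀ τ ∈ Icc s t, X τ ∈ Ioo Z0 Z1) (hX' : ∀ τ ∈ Ioo s t, HasDerivAt X (X' τ) τ)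
    (hLY : ∀ τ ∈ Icc s t, ∀ τ' ∈ Icc s t, |Y τ - Y τ'| ≤ L * |τ - τ'|)
    (hY : ∀ τ ∈ Icc s t, Y τ ∈ Ioo Z0 Z1) (hY' : ∀ τ ∈ Ioo s t, HasDerivAt Y (Y' τ) τ) :
    IntervalIntegrable (fun τ => (-(ρ τ (Y τ) * v τ (Y τ)) + ρ τ (Y τ) * Y' τ) - (-(ρ τ (X τ) * v τ (X τ)) + ρ τ (X τ) * X' τ)) volume s t ∧
    (∫ y in (X t)..(Y t), ρ t y) - (∫ y in (X s)..(Y s), ρ s y) =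
      ∫ τ in s..t, ((-(ρ τ (Y τ) * v τ (Y τ)) + ρ τ (Y τ) * Y' τ) - (-(ρ τ (X τ) * v τ (X τ)) + ρ τ (X τ) * X' τ)) := by
  have n1 := (tm_nice_cts h h0 h1 hZ (fun τ x => ρ τ x * v τ x) (h.ρ_cont.mul h.v_cont)).1
  have nr := (tm_nice_cts h h0 h1 hZ ρ h.ρ_cont).1
  have nv := (tm_nice_cts h h0 h1 hZ v h.v_cont).1
  obtain ⟨np, nz⟩ := tm_nice_x h h0 h1 hZ
  have nrt := ((np.mul nv).add (nr.mul nz)).neg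
  refine tm_cons2 h h0 h1 hZ ρ (fun τ x => -(ρ τ x * v τ x)) h.ρ_cont n1.neg
    (fun s t x a b c d => ?_) s t L hs hst ht hL0 X X' Y Y' hL hX hX' hLY hY hY'
  have idT : ∀ τ ∈ Icc s t, tm_cl T0 T1 τ = τ := fun τ hτ => tm_cl_id _ _ _ ⟨a.le.trans hτ.1, hτ.2.trans c.le⟩
  have inT : ∀ τ ∈ Icc s t, τ ∈ Icc T0 T1 := fun τ hτ => ⟨a.le.trans hτ.1, hτ.2.trans c.le⟩
  have idZ : ∀ y ∈ Icc Z0 x, tm_cl Z0 Z1 y = y := fun y hy => tm_cl_id _ _ _ ⟨hy.1, hy.2.trans d.2⟩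
  have inX : ∀ y ∈ Icc Z0 x, y ∈ Icc X0 X1 := fun y hy => ⟨h0.le.trans hy.1, (hy.2.trans d.2).trans h1.le⟩
  set F : ℝ → ℝ → ℝ := fun τ x => -(ρx (tm_cl T0 T1 τ) (tm_cl Z0 Z1 x) * v (tm_cl T0 T1 τ) (tm_cl Z0 Z1 x) +
            ρ (tm_cl T0 T1 τ) (tm_cl Z0 Z1 x) * vx (tm_cl T0 T1 τ) (tm_cl Z0 Z1 x)) with hF
  have Fe : ∀ τ ∈ Icc s t, ∀ y ∈ Icc Z0 x, F τ y = ρt τ y := fun τ hτ y hy => by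
    simp only [hF, idT τ hτ, idZ y hy]
    linarith [h.mass τ (inT τ hτ) y (inX y hy)]
  obtain ⟨B, hB⟩ := nrt.b
  have mF1 : ∀ y, Measurable (fun τ => F τ y) := fun y => nrt.m.comp (show Measurable (fun τ : ℝ => (τ, y)) by fun_prop)
  have s1 : ∀ y ∈ Icc Z0 x, ρ t y - ρ s y = ∫ τ in s..t, F τ y := by
    intro y hy
    rw [intervalIntegral.integral_eq_sub_of_hasDerivAt (f := fun τ => ρ τ y) ?_
      (tm_bint _ (mF1 y) B (fun τ => hB (τ, y)) _ _)]
    intro τ hτ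
    rw [uIcc_of_le b] at hτ
    rw [Fe τ hτ y hy]
    exact h.hρt τ (inT τ hτ) y (inX y hy)
  have s2 : ∀ τ ∈ Icc s t, (∫ y in Z0..x, F τ y) = -(ρ τ x * v τ x) - -(ρ τ Z0 * v τ Z0) := by
    intro τ hτ
    rw [intervalIntegral.integral_eq_sub_of_hasDerivAt (f := fun y => -(ρ τ y * v τ y)) ?_
      ((nrt.c τ).intervalIntegrable _ _)]
    intro y hy
    rw [uIcc_of_le d.1] at hy
    have := ((h.hρx τ (inT τ hτ) y (inX y hy)).mul (h.hvx τ (inT τ hτ) y (inX y hy))).neg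
    refine this.congr_deriv ?_
    simp only [hF, idT τ hτ, idZ y hy]
  have kc : ∀ τ ∈ Icc s t, IntervalIntegrable (ρ τ) volume Z0 x := by
    intro τ hτ
    apply ContinuousOn.intervalIntegrable
    rw [uIcc_of_le d.1]
    exact h.ρ_cont.comp (Continuous.prodMk_right τ).continuousOn fun y hy => ⟨inT τ hτ, inX y hy⟩
  rw [← intervalIntegral.integral_sub (kc t ⟨b, le_rfl⟩) (kc s ⟨le_rfl, b⟩),
    intervalIntegral.integral_congr (g := fun y => ∫ τ in s..t, F τ y) (fun y hy => s1 y (by rwa [uIcc_of_le d.1] at hy)),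
    intervalIntegral_intervalIntegral_swap]
  · exact intervalIntegral.integral_congr fun τ hτ => s2 τ (by rwa [uIcc_of_le b] at hτ)
  · refine Measure.integrableOn_of_bounded (M := B) ?_ ?_ ?_
    · rw [Measure.volume_eq_prod, Measure.prod_prod, uIoc_of_le b, uIoc_of_le d.1]
      simp [ENNReal.mul_eq_top]
    · have : Measurable (fun p : ℝ × ℝ => F p.2 p.1) := nrt.m.comp measurable_swap
      exact this.aestronglyMeasurable
    · exact Eventually.of_forall fun p => hB (p.2, p.1)

lemma tm_R2 (hl : TmLaw P μ P1 μ1) (h : TmRect P μ ρ v ρt ρx vt vx T0 T1 X0 X1 N) {Z0 Z1 : ℝ} (h0 : X0 < Z0) (h1 : Z1 < X1)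
    (hZ : Z0 ≤ Z1) (M : ℝ → ℝ) (hM : ∀ y, 0 < y → HasDerivAt M (μ y / y) y)
    (s t L : ℝ) (hs : T0 < s) (hst : s ≤ t) (ht : t < T1) (hL0 : 0 ≤ L) (X X' : ℝ → ℝ)
    (hL : ∀ τ ∈ Icc s t, ∀ τ' ∈ Icc s t, |X τ - X τ'| ≤ L * |τ - τ'|)
    (hX : ∀ τ ∈ Icc s t, X τ ∈ Ioo Z0 Z1) (hX' : ∀ τ ∈ Ioo s t, HasDerivAt X (X' τ) τ)
    (hXv : ∀ τ ∈ Ioo s t, X' τ = v τ (X τ)) :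
    IntervalIntegrable (fun τ => -(μ (ρ τ (X τ)) * vx τ (X τ))) volume s t ∧
    M (ρ t (X t)) - M (ρ s (X s)) = ∫ τ in s..t, -(μ (ρ τ (X τ)) * vx τ (X τ)) := by
  have cμ : ContinuousOn μ (Ioi 0) := fun y hy => (hl.dμ y hy).continuousAt.continuousWithinAt
  have cM : ContinuousOn M (Ioi 0) := fun y hy => (hM y hy).continuousAt.continuousWithinAt
  have nr := (tm_nice_cts h h0 h1 hZ ρ h.ρ_cont).1
  have nv := (tm_nice_cts h h0 h1 hZ v h.v_cont).1
  have nm := tm_nice_ρ h h0 h1 hZ (fun y => μ y / y) (cμ.div continuousOn_id fun y hy => ne_of_gt hy)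
  obtain ⟨np, nz⟩ := tm_nice_x h h0 h1 hZ
  have nG := nm.mul (((np.mul nv).add (nr.mul nz)).neg)
  have cq := (tm_nice_cts h h0 h1 hZ (fun τ x => M (ρ τ x))
    (cM.comp h.ρ_cont fun p hp => h.ρ_pos _ hp.1 _ hp.2)).2
  obtain ⟨lipX, cX⟩ := tm_lipc X s t L hst hL0 hL
  obtain ⟨B1, hB1⟩ := nG.b
  obtain ⟨B2, hB2⟩ := (nm.mul np).b
  have hB10 : 0 ≤ B1 := (abs_nonneg _).trans (hB1 0)
  have hB20 : 0 ≤ B2 := (abs_nonneg _).trans (hB2 0)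
  obtain ⟨T2, hT2, hT2'⟩ := exists_between ht
  have inT : ∀ τ ∈ Icc s T2, τ ∈ Icc T0 T1 := fun τ hτ => ⟨hs.le.trans hτ.1, hτ.2.trans hT2'.le⟩
  have idT : ∀ τ ∈ Icc s T2, tm_cl T0 T1 τ = τ := fun τ hτ => tm_cl_id _ _ _ (inT τ hτ)
  have mT : ∀ t, tm_cl T0 T1 t ∈ Icc T0 T1 := fun t => tm_cl_mem _ _ _ h.hT.le
  have sub3 : ∀ τ ∈ Icc s t, τ ∈ Icc s T2 := fun τ hτ => ⟨hτ.1, hτ.2.trans hT2.le⟩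
  have ZX : ∀ x ∈ Icc Z0 Z1, x ∈ Icc X0 X1 := fun x hx => ⟨h0.le.trans hx.1, hx.2.trans h1.le⟩
  have mF1 := fun y => nG.m.comp (show Measurable (fun τ : ℝ => (τ, y)) by fun_prop)
  have main := tm_chain (fun τ x => M (ρ (tm_cl T0 T1 τ) (tm_cl Z0 Z1 x))) _
    (fun τ => X (tm_cl s t τ)) X' (fun τ => μ (ρ τ (X τ)) / ρ τ (X τ) * ρx τ (X τ)) s t T2 (B1 + B2) L hst hT2
    (by linarith) hL0 cq
    (fun τ x y => by
      refine (tm_lip (fun y => M (ρ (tm_cl T0 T1 τ) y)) (fun y => μ (ρ (tm_cl T0 T1 τ) y) / ρ (tm_cl T0 T1 τ) y *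
        ρx (tm_cl T0 T1 τ) y) Z0 Z1 B2 (fun y hy => (hM _ (h.ρ_pos _ (mT τ) y (ZX y hy))).comp y (h.hρx _ (mT τ) y (ZX y hy)))
        (fun y hy => by
          have := hB2 (τ, y)
          simp only [tm_cl_id Z0 Z1 y hy] at this
          exact this) _ (tm_cl_mem _ _ x hZ) _ (tm_cl_mem _ _ y hZ)).trans ?_
      exact mul_le_mul (by linarith) (tm_cl_lip _ _ _ _) (abs_nonneg _) (by linarith))
    nG.m (fun τ x => (hB1 (τ, x)).trans (by linarith))
    (fun τ hτ => (nG.c τ).continuousAt)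
    (fun τ τ' x k1 k2 k3 => by
      have hx := tm_cl_mem Z0 Z1 x hZ
      have := intervalIntegral.integral_eq_sub_of_hasDerivAt (f := fun τ => M (ρ τ (tm_cl Z0 Z1 x))) (a := τ) (b := τ') ?_
        (tm_bint _ (mF1 x) B1 (fun τ => hB1 (τ, x)) _ _)
      · rw [idT τ ⟨k1, k2.trans k3⟩, idT τ' ⟨k1.trans k2, k3⟩, ← this]
        rfl
      · intro σ hσ
        rw [uIcc_of_le k2] at hσ
        have hσ' : σ ∈ Icc s T2 := ⟨k1.trans hσ.1, hσ.2.trans k3⟩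
        have e := (hM _ (h.ρ_pos _ (inT σ hσ') _ (ZX _ hx))).comp σ (h.hρt _ (inT σ hσ') _ (ZX _ hx))
        refine e.congr_deriv ?_
        simp only [Function.comp, idT σ hσ']
        rw [show ρt σ (tm_cl Z0 Z1 x) = -(ρx σ (tm_cl Z0 Z1 x) * v σ (tm_cl Z0 Z1 x) + ρ σ (tm_cl Z0 Z1 x) * vx σ (tm_cl Z0 Z1 x)) by
          linarith [h.mass σ (inT σ hσ') _ (ZX _ hx)]])
    cX lipX
    (fun τ hτ => by
      refine (hX' τ hτ).congr_of_eventuallyEq ?_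
      filter_upwards [Ioo_mem_nhds hτ.1 hτ.2] with y hy
      rw [tm_cl_id _ _ _ (Ioo_subset_Icc_self hy)])
    (fun τ hτ => by
      rw [tm_cl_id _ _ _ (Ioo_subset_Icc_self hτ)]
      have hτ' := sub3 τ (Ioo_subset_Icc_self hτ)
      have hx := hX τ (Ioo_subset_Icc_self hτ)
      have hx' := ZX _ (Ioo_subset_Icc_self hx)
      refine ((hM _ (h.ρ_pos _ (inT τ hτ') _ hx')).comp (X τ) (h.hρx _ (inT τ hτ') _ hx')).congr_of_eventuallyEq ?_
      filter_upwards [Ioo_mem_nhds hx.1 hx.2] with y hy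
      rw [idT τ hτ', tm_cl_id _ _ _ (Ioo_subset_Icc_self hy)]
      rfl)
  rw [tm_cl_id s t t ⟨hst, le_rfl⟩, tm_cl_id s t s ⟨le_rfl, hst⟩, idT s ⟨le_rfl, hst.trans hT2.le⟩, idT t ⟨hst, hT2.le⟩,
    tm_cl_id _ _ _ (Ioo_subset_Icc_self (hX t ⟨hst, le_rfl⟩)),
    tm_cl_id _ _ _ (Ioo_subset_Icc_self (hX s ⟨le_rfl, hst⟩))] at main
  have ge : ∀ τ ∈ Ioo s t, μ (ρ (tm_cl T0 T1 τ) (tm_cl Z0 Z1 (X (tm_cl s t τ)))) /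
                ρ (tm_cl T0 T1 τ) (tm_cl Z0 Z1 (X (tm_cl s t τ))) *
              -(ρx (tm_cl T0 T1 τ) (tm_cl Z0 Z1 (X (tm_cl s t τ))) * v (tm_cl T0 T1 τ) (tm_cl Z0 Z1 (X (tm_cl s t τ))) +
                  ρ (tm_cl T0 T1 τ) (tm_cl Z0 Z1 (X (tm_cl s t τ))) *
                    vx (tm_cl T0 T1 τ) (tm_cl Z0 Z1 (X (tm_cl s t τ)))) +
            μ (ρ τ (X τ)) / ρ τ (X τ) * ρx τ (X τ) * X' τ = -(μ (ρ τ (X τ)) * vx τ (X τ)) := by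
    intro τ hτ
    have hτ' := Ioo_subset_Icc_self hτ
    rw [hXv τ hτ, tm_cl_id s t τ hτ', idT τ (sub3 τ hτ'), tm_cl_id _ _ _ (Ioo_subset_Icc_self (hX τ hτ'))]
    have := h.ρ_pos τ (inT τ (sub3 τ hτ')) _ (ZX _ (Ioo_subset_Icc_self (hX τ hτ')))
    field_simp
    ring
  have hae : ∀ᵐ τ : ℝ, τ ∈ uIoc s t → τ ∈ Ioo s t := by
    filter_upwards [Measure.ae_ne volume t] with τ h1 h2
    rw [uIoc_of_le hst] at h2
    exact ⟨h2.1, lt_of_le_of_ne h2.2 h1⟩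
  refine ⟨main.1.congr_ae ?_, main.2.trans (intervalIntegral.integral_congr_ae ?_)⟩
  · rw [EventuallyEq, ae_restrict_iff' measurableSet_uIoc]
    filter_upwards [hae] with τ k1 k2 using ge τ (k1 k2)
  · filter_upwards [hae] with τ k1 k2 using ge τ (k1 k2)
end

section
variable {P μ P1 μ1 : ℝ → ℝ} {Pe : ℝ}

def TmB (S : PistonSol P μ Pe) (N t : ℝ) : Prop :=
  ∀ x ∈ Icc (S.a t) (S.b t), |S.ρx t x| ≤ N ∧ |S.vx t x| ≤ N

def TmLB (S : PistonSol P μ Pe) (t : ℝ) : Prop := ∃ N, ∀ᶠ τ in 𝓝 t, TmB S N τ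

lemma tm_law (hP : ContDiffOn ℝ 2 P (Ioi 0)) (hμ : ContDiffOn ℝ 2 μ (Ioi 0)) (h : ∀ y, 0 < y → 0 < μ y) :
    TmLaw P μ (deriv P) (deriv μ) := by
  have d : ∀ f : ℝ → ℝ, ContDiffOn ℝ 2 f (Ioi 0) → (∀ y, 0 < y → HasDerivAt f (deriv f y) y) ∧
      ContinuousOn (deriv f) (Ioi 0) := fun f hf =>
    ⟨fun y hy => ((hf.differentiableOn (by norm_num)).differentiableAt (Ioi_mem_nhds hy)).hasDerivAt,
      hf.continuousOn_deriv_of_isOpen isOpen_Ioi (by norm_num)⟩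
  exact ⟨(d P hP).1, (d μ hμ).1, (d P hP).2, (d μ hμ).2, h⟩

lemma tm_M (hl : TmLaw P μ P1 μ1) : ∃ M : ℝ → ℝ, ∀ y, 0 < y → HasDerivAt M (μ y / y) y := by
  have c : ContinuousOn (fun y => μ y / y) (Ioi 0) :=
    ContinuousOn.div (fun y hy => (hl.dμ y hy).continuousAt.continuousWithinAt) continuousOn_id fun y hy => ne_of_gt hy
  refine ⟨fun x => ∫ y in (1:ℝ)..x, μ y / y, fun y hy => ?_⟩
  refine intervalIntegral.integral_hasDerivAt_right ?_ ?_ (c.continuousAt (Ioi_mem_nhds hy))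
  · refine (c.mono fun z hz => ?_).intervalIntegrable
    exact lt_of_lt_of_le (lt_min one_pos hy) hz.1
  · exact c.stronglyMeasurableAtFilter isOpen_Ioi y hy

lemma tm_ac (S : PistonSol P μ Pe) : ContinuousOn S.a (Ici 0) ∧ ContinuousOn S.b (Ici 0) :=
  ⟨fun t ht => (S.ha' t ht).continuousWithinAt, fun t ht => (S.hb' t ht).continuousWithinAt⟩

lemma tm_ad (S : PistonSol P μ Pe) {t : ℝ} (ht : 0 < t) : HasDerivAt S.a (S.a' t) t ∧ HasDerivAt S.b (S.b' t) t :=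
  ⟨(S.ha' t ht.le).hasDerivAt (Ici_mem_nhds ht), (S.hb' t ht.le).hasDerivAt (Ici_mem_nhds ht)⟩

lemma tm_rect (S : PistonSol P μ Pe) {t x y : ℝ} (ht : 0 < t) (hb : TmLB S t) (hx : S.a t < x) (hxy : x ≤ y)
    (hy : y < S.b t) : ∃ X0 Z0 Z1 X1 N e, 0 < e ∧ X0 < Z0 ∧ Z0 < x ∧ y < Z1 ∧ Z1 < X1 ∧
      TmRect P μ S.ρ S.v S.ρt S.ρx S.vt S.vx (t - e) (t + e) X0 X1 N := by
  obtain ⟨Z0, h1, h2⟩ := exists_between hx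
  obtain ⟨X0, h3, h4⟩ := exists_between h1
  obtain ⟨Z1, h5, h6⟩ := exists_between hy
  obtain ⟨X1, h7, h8⟩ := exists_between h6
  obtain ⟨N, hN⟩ := hb
  obtain ⟨ca, cb⟩ := tm_ad S ht
  have ev := ((hN.and (ca.continuousAt.eventually_lt_const h3)).and (cb.continuousAt.eventually_const_lt h8)).and (Ioi_mem_nhds ht)
  obtain ⟨e, he, H⟩ := Metric.eventually_nhds_iff.1 ev
  have H' : ∀ τ ∈ Icc (t - e / 2) (t + e / 2), ((TmB S N τ ∧ S.a τ < X0) ∧ X1 < S.b τ) ∧ 0 < τ := fun τ hτ =>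
    H (by rw [Real.dist_eq, abs_lt]; constructor <;> linarith [hτ.1, hτ.2])
  have I : ∀ τ ∈ Icc (t - e / 2) (t + e / 2), ∀ z ∈ Icc X0 X1, z ∈ Ioo (S.a τ) (S.b τ) := fun τ hτ z hz =>
    ⟨(H' τ hτ).1.1.2.trans_le hz.1, hz.2.trans_lt (H' τ hτ).1.2⟩
  have J := fun τ hτ z hz => Ioo_subset_Icc_self (I τ hτ z hz)
  have p := fun τ hτ => (H' τ hτ).2
  have D : Icc (t - e / 2) (t + e / 2) ×ˢ Icc X0 X1 ⊆ {p : ℝ × ℝ | 0 ≤ p.1 ∧ p.2 ∈ Icc (S.a p.1) (S.b p.1)} :=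
    fun q hq => ⟨(p q.1 hq.1).le, J _ hq.1 _ hq.2⟩
  refine ⟨X0, Z0, Z1, X1, N, e / 2, by linarith, h4, h2, h5, h7, ?_⟩
  exact ⟨by linarith, by linarith, fun τ a z b => S.ρ_pos _ (p τ a).le _ (J τ a z b), S.ρ_cont.mono D, S.v_cont.mono D,
    fun τ a z b => S.hρt _ (p τ a) _ (J τ a z b), fun τ a z b => S.hρx _ (p τ a).le _ (J τ a z b),
    fun τ a z b => S.hvt _ (p τ a) _ (J τ a z b), fun τ a z b => S.hvx _ (p τ a) _ (J τ a z b),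
    fun τ a => (S.ρx_cont _ (p τ a).le).mono (J τ a), fun τ a => (S.vx_cont _ (p τ a)).mono (J τ a),
    fun τ a z b => ((H' τ a).1.1.1 z (J τ a z b)).1, fun τ a z b => ((H' τ a).1.1.1 z (J τ a z b)).2,
    fun τ a z b => S.mass_eq _ (p τ a) _ (J τ a z b), fun τ a z b => S.momentum_eq _ (p τ a) _ (I τ a z b)⟩

lemma tm_G (S : PistonSol P μ Pe) (s t L : ℝ) (hs : 0 < s) (hst : s ≤ t) (lb : ∀ τ ∈ Icc s t, TmLB S τ) (X Y : ℝ → ℝ)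
    (hL : ∀ τ ∈ Icc s t, ∀ τ' ∈ Icc s t, |X τ - X τ'| ≤ L * |τ - τ'|)
    (hLY : ∀ τ ∈ Icc s t, ∀ τ' ∈ Icc s t, |Y τ - Y τ'| ≤ L * |τ - τ'|) (hL0 : 0 ≤ L)
    (hX : ∀ τ ∈ Icc s t, S.a τ < X τ ∧ X τ ≤ Y τ ∧ Y τ < S.b τ) (Φ k : ℝ → ℝ)
    (H : ∀ T0 T1 X0 X1 N Z0 Z1 s1 t1, TmRect P μ S.ρ S.v S.ρt S.ρx S.vt S.vx T0 T1 X0 X1 N → X0 < Z0 → Z1 < X1 → Z0 ≤ Z1 →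
      T0 < s1 → s1 ≤ t1 → t1 < T1 → Icc s1 t1 ⊆ Icc s t → (∀ τ ∈ Icc s1 t1, X τ ∈ Ioo Z0 Z1) → (∀ τ ∈ Icc s1 t1, Y τ ∈ Ioo Z0 Z1) →
      IntervalIntegrable k volume s1 t1 ∧ Φ t1 - Φ s1 = ∫ τ in s1..t1, k τ) :
    IntervalIntegrable k volume s t ∧ Φ t - Φ s = ∫ τ in s..t, k τ := by
  refine tm_glue Φ k s t hst fun x hx => ?_
  obtain ⟨h1, h2, h3⟩ := hX x hx
  obtain ⟨X0, Z0, Z1, X1, N, e, he, a1, a2, a3, a4, R⟩ := tm_rect S (hs.trans_le hx.1) (lb x hx) h1 h2 h3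
  have c : ∀ X : ℝ → ℝ, (∀ τ ∈ Icc s t, ∀ τ' ∈ Icc s t, |X τ - X τ'| ≤ L * |τ - τ'|) → ContinuousWithinAt X (Icc s t) x := by
    intro X hL
    have : LipschitzOnWith ⟨L, hL0⟩ X (Icc s t) := LipschitzOnWith.of_dist_le_mul fun y hy z hz => by
      rw [Real.dist_eq, Real.dist_eq]; exact hL y hy z hz
    exact this.continuousOn x hx
  have ev := ((((c X hL).eventually (Ioo_mem_nhds a2 (h2.trans_lt a3))).and
    ((c Y hLY).eventually (Ioo_mem_nhds (a2.trans_le h2) a3)))).and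
    (mem_nhdsWithin_of_mem_nhds (Ioo_mem_nhds (show x - e < x by linarith) (show x < x + e by linarith)))
  obtain ⟨ε, hε, B⟩ := Metric.mem_nhdsWithin_iff.1 ev
  have K : ∀ s1 t1, s1 ∈ Icc s t → t1 ∈ Icc s t → s1 ≤ t1 → |s1 - x| < ε → |t1 - x| < ε →
      IntervalIntegrable k volume s1 t1 ∧ Φ t1 - Φ s1 = ∫ τ in s1..t1, k τ := by
    intro s1 t1 i1 i2 i3 i4 i5
    have sub : Icc s1 t1 ⊆ Icc s t := Icc_subset_Icc i1.1 i2.2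
    have B' : ∀ τ ∈ Icc s1 t1, τ ∈ _ := fun τ hτ => B ⟨by
      rw [Metric.mem_ball, Real.dist_eq, abs_lt]
      rw [abs_lt] at i4 i5
      constructor <;> linarith [hτ.1, hτ.2], sub hτ⟩
    exact H _ _ _ _ _ Z0 Z1 s1 t1 R a1 a4 (by linarith) (B' s1 ⟨le_rfl, i3⟩).2.1 i3 (B' t1 ⟨i3, le_rfl⟩).2.2 sub
      (fun τ hτ => (B' τ hτ).1.1) (fun τ hτ => (B' τ hτ).1.2)
  filter_upwards [Metric.mem_nhdsWithin_iff.2 ⟨ε, hε, Subset.rfl⟩] with y hy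
  have hyx : |y - x| < ε := by have := hy.1; rwa [Metric.mem_ball, Real.dist_eq] at this
  rcases le_total x y with h | h
  · exact K x y hx hy.2 h (by simpa using hε) hyx
  · obtain ⟨q1, q2⟩ := K y x hy.2 hx h hyx (by simpa using hε)
    refine ⟨q1.symm, ?_⟩
    rw [intervalIntegral.integral_symm, ← q2]; ring

lemma tm_BD (hl : TmLaw P μ P1 μ1) (M : ℝ → ℝ) (hM : ∀ y, 0 < y → HasDerivAt M (μ y / y) y) (S : PistonSol P μ Pe)
    (s t L : ℝ) (hs : 0 < s) (hst : s ≤ t) (lb : ∀ τ ∈ Icc s t, TmLB S τ) (X Y : ℝ → ℝ)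
    (hL : ∀ τ ∈ Icc s t, ∀ τ' ∈ Icc s t, |X τ - X τ'| ≤ L * |τ - τ'|)
    (hLY : ∀ τ ∈ Icc s t, ∀ τ' ∈ Icc s t, |Y τ - Y τ'| ≤ L * |τ - τ'|) (hL0 : 0 ≤ L)
    (hX : ∀ τ ∈ Icc s t, S.a τ < X τ ∧ X τ ≤ Y τ ∧ Y τ < S.b τ)
    (dX : ∀ τ ∈ Ioo s t, HasDerivAt X (S.v τ (X τ)) τ) (dY : ∀ τ ∈ Ioo s t, HasDerivAt Y (S.v τ (Y τ)) τ) :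
    (∫ y in (X t)..(Y t), S.ρ t y) = (∫ y in (X s)..(Y s), S.ρ s y) ∧
    ((∫ y in (X t)..(Y t), S.ρ t y * S.v t y) + M (S.ρ t (Y t)) - M (S.ρ t (X t))) -
    ((∫ y in (X s)..(Y s), S.ρ s y * S.v s y) + M (S.ρ s (Y s)) - M (S.ρ s (X s))) =
      ∫ τ in s..t, (P (S.ρ τ (X τ)) - P (S.ρ τ (Y τ))) := by
  constructor
  · have := (tm_G S s t L hs hst lb X Y hL hLY hL0 hX (fun τ => ∫ y in (X τ)..(Y τ), S.ρ τ y) (fun _ => 0) ?_).2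
    · simp only [intervalIntegral.integral_zero] at this; linarith
    · intro T0 T1 X0 X1 N Z0 Z1 s1 t1 R a1 a2 a3 a4 a5 a6 sub bX bY
      have sb : Ioo s1 t1 ⊆ Ioo s t := Ioo_subset_Ioo (sub ⟨le_rfl, a5⟩).1 (sub ⟨a5, le_rfl⟩).2
      have := tm_R0 R a1 a2 a3 s1 t1 L a4 a5 a6 hL0 X (fun τ => S.v τ (X τ)) Y (fun τ => S.v τ (Y τ))
        (fun τ h τ' h' => hL τ (sub h) τ' (sub h')) bX (fun τ h => dX τ (sb h))
        (fun τ h τ' h' => hLY τ (sub h) τ' (sub h')) bY (fun τ h => dY τ (sb h))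
      simpa using this
  · refine (tm_G S s t L hs hst lb X Y hL hLY hL0 hX
      (fun τ => (∫ y in (X τ)..(Y τ), S.ρ τ y * S.v τ y) + M (S.ρ τ (Y τ)) - M (S.ρ τ (X τ))) _ ?_).2
    intro T0 T1 X0 X1 N Z0 Z1 s1 t1 R a1 a2 a3 a4 a5 a6 sub bX bY
    have sb : Ioo s1 t1 ⊆ Ioo s t := Ioo_subset_Ioo (sub ⟨le_rfl, a5⟩).1 (sub ⟨a5, le_rfl⟩).2
    have r1 := tm_R1 hl R a1 a2 a3 s1 t1 L a4 a5 a6 hL0 X (fun τ => S.v τ (X τ)) Y (fun τ => S.v τ (Y τ))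
        (fun τ h τ' h' => hL τ (sub h) τ' (sub h')) bX (fun τ h => dX τ (sb h))
        (fun τ h τ' h' => hLY τ (sub h) τ' (sub h')) bY (fun τ h => dY τ (sb h)) _ rfl
    have r2 := tm_R2 hl R a1 a2 a3 M hM s1 t1 L a4 a5 a6 hL0 X (fun τ => S.v τ (X τ))
        (fun τ h τ' h' => hL τ (sub h) τ' (sub h')) bX (fun τ h => dX τ (sb h)) (fun _ _ => rfl)
    have r3 := tm_R2 hl R a1 a2 a3 M hM s1 t1 L a4 a5 a6 hL0 Y (fun τ => S.v τ (Y τ))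
        (fun τ h τ' h' => hLY τ (sub h) τ' (sub h')) bY (fun τ h => dY τ (sb h)) (fun _ _ => rfl)
    have e : (fun τ => P (S.ρ τ (X τ)) - P (S.ρ τ (Y τ))) = fun τ =>
      (((μ (S.ρ τ (Y τ)) * S.vx τ (Y τ) - P (S.ρ τ (Y τ)) - S.ρ τ (Y τ) * S.v τ (Y τ) ^ 2 + S.ρ τ (Y τ) * S.v τ (Y τ) * S.v τ (Y τ)) -
      (μ (S.ρ τ (X τ)) * S.vx τ (X τ) - P (S.ρ τ (X τ)) - S.ρ τ (X τ) * S.v τ (X τ) ^ 2 + S.ρ τ (X τ) * S.v τ (X τ) * S.v τ (X τ))) +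
      -(μ (S.ρ τ (Y τ)) * S.vx τ (Y τ))) - -(μ (S.ρ τ (X τ)) * S.vx τ (X τ)) := by funext τ; ring
    rw [e]
    refine ⟨(r1.1.add r3.1).sub r2.1, ?_⟩
    rw [intervalIntegral.integral_sub (r1.1.add r3.1) r2.1, intervalIntegral.integral_add r1.1 r3.1, ← r2.2, ← r3.2, ← r1.2]
    ring
end

section
variable {P μ P1 μ1 : ℝ → ℝ} {Pe : ℝ}

lemma tm_ext (S : PistonSol P μ Pe) {T0 T1 : ℝ} (h0 : 0 ≤ T0) (h1 : T0 ≤ T1) (q : ℝ → ℝ → ℝ)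
    (hq : ContinuousOn (fun p : ℝ × ℝ => q p.1 p.2) {p : ℝ × ℝ | 0 ≤ p.1 ∧ p.2 ∈ Icc (S.a p.1) (S.b p.1)}) :
    Continuous (fun p : ℝ × ℝ => q (tm_cl T0 T1 p.1) (tm_cl (S.a (tm_cl T0 T1 p.1)) (S.b (tm_cl T0 T1 p.1)) p.2)) := by
  have m : ∀ t, 0 ≤ tm_cl T0 T1 t := fun t => h0.trans (tm_cl_mem _ _ _ h1).1
  have ca := (tm_ac S).1.comp_continuous (tm_cl_cont T0 T1) m
  have cb := (tm_ac S).2.comp_continuous (tm_cl_cont T0 T1) m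
  refine hq.comp_continuous (f := fun p : ℝ × ℝ => (tm_cl T0 T1 p.1, (tm_cl (S.a (tm_cl T0 T1 p.1)) (S.b (tm_cl T0 T1 p.1)) p.2))) ?_
    fun p => ⟨m _, tm_cl_mem _ _ _ (S.hab _ (m _)).le⟩
  refine ((tm_cl_cont T0 T1).comp continuous_fst).prodMk ?_
  exact (ca.comp continuous_fst).max ((cb.comp continuous_fst).min continuous_snd)

lemma tm_bds (S : PistonSol P μ Pe) {T0 T1 : ℝ} (h0 : 0 ≤ T0) (h1 : T0 ≤ T1) :
    ∃ V r0 r1 l, 0 < V ∧ 0 < r0 ∧ 0 < l ∧ ∀ t ∈ Icc T0 T1, l ≤ S.b t - S.a t ∧ ∀ x ∈ Icc (S.a t) (S.b t),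
      |S.v t x| ≤ V ∧ S.ρ t x ∈ Icc r0 r1 := by
  have ca := (tm_ac S).1.mono (fun t (ht : t ∈ Icc T0 T1) => h0.trans ht.1)
  have cb := (tm_ac S).2.mono (fun t (ht : t ∈ Icc T0 T1) => h0.trans ht.1)
  obtain ⟨t1, i1, m1⟩ := isCompact_Icc.exists_isMinOn (nonempty_Icc.2 h1) (cb.sub ca)
  have K : IsCompact (Icc T0 T1 ×ˢ Icc (0:ℝ) 1) := isCompact_Icc.prod isCompact_Icc
  have ne : (Icc T0 T1 ×ˢ Icc (0:ℝ) 1).Nonempty := ⟨(T0, 0), ⟨le_rfl, h1⟩, by simp⟩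
  have cc : ContinuousOn (fun p : ℝ × ℝ => (p.1, S.a p.1 + p.2 * (S.b p.1 - S.a p.1))) (Icc T0 T1 ×ˢ Icc (0:ℝ) 1) := by
    have ca' : ContinuousOn (fun p : ℝ × ℝ => S.a p.1) (Icc T0 T1 ×ˢ Icc (0:ℝ) 1) := ca.comp continuousOn_fst fun p hp => hp.1
    have cb' : ContinuousOn (fun p : ℝ × ℝ => S.b p.1) (Icc T0 T1 ×ˢ Icc (0:ℝ) 1) := cb.comp continuousOn_fst fun p hp => hp.1
    exact continuousOn_fst.prodMk (ca'.add (continuousOn_snd.mul (cb'.sub ca')))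
  have mp : MapsTo (fun p : ℝ × ℝ => (p.1, S.a p.1 + p.2 * (S.b p.1 - S.a p.1))) (Icc T0 T1 ×ˢ Icc (0:ℝ) 1)
      {p : ℝ × ℝ | 0 ≤ p.1 ∧ p.2 ∈ Icc (S.a p.1) (S.b p.1)} := fun p hp => by
    have h := S.hab p.1 (h0.trans hp.1.1)
    have h2 := hp.2.1
    have h3 := hp.2.2
    refine ⟨h0.trans hp.1.1, ?_, ?_⟩ <;> simp only <;> nlinarith
  obtain ⟨V, hV⟩ := K.exists_bound_of_continuousOn (S.v_cont.comp cc mp)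
  obtain ⟨r1, hr1⟩ := K.exists_bound_of_continuousOn (S.ρ_cont.comp cc mp)
  obtain ⟨p0, i0, m0⟩ := K.exists_isMinOn ne (S.ρ_cont.comp cc mp)
  refine ⟨max V 1, _, r1, _, by positivity, S.ρ_pos _ (mp i0).1 _ (mp i0).2, sub_pos.2 (S.hab t1 (h0.trans i1.1)),
    fun t ht => ⟨m1 ht, fun x hx => ?_⟩⟩
  have hh := sub_pos.2 (S.hab t (h0.trans ht.1))
  have e : S.a t + (x - S.a t) / (S.b t - S.a t) * (S.b t - S.a t) = x := by field_simp; ring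
  have i : (t, (x - S.a t) / (S.b t - S.a t)) ∈ Icc T0 T1 ×ˢ Icc (0:ℝ) 1 :=
    ⟨ht, div_nonneg (by linarith [hx.1]) hh.le, (div_le_one hh).2 (by linarith [hx.2])⟩
  have q1 := hV _ i
  have q2 := hr1 _ i
  have q3 := m0 i
  simp only [Function.comp, e, mem_setOf_eq] at q1 q2 q3
  exact ⟨q1.trans (le_max_left _ _), q3, (le_abs_self _).trans q2⟩

lemma tm_ord (w : ℝ → ℝ → ℝ) (N : ℝ) (hN : 0 ≤ N) (s t : ℝ) (hst : s ≤ t) (hw : ∀ τ ∈ Icc s t, ∀ x y, |w τ x - w τ y| ≤ N * |x - y|)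
    (X Y : ℝ → ℝ) (hX : ∀ τ ∈ Icc s t, HasDerivWithinAt X (w τ (X τ)) (Icc s t) τ)
    (hY : ∀ τ ∈ Icc s t, HasDerivWithinAt Y (w τ (Y τ)) (Icc s t) τ) (h : X t < Y t) : ∀ τ ∈ Icc s t, X τ < Y τ := by
  intro τ hτ
  by_contra hc
  have cX : ContinuousOn X (Icc s t) := fun z hz => (hX z hz).continuousWithinAt
  have cY : ContinuousOn Y (Icc s t) := fun z hz => (hY z hz).continuousWithinAt
  have sub : Icc τ t ⊆ Icc s t := Icc_subset_Icc hτ.1 le_rfl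
  obtain ⟨z, hz, hz0⟩ := intermediate_value_Icc hτ.2 ((cY.sub cX).mono sub)
    (show (0:ℝ) ∈ Icc _ _ from ⟨by simp only [Pi.sub_apply]; linarith [not_lt.1 hc], by simp only [Pi.sub_apply]; linarith⟩)
  have sz : Icc z t ⊆ Icc s t := Icc_subset_Icc (sub hz).1 le_rfl
  have d : ∀ X : ℝ → ℝ, (∀ τ ∈ Icc s t, HasDerivWithinAt X (w τ (X τ)) (Icc s t) τ) → ∀ σ ∈ Ico z t,
      HasDerivWithinAt X (w σ (X σ)) (Ici σ) σ := fun X hX σ hσ =>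
    (hX σ (sz ⟨hσ.1, hσ.2.le⟩)).mono_of_mem_nhdsWithin
      (mem_of_superset (Icc_mem_nhdsGE hσ.2) (Icc_subset_Icc ((sub hz).1.trans hσ.1) le_rfl))
  have := ODE_solution_unique_of_mem_Icc_right (v := w) (s := fun _ => univ) (K := ⟨N, hN⟩) (a := z) (b := t) (f := X) (g := Y)
    (fun σ hσ => (LipschitzWith.of_dist_le_mul fun x y => by
      rw [Real.dist_eq, Real.dist_eq]; exact hw σ (sz ⟨hσ.1, hσ.2.le⟩) x y).lipschitzOnWith)
    (cX.mono sz) (d X hX) (fun _ _ => mem_univ _) (cY.mono sz) (d Y hY) (fun _ _ => mem_univ _)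
    (by simp only [Pi.sub_apply] at hz0; linarith)
  have := this ⟨hz.2, le_rfl⟩
  linarith

lemma tm_flow (S : PistonSol P μ Pe) (s t N V : ℝ) (hs : 0 < s) (hst : s ≤ t) (hN : ∀ τ ∈ Icc s t, TmB S N τ) (hV0 : 0 < V)
    (hV : ∀ τ ∈ Icc s t, ∀ x ∈ Icc (S.a τ) (S.b τ), |S.v τ x| ≤ V) (p q : ℝ) (hp : S.a t < p) (hpq : p < q) (hq : q < S.b t) :
    ∃ X Y : ℝ → ℝ, X t = p ∧ Y t = q ∧ (∀ τ ∈ Icc s t, S.a τ < X τ ∧ X τ < Y τ ∧ Y τ < S.b τ) ∧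
      (∀ τ ∈ Icc s t, ∀ τ' ∈ Icc s t, |X τ - X τ'| ≤ V * |τ - τ'|) ∧
      (∀ τ ∈ Icc s t, ∀ τ' ∈ Icc s t, |Y τ - Y τ'| ≤ V * |τ - τ'|) ∧
      (∀ τ ∈ Ioo s t, HasDerivAt X (S.v τ (X τ)) τ) ∧ (∀ τ ∈ Ioo s t, HasDerivAt Y (S.v τ (Y τ)) τ) := by
  have hN0 : 0 ≤ N := (abs_nonneg _).trans (hN s ⟨le_rfl, hst⟩ _ ⟨le_rfl, (S.hab s hs.le).le⟩).1
  set w : ℝ → ℝ → ℝ := fun τ x => S.v (tm_cl s t τ) (tm_cl (S.a (tm_cl s t τ)) (S.b (tm_cl s t τ)) x) with hw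
  have wc : Continuous (fun p : ℝ × ℝ => w p.1 p.2) := tm_ext S hs.le hst S.v S.v_cont
  have mI := fun τ => tm_cl_mem s t τ hst
  have mX := fun τ x => tm_cl_mem (S.a (tm_cl s t τ)) (S.b (tm_cl s t τ)) x (S.hab _ (hs.le.trans (mI τ).1)).le
  have wb : ∀ τ x, |w τ x| ≤ V := fun τ x => hV _ (mI τ) _ (mX τ x)
  have wl : ∀ τ x y, |w τ x - w τ y| ≤ N * |x - y| := fun τ x y =>
    (tm_lip (S.v (tm_cl s t τ)) (S.vx (tm_cl s t τ)) _ _ N (S.hvx _ (hs.trans_le (mI τ).1))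
      (fun x hx => (hN _ (mI τ) x hx).2) _ (mX τ x) _ (mX τ y)).trans (mul_le_mul_of_nonneg_left (tm_cl_lip _ _ _ _) hN0)
  have we : ∀ τ ∈ Icc s t, ∀ x ∈ Icc (S.a τ) (S.b τ), w τ x = S.v τ x := fun τ hτ x hx => by
    simp only [hw]; rw [tm_cl_id _ _ _ hτ, tm_cl_id _ _ _ hx]
  have ex : ∀ x0, ∃ X : ℝ → ℝ, X t = x0 ∧ ∀ τ ∈ Icc s t, HasDerivWithinAt X (w τ (X τ)) (Icc s t) τ := fun x0 => by
    have : IsPicardLindelof w (tmin := s) (tmax := t) ⟨t, hst, le_rfl⟩ x0 ⟨V * (t - s), by nlinarith⟩ 0 ⟨V, hV0.le⟩ ⟨N, hN0⟩ := by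
      refine ⟨fun τ hτ => (LipschitzWith.of_dist_le_mul fun x y => ?_).lipschitzOnWith, fun x hx => ?_, fun τ hτ x hx => wb τ x, ?_⟩
      · rw [Real.dist_eq, Real.dist_eq]; exact wl τ x y
      · exact (wc.comp (Continuous.prodMk_left x)).continuousOn
      · simp only [sub_self, NNReal.coe_zero, sub_zero]; rw [max_eq_right (by linarith)]; exact le_rfl
    exact this.exists_eq_forall_mem_Icc_hasDerivWithinAt₀
  obtain ⟨X, X1, X2⟩ := ex p
  obtain ⟨Y, Y1, Y2⟩ := ex q
  have ord := tm_ord w N hN0 s t hst (fun τ _ => wl τ)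
  have pos : ∀ τ ∈ Icc s t, 0 < τ := fun τ hτ => hs.trans_le hτ.1
  have oa := ord S.a X (fun τ hτ => by
    have := S.hab τ (pos τ hτ).le
    rw [we τ hτ _ ⟨le_rfl, this.le⟩, S.bc_a τ (pos τ hτ).le]; exact (tm_ad S (pos τ hτ)).1.hasDerivWithinAt) X2 (X1 ▸ hp)
  have ob := ord Y S.b Y2 (fun τ hτ => by
    have := S.hab τ (pos τ hτ).le
    rw [we τ hτ _ ⟨this.le, le_rfl⟩, S.bc_b τ (pos τ hτ).le]; exact (tm_ad S (pos τ hτ)).2.hasDerivWithinAt) (Y1 ▸ hq)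
  have oc := ord X Y X2 Y2 (by rw [X1, Y1]; exact hpq)
  have lip : ∀ X : ℝ → ℝ, (∀ τ ∈ Icc s t, HasDerivWithinAt X (w τ (X τ)) (Icc s t) τ) →
      ∀ τ ∈ Icc s t, ∀ τ' ∈ Icc s t, |X τ - X τ'| ≤ V * |τ - τ'| := fun X hX τ h τ' h' =>
    (convex_Icc s t).norm_image_sub_le_of_norm_hasDerivWithin_le hX (fun z _ => wb z _) h' h
  have dd : ∀ X : ℝ → ℝ, (∀ τ ∈ Icc s t, HasDerivWithinAt X (w τ (X τ)) (Icc s t) τ) →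
      (∀ τ ∈ Icc s t, X τ ∈ Icc (S.a τ) (S.b τ)) → ∀ τ ∈ Ioo s t, HasDerivAt X (S.v τ (X τ)) τ := fun X hX hI τ h => by
    have h' := Ioo_subset_Icc_self h
    rw [← we τ h' _ (hI τ h')]; exact (hX τ h').hasDerivAt (Icc_mem_nhds h.1 h.2)
  exact ⟨X, Y, X1, Y1, fun τ h => ⟨oa τ h, oc τ h, ob τ h⟩, lip X X2, lip Y Y2,
    dd X X2 fun τ h => ⟨(oa τ h).le, ((oc τ h).trans (ob τ h)).le⟩, dd Y Y2 fun τ h => ⟨((oa τ h).trans (oc τ h)).le, (ob τ h).le⟩⟩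
end

section
variable {P μ P1 μ1 : ℝ → ℝ} {Pe : ℝ}

lemma tm_dlip (f f' : ℝ → ℝ) (A B N : ℝ) (hAB : A < B) (hN : 0 ≤ N) (hf : ∀ x ∈ Icc A B, HasDerivAt f (f' x) x)
    (hc : ContinuousOn f' (Icc A B)) (h : ∀ x ∈ Ioo A B, ∀ y ∈ Ioo A B, x < y → |f y - f x| ≤ N * (y - x)) :
    ∀ x ∈ Icc A B, |f' x| ≤ N := by
  have L : LipschitzOnWith ⟨N, hN⟩ f (Ioo A B) := LipschitzOnWith.of_dist_le_mul fun x hx y hy => by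
    rw [Real.dist_eq, Real.dist_eq]
    change _ ≤ N * _
    rcases lt_trichotomy x y with k | k | k
    · rw [abs_sub_comm, abs_sub_comm x, abs_of_pos (sub_pos.2 k)]; exact h x hx y hy k
    · simp [k]
    · rw [abs_of_pos (sub_pos.2 k)]; exact h y hy x hx k
  have I : ∀ x ∈ Ioo A B, |f' x| ≤ N := fun x hx =>
    (hf x (Ioo_subset_Icc_self hx)).le_of_lipschitzOn (Ioo_mem_nhds hx.1 hx.2) L
  intro x hx
  have ne : (𝓝[Ioo A B] x).NeBot := mem_closure_iff_nhdsWithin_neBot.1 (by rw [closure_Ioo hAB.ne]; exact hx)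
  exact le_of_tendsto ((hc x hx).mono Ioo_subset_Icc_self).abs (eventually_mem_nhdsWithin.mono I)

lemma tm_cpt (S : PistonSol P μ Pe) (s t : ℝ) (lb : ∀ τ ∈ Icc s t, TmLB S τ) : ∃ N, ∀ τ ∈ Icc s t, TmB S N τ := by
  refine isCompact_Icc.induction_on (p := fun U => ∃ N, ∀ τ ∈ U, TmB S N τ) ⟨0, by simp⟩
    (fun U W h ⟨N, hN⟩ => ⟨N, fun τ hτ => hN τ (h hτ)⟩)
    (fun U W ⟨N, hN⟩ ⟨K, hK⟩ => ⟨max N K, fun τ hτ x hx => ?_⟩) (fun τ hτ => ?_)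
  · rcases hτ with h | h
    · exact ⟨(hN τ h x hx).1.trans (le_max_left _ _), (hN τ h x hx).2.trans (le_max_left _ _)⟩
    · exact ⟨(hK τ h x hx).1.trans (le_max_right _ _), (hK τ h x hx).2.trans (le_max_right _ _)⟩
  · obtain ⟨N, hN⟩ := lb τ hτ
    exact ⟨_, mem_nhdsWithin_of_mem_nhds hN, N, fun _ h => h⟩

lemma tm_MK (hl : TmLaw P μ P1 μ1) (M : ℝ → ℝ) (hM : ∀ y, 0 < y → HasDerivAt M (μ y / y) y) (r0 r1 : ℝ) (h0 : 0 < r0) (h1 : r0 ≤ r1) :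
    ∃ K, 0 < K ∧ ∀ x ∈ Icc r0 r1, ∀ y ∈ Icc r0 r1, |x - y| ≤ K * |M x - M y| ∧ |M x - M y| ≤ K * |x - y| ∧
      |P x - P y| ≤ K * |M x - M y| := by
  have p : ∀ x ∈ Icc r0 r1, 0 < x := fun x hx => h0.trans_le hx.1
  have c : ContinuousOn (fun y => μ y / y) (Icc r0 r1) :=
    ContinuousOn.div (fun y hy => (hl.dμ y (p y hy)).continuousAt.continuousWithinAt) continuousOn_id fun y hy => (p y hy).ne'
  obtain ⟨z, hz, mz⟩ := isCompact_Icc.exists_isMinOn (nonempty_Icc.2 h1) c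
  obtain ⟨c1, hc1⟩ := isCompact_Icc.exists_bound_of_continuousOn c
  obtain ⟨c2, hc2⟩ := isCompact_Icc.exists_bound_of_continuousOn (hl.cP1.mono (show Icc r0 r1 ⊆ Ioi 0 from p))
  have z0 : 0 < μ z / z := div_pos (hl.μpos z (p z hz)) (p z hz)
  set c0 := μ z / z
  have lo' : ∀ x ∈ Icc r0 r1, ∀ y ∈ Icc r0 r1, x ≤ y → c0 * (y - x) ≤ M y - M x :=
    Convex.mul_sub_le_image_sub_of_le_deriv (convex_Icc r0 r1) (fun y hy => (hM y (p y hy)).continuousAt.continuousWithinAt)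
      (fun y hy => (hM y (p y (interior_subset hy))).differentiableAt.differentiableWithinAt)
      (fun y hy => by rw [(hM y (p y (interior_subset hy))).deriv]; exact mz (interior_subset hy))
  have lo : ∀ x ∈ Icc r0 r1, ∀ y ∈ Icc r0 r1, |x - y| ≤ c0⁻¹ * |M x - M y| := fun x hx y hy => by
    rw [← div_eq_inv_mul, le_div_iff₀ z0]
    rcases le_total x y with k | k
    · rw [abs_sub_comm, abs_of_nonneg (sub_nonneg.2 k), abs_sub_comm]; linarith [lo' x hx y hy k, le_abs_self (M y - M x)]
    · rw [abs_of_nonneg (sub_nonneg.2 k)]; linarith [lo' y hy x hx k, le_abs_self (M x - M y)]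
  have z1 := inv_pos.2 z0
  refine ⟨c0⁻¹ + |c1| + |c2| * c0⁻¹, by positivity, fun x hx y hy => ⟨(lo x hx y hy).trans ?_,
    (tm_lip M _ r0 r1 c1 (fun y hy => hM y (p y hy)) hc1 x hx y hy).trans ?_,
    (tm_lip P _ r0 r1 c2 (fun y hy => hl.dP y (p y hy)) hc2 x hx y hy).trans ?_⟩⟩
  · exact mul_le_mul_of_nonneg_right (by have : 0 ≤ |c2| * c0⁻¹ := by positivity
                                         linarith [abs_nonneg c1]) (abs_nonneg _)
  · exact mul_le_mul_of_nonneg_right (by have : 0 ≤ |c2| * c0⁻¹ := by positivity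
                                         linarith [le_abs_self c1]) (abs_nonneg _)
  · calc c2 * |x - y| ≤ |c2| * (c0⁻¹ * |M x - M y|) := mul_le_mul (le_abs_self _) (lo x hx y hy) (abs_nonneg _) (abs_nonneg _)
      _ = (|c2| * c0⁻¹) * |M x - M y| := by ring
      _ ≤ _ := mul_le_mul_of_nonneg_right (by linarith [abs_nonneg c1]) (abs_nonneg _)

lemma tm_uc (S : PistonSol P μ Pe) (s T1 N : ℝ) (hs : 0 < s) (h1 : s < T1) (hN : ∀ x ∈ Icc (S.a s) (S.b s), |S.ρx s x| ≤ N) (ε : ℝ) (hε : 0 < ε) :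
    ∃ s' ∈ Ioo s T1, ∀ x ∈ Icc (S.a s') (S.b s'), ∀ y ∈ Icc (S.a s') (S.b s'), |S.ρ s' x - S.ρ s' y| ≤ N * |x - y| + ε := by
  have hc := tm_ext S hs.le h1.le S.ρ S.ρ_cont
  set r : ℝ × ℝ → ℝ := fun p => S.ρ (tm_cl s T1 p.1) (tm_cl (S.a (tm_cl s T1 p.1)) (S.b (tm_cl s T1 p.1)) p.2) with hr
  have sI : s ∈ Icc s T1 := ⟨le_rfl, h1.le⟩
  have hN0 : 0 ≤ N := (abs_nonneg _).trans (hN _ ⟨le_rfl, (S.hab s hs.le).le⟩)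
  obtain ⟨ca, cb⟩ := tm_ac S
  obtain ⟨A, hA⟩ := isCompact_Icc.exists_bound_of_continuousOn (ca.mono fun t (ht : t ∈ Icc s T1) => hs.le.trans ht.1)
  obtain ⟨B, hB⟩ := isCompact_Icc.exists_bound_of_continuousOn (cb.mono fun t (ht : t ∈ Icc s T1) => hs.le.trans ht.1)
  have K : IsCompact (Icc s T1 ×ˢ Icc (-A) B) := isCompact_Icc.prod isCompact_Icc
  obtain ⟨δ, hδ, H⟩ := Metric.uniformContinuousOn_iff.1 (K.uniformContinuousOn_of_continuous hc.continuousOn) (ε / 2) (by linarith)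
  obtain ⟨s', h2, h3⟩ := exists_between (show s < min T1 (s + δ) from lt_min h1 (by linarith))
  have h4 : s' ∈ Icc s T1 := ⟨h2.le, (h3.trans_le (min_le_left _ _)).le⟩
  refine ⟨s', ⟨h2, h3.trans_le (min_le_left _ _)⟩, fun x hx y hy => ?_⟩
  have J : ∀ x ∈ Icc (S.a s') (S.b s'), |S.ρ s' x - r (s, x)| < ε / 2 := fun x hx => by
    have xm : x ∈ Icc (-A) B := ⟨(neg_le_of_abs_le (hA s' h4)).trans hx.1, hx.2.trans (le_of_abs_le (hB s' h4))⟩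
    have := H (s', x) ⟨h4, xm⟩ (s, x) ⟨sI, xm⟩ (by
      rw [Prod.dist_eq, dist_self, max_eq_left dist_nonneg, Real.dist_eq, abs_of_pos (sub_pos.2 h2)]
      linarith [min_le_right T1 (s + δ)])
    rw [Real.dist_eq, show r (s', x) = S.ρ s' x by simp only [hr, tm_cl_id _ _ _ h4, tm_cl_id _ _ _ hx]] at this
    exact this
  have l : |r (s, x) - r (s, y)| ≤ N * |x - y| := by
    simp only [hr, tm_cl_id _ _ _ sI]
    have m := fun x => tm_cl_mem (S.a s) (S.b s) x (S.hab s hs.le).le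
    exact (tm_lip (S.ρ s) (S.ρx s) _ _ N (S.hρx s hs.le) hN _ (m x) _ (m y)).trans (mul_le_mul_of_nonneg_left (tm_cl_lip _ _ _ _) hN0)
  have e1 := abs_lt.1 (J x hx)
  have e2 := abs_lt.1 (J y hy)
  have e3 := abs_le.1 l
  rw [abs_le]
  constructor <;> linarith [e1.1, e1.2, e2.1, e2.2, e3.1, e3.2]
end

section
variable {P μ P1 μ1 : ℝ → ℝ} {Pe : ℝ}

lemma tm_gron (d k : ℝ → ℝ) (s t K c : ℝ) (hst : s ≤ t) (hK : 0 < K) (hk : ContinuousOn k (Icc s t))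
    (hd : ∀ τ ∈ Icc s t, d τ - d s = ∫ z in s..τ, k z) (hb : ∀ τ ∈ Icc s t, |k τ| ≤ K * (|d τ| + c)) :
    |d t| ≤ (|d s| + c) * Real.exp (K * (t - s)) - c := by
  set k' : ℝ → ℝ := fun z => k (tm_cl s t z)
  have ck : Continuous k' := hk.comp_continuous (tm_cl_cont s t) fun z => tm_cl_mem _ _ _ hst
  set D : ℝ → ℝ := fun τ => d s + ∫ z in s..τ, k' z with hD
  have dD : ∀ τ, HasDerivAt D (k' τ) τ := fun τ => (intervalIntegral.integral_hasDerivAt_right (ck.intervalIntegrable _ _)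
    (ck.stronglyMeasurableAtFilter _ _) ck.continuousAt).const_add _
  have e : ∀ τ ∈ Icc s t, D τ = d τ := fun τ hτ => by
    have : (∫ z in s..τ, k' z) = ∫ z in s..τ, k z := intervalIntegral.integral_congr fun z hz => by
      rw [uIcc_of_le hτ.1] at hz
      exact congrArg k (tm_cl_id _ _ _ ⟨hz.1, hz.2.trans hτ.2⟩)
    simp only [hD]; rw [this, ← hd τ hτ]; ring
  have := norm_le_gronwallBound_of_norm_deriv_right_le (f := D) (f' := k') (δ := |d s|) (K := K) (ε := K * c) (a := s) (b := t)
    (fun τ _ => (dD τ).continuousAt.continuousWithinAt) (fun τ _ => (dD τ).hasDerivWithinAt)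
    (by rw [e s ⟨le_rfl, hst⟩]; exact le_rfl) (fun τ hτ => by
      have hτ' := Ico_subset_Icc_self hτ
      rw [e τ hτ', show k' τ = k τ from congrArg k (tm_cl_id _ _ _ hτ')]
      exact (hb τ hτ').trans (le_of_eq (by rw [Real.norm_eq_abs]; ring))) t ⟨hst, le_rfl⟩
  rw [e t ⟨hst, le_rfl⟩, gronwallBound_of_K_ne_0 hK.ne', mul_div_cancel_left₀ _ hK.ne', Real.norm_eq_abs] at this
  linarith

lemma tm_B1 (hl : TmLaw P μ P1 μ1) (S : PistonSol P μ Pe) (T0 T1 N : ℝ) (h0 : 0 < T0) (h1 : T0 ≤ T1) (hN : 0 ≤ N) :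
    ∃ N1, 0 ≤ N1 ∧ ∀ s t, T0 ≤ s → s < t → t ≤ T1 → (∀ τ ∈ Ioc s t, TmLB S τ) → (∀ x ∈ Icc (S.a s) (S.b s), |S.ρx s x| ≤ N) →
      ∀ x ∈ Icc (S.a t) (S.b t), |S.ρx t x| ≤ N1 := by
  obtain ⟨M, hM⟩ := tm_M hl
  obtain ⟨V, r0, r1, l, hV, hr0, -, hb⟩ := tm_bds S h0.le h1
  have hr1 : r0 ≤ r1 := by
    obtain ⟨-, h⟩ := hb T0 ⟨le_rfl, h1⟩
    have := (h _ ⟨le_rfl, (S.hab T0 h0.le).le⟩).2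
    exact this.1.trans this.2
  have hr1' := hr0.trans_le hr1
  obtain ⟨K, hK, hMK⟩ := tm_MK hl M hM r0 r1 hr0 hr1
  set E := Real.exp (K * (T1 - T0)) with hE
  have hE0 : 0 < E := Real.exp_pos _
  refine ⟨K * ((2 * V + K * (N / r0)) * E + V) * r1, by positivity, fun s t hs hst ht lb hN' => ?_⟩
  have sp := h0.trans_le hs
  refine tm_dlip (S.ρ t) _ _ _ _ (S.hab t (sp.trans hst).le) (by positivity) (S.hρx t (sp.trans hst).le) (S.ρx_cont t (sp.trans hst).le)
    fun p hp q hq hpq => le_of_forall_pos_le_add fun ε hε => ?_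
  obtain ⟨s', ⟨h2, h3⟩, hm⟩ := tm_uc S s t N sp hst hN' (ε / (K * K * E)) (by positivity)
  have sp' := sp.trans h2
  have lb' : ∀ τ ∈ Icc s' t, TmLB S τ := fun τ hτ => lb τ ⟨h2.trans_le hτ.1, hτ.2⟩
  have hb' : ∀ τ ∈ Icc s' t, _ := fun τ hτ => (hb τ ⟨hs.trans (h2.le.trans hτ.1), hτ.2.trans ht⟩).2
  obtain ⟨Nc, hNc⟩ := tm_cpt S s' t lb'
  obtain ⟨X, Y, X1, Y1, o, LX, LY, dX, dY⟩ := tm_flow S s' t Nc V sp' h3.le hNc hV (fun τ hτ x hx => (hb' τ hτ x hx).1) p q hp.1 hpq hq.2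
  set d : ℝ → ℝ := fun τ => (∫ y in (X τ)..(Y τ), S.ρ τ y * S.v τ y) + M (S.ρ τ (Y τ)) - M (S.ρ τ (X τ)) with hd
  set m := ∫ y in (X t)..(Y t), S.ρ t y with hm0
  have bd : ∀ τ ∈ Icc s' t, (m = ∫ y in (X τ)..(Y τ), S.ρ τ y) ∧ d τ - d s' = ∫ z in s'..τ, (P (S.ρ z (X z)) - P (S.ρ z (Y z))) := by
    have I : ∀ τ ∈ Icc s' t, _ := fun τ (hτ : τ ∈ Icc s' t) =>
      have sub : Icc s' τ ⊆ Icc s' t := Icc_subset_Icc le_rfl hτ.2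
      tm_BD hl M hM S s' τ V sp' hτ.1 (fun z hz => lb' z (sub hz)) X Y (fun z hz z' hz' => LX z (sub hz) z' (sub hz'))
      (fun z hz z' hz' => LY z (sub hz) z' (sub hz')) hV.le (fun z hz => ⟨(o z (sub hz)).1, (o z (sub hz)).2.1.le, (o z (sub hz)).2.2⟩)
      (fun z hz => dX z ⟨hz.1, hz.2.trans_le hτ.2⟩) (fun z hz => dY z ⟨hz.1, hz.2.trans_le hτ.2⟩)
    exact fun τ hτ => ⟨(I t ⟨h3.le, le_rfl⟩).1.trans (I τ hτ).1.symm, (I τ hτ).2⟩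
  have oX : ∀ τ ∈ Icc s' t, X τ ∈ Icc (S.a τ) (S.b τ) := fun τ hτ => ⟨(o τ hτ).1.le, ((o τ hτ).2.1.trans (o τ hτ).2.2).le⟩
  have oY : ∀ τ ∈ Icc s' t, Y τ ∈ Icc (S.a τ) (S.b τ) := fun τ hτ => ⟨((o τ hτ).1.trans (o τ hτ).2.1).le, (o τ hτ).2.2.le⟩
  have sp2 : ∀ τ ∈ Icc s' t, 0 ≤ τ := fun τ hτ => sp'.le.trans hτ.1
  have rc : ∀ X : ℝ → ℝ, (∀ τ ∈ Icc s' t, ∀ τ' ∈ Icc s' t, |X τ - X τ'| ≤ V * |τ - τ'|) → (∀ τ ∈ Icc s' t, X τ ∈ Icc (S.a τ) (S.b τ)) →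
      ContinuousOn (fun z => P (S.ρ z (X z))) (Icc s' t) := fun X LX oX => by
    have c : ContinuousOn X (Icc s' t) := (show LipschitzOnWith ⟨V, hV.le⟩ X (Icc s' t) from LipschitzOnWith.of_dist_le_mul fun y hy z hz => by
      rw [Real.dist_eq, Real.dist_eq]; exact LX y hy z hz).continuousOn
    have cr : ContinuousOn (fun z => S.ρ z (X z)) (Icc s' t) := S.ρ_cont.comp (continuousOn_id.prodMk c) fun z hz => ⟨sp2 z hz, oX z hz⟩
    intro z hz
    exact ContinuousAt.comp_continuousWithinAt (f := fun z => S.ρ z (X z)) (hl.dP _ (S.ρ_pos z (sp2 z hz) _ (oX z hz))).continuousAt (cr z hz)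
  have sl : ∀ τ ∈ Icc s' t, ∀ y ∈ uIcc (X τ) (Y τ), y ∈ Icc (S.a τ) (S.b τ) := fun τ hτ y hy => by
    rw [uIcc_of_le (o τ hτ).2.1.le] at hy
    exact ⟨(oX τ hτ).1.trans hy.1, hy.2.trans (oY τ hτ).2⟩
  have ri : ∀ τ ∈ Icc s' t, IntervalIntegrable (S.ρ τ) volume (X τ) (Y τ) := fun τ hτ => ContinuousOn.intervalIntegrable
    fun y hy => (S.hρx τ (sp2 τ hτ) y (sl τ hτ y hy)).continuousAt.continuousWithinAt
  have fV : ∀ τ ∈ Icc s' t, |∫ y in (X τ)..(Y τ), S.ρ τ y * S.v τ y| ≤ V * m := fun τ hτ => by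
    rw [(bd τ hτ).1, ← intervalIntegral.integral_const_mul]
    refine intervalIntegral.norm_integral_le_of_norm_le (f := fun y => S.ρ τ y * S.v τ y) (o τ hτ).2.1.le (Eventually.of_forall fun y hy => ?_) ((ri τ hτ).const_mul V)
    have := hb' τ hτ y (sl τ hτ y (by rw [uIcc_of_le (o τ hτ).2.1.le]; exact Ioc_subset_Icc_self hy))
    rw [Real.norm_eq_abs, abs_mul, abs_of_pos (hr0.trans_le this.2.1), mul_comm]
    exact mul_le_mul_of_nonneg_right this.1 (hr0.le.trans this.2.1)
  have mlo : r0 * (Y s' - X s') ≤ m := by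
    have i : s' ∈ Icc s' t := ⟨le_rfl, h3.le⟩
    have := intervalIntegral.integral_mono_on (o s' i).2.1.le (f := fun _ => r0) (by simp) (ri s' i)
      (fun y hy => (hb' s' i y (sl s' i y (by rw [uIcc_of_le (o s' i).2.1.le]; exact hy))).2.1)
    rw [(bd s' i).1]; simp at this; linarith
  have it : t ∈ Icc s' t := ⟨h3.le, le_rfl⟩
  have is' : s' ∈ Icc s' t := ⟨le_rfl, h3.le⟩
  have mhi : m ≤ r1 * (q - p) := by
    have := intervalIntegral.integral_mono_on (o t it).2.1.le (g := fun _ => r1) (ri t it) (by simp)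
      (fun y hy => (hb' t it y (sl t it y (by rw [uIcc_of_le (o t it).2.1.le]; exact hy))).2.2)
    simp only [intervalIntegral.integral_const, smul_eq_mul, X1, Y1] at this; rw [hm0, X1, Y1]; linarith
  have MM : ∀ τ ∈ Icc s' t, _ := fun τ hτ => hMK _ (hb' τ hτ _ (oY τ hτ)).2 _ (hb' τ hτ _ (oX τ hτ)).2
  have md : ∀ τ ∈ Icc s' t, |M (S.ρ τ (Y τ)) - M (S.ρ τ (X τ))| ≤ |d τ| + V * m := fun τ hτ => by
    have a := abs_le.1 (fV τ hτ)
    have b := abs_le.1 (le_refl |d τ|)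
    simp only [hd] at b ⊢
    rw [abs_le]; constructor <;> linarith [a.1, a.2, b.1, b.2]
  have g := tm_gron d _ s' t K (V * m) h3.le hK ((rc X LX oX).sub (rc Y LY oY)) (fun τ hτ => (bd τ hτ).2) (fun τ hτ => by
    rw [Pi.sub_apply, abs_sub_comm]
    exact ((MM τ hτ).2.2).trans (mul_le_mul_of_nonneg_left (md τ hτ) hK.le))
  have m0 : 0 ≤ m := by nlinarith [(o s' is').2.1]
  have Ed : Real.exp (K * (t - s')) ≤ E := Real.exp_le_exp.2 (mul_le_mul_of_nonneg_left (by linarith) hK.le)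
  have dsb : |d s'| ≤ V * m + K * (N * (m / r0) + ε / (K * K * E)) := by
    have a := (MM s' is').2.1
    have b := hm _ (oY s' is') _ (oX s' is')
    rw [abs_of_pos (sub_pos.2 (o s' is').2.1)] at b
    have c : Y s' - X s' ≤ m / r0 := by rw [le_div_iff₀ hr0]; linarith
    have e : |d s'| ≤ |∫ y in (X s')..(Y s'), S.ρ s' y * S.v s' y| + |M (S.ρ s' (Y s')) - M (S.ρ s' (X s'))| := by
      simp only [hd]; rw [add_sub_assoc]; exact abs_add_le _ _
    refine e.trans (add_le_add (fV s' is') (a.trans (mul_le_mul_of_nonneg_left (b.trans ?_) hK.le)))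
    linarith [mul_le_mul_of_nonneg_left c hN]
  have fin := (MM t it).1.trans (mul_le_mul_of_nonneg_left (md t it) hK.le)
  rw [X1, Y1] at fin
  have hVm : 0 ≤ V * m := by positivity
  have g2 : |d t| ≤ (V * m + K * (N * (m / r0) + ε / (K * K * E)) + V * m) * E - V * m :=
    g.trans (sub_le_sub_right (mul_le_mul (by linarith) Ed (Real.exp_pos _).le (by positivity)) _)
  calc |S.ρ t q - S.ρ t p| ≤ K * (|d t| + V * m) := fin
    _ ≤ K * ((V * m + K * (N * (m / r0) + ε / (K * K * E)) + V * m) * E) := mul_le_mul_of_nonneg_left (by linarith) hK.le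
    _ = K * ((2 * V + K * (N / r0)) * E) * m + ε := by field_simp; ring
    _ ≤ K * ((2 * V + K * (N / r0)) * E + V) * m + ε := by
      have : 0 ≤ K * V * m := by positivity
      nlinarith
    _ ≤ K * ((2 * V + K * (N / r0)) * E + V) * (r1 * (q - p)) + ε := by gcongr
    _ = _ := by ring
end

section
variable {P μ P1 μ1 : ℝ → ℝ} {Pe : ℝ}

lemma tm_right (f : ℝ → ℝ) (f' x : ℝ) (h : HasDerivAt f f' x) (hm : ∀ᶠ y in 𝓝[>] x, f y ≤ f x) : f' ≤ 0 := by
  refine le_of_tendsto ((hasDerivAt_iff_tendsto_slope.1 h).mono_left (nhdsGT_le_nhdsNE x)) ?_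
  filter_upwards [hm, self_mem_nhdsWithin] with y h1 h2
  rw [slope_def_field]
  exact div_nonpos_of_nonpos_of_nonneg (by linarith) (sub_nonneg.2 (le_of_lt h2))

lemma tm_left (f : ℝ → ℝ) (f' x : ℝ) (h : HasDerivAt f f' x) (hm : ∀ᶠ y in 𝓝[<] x, f y ≤ f x) : 0 ≤ f' := by
  refine ge_of_tendsto ((hasDerivAt_iff_tendsto_slope.1 h).mono_left (nhdsLT_le_nhdsNE x)) ?_
  filter_upwards [hm, self_mem_nhdsWithin] with y h1 h2
  rw [slope_def_field]
  exact div_nonneg_of_nonpos (by linarith) (sub_nonpos.2 (le_of_lt h2))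

lemma tm_pt (hl : TmLaw P μ P1 μ1) (S : PistonSol P μ Pe) (hu : ∀ t, 0 < t → S.u t = 0) (τ x e m k L V A C N : ℝ) (hτ : 0 < τ)
    (hx : x ∈ Icc (S.a τ) (S.b τ)) (he : |e| = 1) (hm : |m| ≤ L) (hk : k ≤ 0) (hV : ∀ x ∈ Icc (S.a τ) (S.b τ), |S.v τ x| ≤ V)
    (hA : 0 < A) (hC : 0 ≤ C) (hAC : ∀ x ∈ Icc (S.a τ) (S.b τ), A ≤ μ (S.ρ τ x) / S.ρ τ x ∧ |μ1 (S.ρ τ x) / S.ρ τ x| ≤ C ∧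
      |P1 (S.ρ τ x) / S.ρ τ x| ≤ C ∧ |P (S.ρ τ x) - Pe| ≤ C) (hN : |S.ρx τ x| ≤ N)
    (hmax : ∀ᶠ y in 𝓝 x, y ∈ Icc (S.a τ) (S.b τ) → e * S.v τ y - m * (y - x) - k / 2 * (y - x) ^ 2 ≤ e * S.v τ x)
    (ha : x = S.a τ → m ≤ 0) (hb : x = S.b τ → 0 ≤ m) :
    ∃ (c : ℝ → ℝ) (c1 D : ℝ), c τ = x ∧ (∀ᶠ z in 𝓝 τ, c z ∈ Icc (S.a z) (S.b z)) ∧ HasDerivAt c c1 τ ∧ |c1| ≤ V ∧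
      HasDerivAt (fun z => S.v z (c z)) D τ ∧ e * D ≤ (C * N + V) * L + C * N + C ∧
      (x ∈ Ioo (S.a τ) (S.b τ) → e * D ≤ A * k + ((C * N + V) * L + C * N + C)) := by
  have hab := S.hab τ hτ.le
  have hL0 := (abs_nonneg m).trans hm
  have hN0 := (abs_nonneg _).trans hN
  have hV0 := (abs_nonneg _).trans (hV x hx)
  have hG : 0 ≤ (C * N + V) * L + C * N := by positivity
  have r0 := S.ρ_pos τ hτ.le x hx
  have mp := hl.μpos _ r0
  obtain ⟨q1, q2, q3, q4⟩ := hAC x hx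
  have dv := S.hvx τ hτ x hx
  have df : HasDerivAt (fun y => e * S.v τ y - m * (y - x) - k / 2 * (y - x) ^ 2) (e * S.vx τ x - m) x := by
    have a := (hasDerivAt_id x).sub_const x
    refine (((dv.const_mul e).sub (a.const_mul m)).sub ((a.pow 2).const_mul (k / 2))).congr_deriv ?_
    simp
  have eb : ∀ z, |e * z| = |z| := fun z => by rw [abs_mul, he, one_mul]
  rcases eq_or_lt_of_le hx.1 with ea | la
  · refine ⟨S.a, S.a' τ, S.a'' τ, ea, ?_, (tm_ad S hτ).1, by rw [← S.bc_a τ hτ.le, ea]; exact hV x hx, ?_, ?_, fun h => absurd ea h.1.ne⟩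
    · filter_upwards [Ioi_mem_nhds hτ] with z hz using ⟨le_rfl, (S.hab z (le_of_lt hz)).le⟩
    · refine (S.ha'' τ hτ).congr_of_eventuallyEq ?_
      filter_upwards [Ioi_mem_nhds hτ] with z hz using S.bc_a z (le_of_lt hz)
    · have := tm_right _ _ _ df (by
        filter_upwards [mem_nhdsWithin_of_mem_nhds hmax, Ioo_mem_nhdsGT (ea ▸ hab)] with y h1 h2
        have := h1 ⟨ea ▸ h2.1.le, h2.2.le⟩
        simpa using this)
      have h1 : e * S.vx τ x ≤ 0 := by linarith [ha ea.symm]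
      rw [S.newton_a τ hτ, hu τ hτ, ea]
      have h2 := mul_nonpos_of_nonneg_of_nonpos mp.le h1
      have h3 := abs_le.1 ((eb _).trans_le q4)
      nlinarith [h3.1]
  rcases eq_or_lt_of_le hx.2 with ea | lb
  · refine ⟨S.b, S.b' τ, S.b'' τ, ea.symm, ?_, (tm_ad S hτ).2, by rw [← S.bc_b τ hτ.le, ← ea]; exact hV x hx, ?_, ?_, fun h => absurd ea h.2.ne⟩
    · filter_upwards [Ioi_mem_nhds hτ] with z hz using ⟨(S.hab z (le_of_lt hz)).le, le_rfl⟩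
    · refine (S.hb'' τ hτ).congr_of_eventuallyEq ?_
      filter_upwards [Ioi_mem_nhds hτ] with z hz using S.bc_b z (le_of_lt hz)
    · have := tm_left _ _ _ df (by
        filter_upwards [mem_nhdsWithin_of_mem_nhds hmax, Ioo_mem_nhdsLT (ea ▸ hab)] with y h1 h2
        have := h1 ⟨h2.1.le, ea ▸ h2.2.le⟩
        simpa using this)
      have h1 : 0 ≤ e * S.vx τ x := by linarith [hb ea]
      rw [S.newton_b τ hτ, ← ea]
      have h2 := mul_nonneg mp.le h1
      have h3 := abs_le.1 ((eb _).trans_le q4)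
      nlinarith [h3.2]
  have nh := Ioo_mem_nhds la lb
  have hmax' : ∀ᶠ y in 𝓝 x, e * S.v τ y - m * (y - x) - k / 2 * (y - x) ^ 2 ≤ e * S.v τ x := by
    filter_upwards [hmax, nh] with y h1 h2 using h1 (Ioo_subset_Icc_self h2)
  have h1 : e * S.vx τ x - m = 0 := IsLocalMax.hasDerivAt_eq_zero
    (f := fun y => e * S.v τ y - m * (y - x) - k / 2 * (y - x) ^ 2) (hmax'.mono fun y hy => by simpa using hy) df
  have w := tm_vxx hl (v := S.v) τ x r0 (S.hρx τ hτ.le x hx)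
    (by filter_upwards [nh] with y hy using S.ρ_pos τ hτ.le y (Ioo_subset_Icc_self hy)) (S.momentum_eq τ hτ x ⟨la, lb⟩)
  generalize hW : (S.ρ τ x / μ (S.ρ τ x)) * S.vt τ x - ((μ1 (S.ρ τ x) / μ (S.ρ τ x)) * S.ρx τ x * S.vx τ x
       - (P1 (S.ρ τ x) / μ (S.ρ τ x)) * S.ρx τ x - (S.ρ τ x * S.v τ x / μ (S.ρ τ x)) * S.vx τ x) = W at w
  have wk : e * W ≤ k := by
    refine le_of_forall_pos_le_add fun δ hδ => ?_
    have d2 := tm_d2 (S.v τ) (S.vx τ) x W (by filter_upwards [nh] with y hy using S.hvx τ hτ y (Ioo_subset_Icc_self hy)) w δ hδ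
    have t1 : Tendsto (fun η : ℝ => x + η) (𝓝[>] 0) (𝓝 x) := by
      have : Tendsto (fun η : ℝ => x + η) (𝓝 0) (𝓝 (x + 0)) := (continuous_const.add continuous_id).tendsto 0
      rw [add_zero] at this; exact this.mono_left nhdsWithin_le_nhds
    have t2 : Tendsto (fun η : ℝ => x - η) (𝓝[>] 0) (𝓝 x) := by
      have : Tendsto (fun η : ℝ => x - η) (𝓝 0) (𝓝 (x - 0)) := (continuous_const.sub continuous_id).tendsto 0
      rw [sub_zero] at this; exact this.mono_left nhdsWithin_le_nhds
    obtain ⟨η, ⟨⟨i1, i2⟩, i3⟩, i4⟩ := (((d2.and (t1.eventually hmax')).and (t2.eventually hmax')).and self_mem_nhdsWithin).exists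
    have i4 : 0 < η := i4
    rw [← eb] at i1
    have i5 := (abs_le.1 i1).1
    have : e * W * η ^ 2 ≤ (k + δ) * η ^ 2 := by
      rw [show x + η - x = η by ring] at i2
      rw [show x - η - x = -η by ring] at i3
      linarith
    exact le_of_mul_le_mul_right this (by positivity)
  have key : e * S.vt τ x ≤ A * k + ((C * N + V) * L + C * N + C) := by
    have e1 : e * S.vt τ x = μ (S.ρ τ x) / S.ρ τ x * (e * W) + μ1 (S.ρ τ x) / S.ρ τ x * S.ρx τ x * m
        - e * (P1 (S.ρ τ x) / S.ρ τ x * S.ρx τ x) - S.v τ x * m := by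
      rw [← hW, show m = e * S.vx τ x by linarith]; field_simp; ring
    have b1 : μ (S.ρ τ x) / S.ρ τ x * (e * W) ≤ A * k := by
      have := mul_le_mul_of_nonneg_left wk (div_pos mp r0).le
      nlinarith
    have b2 : |μ1 (S.ρ τ x) / S.ρ τ x * S.ρx τ x * m| ≤ C * N * L := by
      rw [abs_mul, abs_mul]; gcongr
    have b3 : |e * (P1 (S.ρ τ x) / S.ρ τ x * S.ρx τ x)| ≤ C * N := by
      rw [eb, abs_mul]; gcongr
    have b4 : |S.v τ x * m| ≤ V * L := by
      rw [abs_mul]; exact mul_le_mul (hV x hx) hm (abs_nonneg _) hV0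
    rw [e1]
    linarith [(abs_le.1 b2).2, (abs_le.1 b3).1, (abs_le.1 b4).1]
  obtain ⟨ca, cb⟩ := tm_ad S hτ
  refine ⟨fun _ => x, 0, S.vt τ x, rfl, ?_, hasDerivAt_const _ _, by simpa using hV0, S.hvt τ hτ x hx, by nlinarith, fun _ => key⟩
  filter_upwards [ca.continuousAt.eventually_lt_const la, cb.continuousAt.eventually_const_lt lb] with z i1 i2 using ⟨i1.le, i2.le⟩
end

section
variable {P μ P1 μ1 : ℝ → ℝ} {Pe : ℝ}

lemma tm_B2c (hl : TmLaw P μ P1 μ1) (S : PistonSol P μ Pe) (hu : ∀ t, 0 < t → S.u t = 0) (s t l V A C N N1 κ δ Λ e : ℝ) (hs : 0 < s)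
    (hst : s ≤ t) (he : |e| = 1) (hV0 : 0 < V) (hV : ∀ τ ∈ Icc s t, l ≤ S.b τ - S.a τ ∧ ∀ x ∈ Icc (S.a τ) (S.b τ), |S.v τ x| ≤ V)
    (hA : 0 < A) (hC : 0 ≤ C) (hAC : ∀ τ ∈ Icc s t, ∀ x ∈ Icc (S.a τ) (S.b τ), A ≤ μ (S.ρ τ x) / S.ρ τ x ∧ |μ1 (S.ρ τ x) / S.ρ τ x| ≤ C ∧
      |P1 (S.ρ τ x) / S.ρ τ x| ≤ C ∧ |P (S.ρ τ x) - Pe| ≤ C) (h1 : 0 ≤ N1) (hN1 : ∀ τ ∈ Icc s t, ∀ x ∈ Icc (S.a τ) (S.b τ), |S.ρx τ x| ≤ N1)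
    (hN : ∀ x ∈ Icc (S.a s) (S.b s), |S.vx s x| ≤ N) (hκ : 0 < κ) (hδ : 0 < δ) (hκδ : κ * δ ≤ 1 / 4) (hδl : δ < l) (hΛ1 : 1 ≤ Λ)
    (hΛN : 2 * N ≤ Λ) (hΛV : 4 * V ≤ Λ * δ) (hAκ : (C * N1 + V) + C * N1 + C + V + 1 ≤ A * κ) (p q : ℝ) (hp : S.a t ≤ p) (hpq : p ≤ q)
    (hq : q ≤ S.b t) (hd : q - p ≤ δ) : e * (S.v t q - S.v t p) ≤ Λ * (q - p) := by
  have cA : Continuous fun x => S.a (tm_cl s t x) := (tm_ac S).1.comp_continuous (tm_cl_cont s t) fun x => hs.le.trans (tm_cl_mem s t x hst).1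
  have cB : Continuous fun x => S.b (tm_cl s t x) := (tm_ac S).2.comp_continuous (tm_cl_cont s t) fun x => hs.le.trans (tm_cl_mem s t x hst).1
  have cv := tm_ext S hs.le hst S.v S.v_cont
  set w : ℝ → ℝ → ℝ := fun τ x => S.v (tm_cl s t τ) (tm_cl (S.a (tm_cl s t τ)) (S.b (tm_cl s t τ)) x) with hw
  have hwv : ∀ τ ∈ Icc s t, ∀ x ∈ Icc (S.a τ) (S.b τ), w τ x = S.v τ x := fun τ hτ x hx => by
    simp only [hw]; rw [tm_cl_id _ _ _ hτ, tm_cl_id _ _ _ hx]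
  set K : Set (ℝ × ℝ × ℝ) := {x | (x.1 ∈ Icc s t) ∧ S.a (tm_cl s t x.1) ≤ x.2.1 ∧ x.2.1 ≤ x.2.2 ∧ x.2.2 ≤ S.b (tm_cl s t x.1) ∧
    x.2.2 - x.2.1 ≤ δ} with hK
  have Kc : IsClosed K := by
    have e1 : IsClosed {x : ℝ × ℝ × ℝ | x.1 ∈ Icc s t} := isClosed_Icc.preimage continuous_fst
    have e2 : IsClosed {x : ℝ × ℝ × ℝ | S.a (tm_cl s t x.1) ≤ x.2.1} := isClosed_le (cA.comp continuous_fst) (by fun_prop)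
    have e3 : IsClosed {x : ℝ × ℝ × ℝ | x.2.1 ≤ x.2.2} := isClosed_le (by fun_prop) (by fun_prop)
    have e4 : IsClosed {x : ℝ × ℝ × ℝ | x.2.2 ≤ S.b (tm_cl s t x.1)} := isClosed_le (by fun_prop) (cB.comp continuous_fst)
    have e5 : IsClosed {x : ℝ × ℝ × ℝ | x.2.2 - x.2.1 ≤ δ} := isClosed_le (by fun_prop) (by fun_prop)
    exact e1.inter (e2.inter (e3.inter (e4.inter e5)))
  obtain ⟨lo, hlo⟩ := (isCompact_Icc (a := s) (b := t)).bddBelow_image cA.continuousOn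
  obtain ⟨hi, hhi⟩ := (isCompact_Icc (a := s) (b := t)).bddAbove_image cB.continuousOn
  have Kk : IsCompact K := by
    refine ((isCompact_Icc (a := s) (b := t)).prod ((isCompact_Icc (a := lo) (b := hi)).prod (isCompact_Icc (a := lo) (b := hi)))).of_isClosed_subset Kc ?_
    rintro ⟨τ, x, y⟩ ⟨k1, k2, k3, k4, -⟩
    have u1 := hlo (mem_image_of_mem _ k1)
    have u2 := hhi (mem_image_of_mem _ k1)
    simp only at k2 k3 k4 u1 u2
    exact ⟨k1, ⟨u1.trans k2, (k3.trans k4).trans u2⟩, ⟨(u1.trans k2).trans k3, k4.trans u2⟩⟩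
  have mK : ∀ τ ∈ Icc s t, ∀ x y, S.a τ ≤ x → x ≤ y → y ≤ S.b τ → y - x ≤ δ → (τ, x, y) ∈ K := fun τ hτ x y a1 a2 a3 a4 => by
    refine ⟨hτ, ?_, a2, ?_, a4⟩
    · simpa only [tm_cl_id _ _ _ hτ] using a1
    · simpa only [tm_cl_id _ _ _ hτ] using a3
  have cw : Continuous fun x : ℝ × ℝ × ℝ => e * (w x.1 x.2.2 - w x.1 x.2.1) - Λ * ((x.2.2 - x.2.1) - κ * (x.2.2 - x.2.1) ^ 2) := by
    have c1 : Continuous fun x : ℝ × ℝ × ℝ => w x.1 x.2.2 := cv.comp (f := fun x : ℝ × ℝ × ℝ => (x.1, x.2.2)) (by fun_prop)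
    have c2 : Continuous fun x : ℝ × ℝ × ℝ => w x.1 x.2.1 := cv.comp (f := fun x : ℝ × ℝ × ℝ => (x.1, x.2.1)) (by fun_prop)
    fun_prop
  have ht : t ∈ Icc s t := ⟨hst, le_rfl⟩
  have m0 := mK t ht p q hp hpq hq hd
  obtain ⟨⟨τ, x, y⟩, hm, hmx⟩ := Kk.exists_isMaxOn ⟨_, m0⟩ cw.continuousOn
  have hmax : ∀ τ' ∈ Icc s t, ∀ x' y', S.a τ' ≤ x' → x' ≤ y' → y' ≤ S.b τ' → y' - x' ≤ δ →
      e * (S.v τ' y' - S.v τ' x') - Λ * ((y' - x') - κ * (y' - x') ^ 2) ≤ e * (w τ y - w τ x) - Λ * ((y - x) - κ * (y - x) ^ 2) := by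
    intro τ' hτ' x' y' a1 a2 a3 a4
    have := hmx (mK τ' hτ' x' y' a1 a2 a3 a4)
    simp only [mem_setOf_eq] at this
    rwa [hwv τ' hτ' y' ⟨a1.trans a2, a3⟩, hwv τ' hτ' x' ⟨a1, a2.trans a3⟩] at this
  obtain ⟨hτ, k2, k3, k4, k5⟩ := hm
  simp only at hτ k2 k3 k4 k5
  rw [tm_cl_id _ _ _ hτ] at k2 k4
  have ix : x ∈ Icc (S.a τ) (S.b τ) := ⟨k2, k3.trans k4⟩
  have iy : y ∈ Icc (S.a τ) (S.b τ) := ⟨k2.trans k3, k4⟩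
  rw [hwv τ hτ y iy, hwv τ hτ x ix] at hmax
  have eb : ∀ z, e * z ≤ |z| := fun z => (le_abs_self _).trans (by rw [abs_mul, he, one_mul])
  have hle : e * (S.v τ y - S.v τ x) - Λ * ((y - x) - κ * (y - x) ^ 2) ≤ 0 := by
    by_contra! hpos
    have hr0 : 0 ≤ y - x := by linarith
    have hκr : κ * (y - x) ≤ 1 / 4 := (mul_le_mul_of_nonneg_left k5 hκ.le).trans hκδ
    have hω : Λ * (3 / 4 * (y - x)) ≤ Λ * ((y - x) - κ * (y - x) ^ 2) := mul_le_mul_of_nonneg_left (by nlinarith) (by linarith)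
    have hxy : x < y := by
      rcases k3.lt_or_eq with h | h
      · exact h
      · subst h; simp at hpos
    have vx' := abs_le.1 ((hV τ hτ).2 x ix)
    have vy' := abs_le.1 ((hV τ hτ).2 y iy)
    have hdl : y - x < δ := by
      rcases k5.lt_or_eq with h | h
      · exact h
      · have : |S.v τ y - S.v τ x| ≤ 2 * V := abs_le.2 ⟨by linarith, by linarith⟩
        have := eb (S.v τ y - S.v τ x)
        rw [h] at hω hpos
        nlinarith
    have hsτ : s < τ := by
      rcases hτ.1.lt_or_eq with h | h
      · exact h
      · exfalso
        subst h
        have := tm_lip _ _ _ _ N (fun z hz => S.hvx s hs z hz) hN y iy x ix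
        have := eb (S.v s y - S.v s x)
        rw [abs_of_pos (sub_pos.2 hxy)] at *
        nlinarith
    have hτ0 : 0 < τ := hs.trans hsτ
    set r := y - x with hr
    have hr' : 0 < r := sub_pos.2 hxy
    have m1 : 0 ≤ Λ * (1 - 2 * κ * r) := mul_nonneg (by linarith) (by linarith)
    have m2 : Λ * (1 - 2 * κ * r) ≤ Λ := by
      have := mul_nonneg (mul_nonneg (by linarith : 0 ≤ Λ) hκ.le) hr'.le
      linarith
    have hk : -2 * κ * Λ ≤ 0 := by have := mul_nonneg hκ.le (by linarith : 0 ≤ Λ); linarith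
    obtain ⟨cq, dq, Dq, q1, q2, q3, q4, q5, q6, q7⟩ := tm_pt hl S hu τ y e (Λ * (1 - 2 * κ * r)) (-2 * κ * Λ) Λ V A C N1 hτ0 iy he
      (by rw [abs_of_nonneg m1]; exact m2) hk (hV τ hτ).2 hA hC (hAC τ hτ) (hN1 τ hτ y iy) (by
        have e1 : ∀ᶠ z in 𝓝 y, x < z ∧ z < x + δ := (eventually_gt_nhds hxy).and (eventually_lt_nhds (by linarith))
        filter_upwards [e1] with z hz hz2
        have := hmax τ hτ x z k2 hz.1.le hz2.2 (by linarith)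
        simp only [hr] at this ⊢
        linarith) (fun h => absurd h (by linarith)) (fun _ => m1)
    obtain ⟨cp, dp, Dp, p1, p2, p3, p4, p5, p6, p7⟩ := tm_pt hl S hu τ x (-e) (-(Λ * (1 - 2 * κ * r))) (-2 * κ * Λ) Λ V A C N1 hτ0 ix
      (by rwa [abs_neg]) (by rw [abs_neg, abs_of_nonneg m1]; exact m2) hk (hV τ hτ).2 hA hC (hAC τ hτ) (hN1 τ hτ x ix) (by
        have e1 : ∀ᶠ z in 𝓝 x, z < y ∧ y - δ < z := (eventually_lt_nhds hxy).and (eventually_gt_nhds (by linarith))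
        filter_upwards [e1] with z hz hz2
        have := hmax τ hτ z y hz2.1 hz.1.le k4 (by linarith)
        simp only [hr] at this ⊢
        linarith) (fun _ => by linarith) (fun h => absurd h (by linarith))
    have dΨ : HasDerivAt (fun z => e * (S.v z (cq z) - S.v z (cp z)) - Λ * ((cq z - cp z) - κ * (cq z - cp z) ^ 2))
        (e * (Dq - Dp) - Λ * ((dq - dp) - κ * (2 * r * (dq - dp)))) τ := by
      have d1 : HasDerivAt (fun z => cq z - cp z) (dq - dp) τ := q3.sub p3
      have d2 : HasDerivAt (fun z => (cq z - cp z) ^ 2) (2 * r * (dq - dp)) τ := by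
        have := d1.pow 2
        simp only [q1, p1, Nat.cast_ofNat, Nat.add_one_sub_one, pow_one] at this
        exact this
      exact ((q5.sub p5).const_mul e).sub ((d1.sub (d2.const_mul κ)).const_mul Λ)
    have fin := tm_left _ _ _ dΨ (by
      have e1 : ∀ᶠ z in 𝓝 τ, cp z < cq z ∧ cq z - cp z < δ ∧ s < z := by
        refine (p3.continuousAt.eventually_lt q3.continuousAt (by rwa [p1, q1])).and (((q3.continuousAt.sub p3.continuousAt).eventually
          (eventually_lt_nhds (b := δ) ?_)).and (eventually_gt_nhds hsτ))
        simpa [p1, q1, hr] using hdl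
      filter_upwards [nhdsWithin_le_nhds e1, nhdsWithin_le_nhds q2, nhdsWithin_le_nhds p2, self_mem_nhdsWithin] with z a1 a2 a3 a4
      have := hmax z ⟨a1.2.2.le, (le_of_lt a4).trans hτ.2⟩ (cp z) (cq z) a3.1 a1.1.le a2.2 a1.2.1.le
      rw [p1, q1]; exact this)
    have c1 := abs_le.1 q4
    have c2 := abs_le.1 p4
    have c3 : -(Λ * (1 - 2 * κ * r) * (dq - dp)) ≤ Λ * (2 * V) := by
      have : Λ * (1 - 2 * κ * r) * (dp - dq) ≤ Λ * (1 - 2 * κ * r) * (2 * V) := mul_le_mul_of_nonneg_left (by linarith) m1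
      have : Λ * (1 - 2 * κ * r) * (2 * V) ≤ Λ * (2 * V) := mul_le_mul_of_nonneg_right m2 (by linarith)
      linarith
    have c4 : Λ * ((C * N1 + V) + C * N1 + C + V + 1) ≤ Λ * (A * κ) := mul_le_mul_of_nonneg_left hAκ (by linarith)
    have c5 : 0 ≤ (Λ - 1) * (C * N1 + C) := mul_nonneg (by linarith) (by have := mul_nonneg hC h1; linarith)
    have hor : x ∈ Ioo (S.a τ) (S.b τ) ∨ y ∈ Ioo (S.a τ) (S.b τ) := by
      rcases k2.lt_or_eq with h | h
      · exact Or.inl ⟨h, by linarith⟩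
      · exact Or.inr ⟨by linarith, by linarith [(hV τ hτ).1]⟩
    rcases hor with h | h
    · have := p7 h
      linarith
    · have := q7 h
      linarith
  have h5 := (hmax t ht p q hp hpq hq hd).trans hle
  have : 0 ≤ Λ * (κ * (q - p) ^ 2) := by positivity
  linarith
end

section
variable {P μ P1 μ1 : ℝ → ℝ} {Pe : ℝ}

lemma tm_B2 (hl : TmLaw P μ P1 μ1) (S : PistonSol P μ Pe) (hu : ∀ t, 0 < t → S.u t = 0) (T0 T1 N N1 : ℝ) (h0 : 0 < T0) (h1 : T0 ≤ T1)
    (hN : 0 ≤ N) (hN1 : 0 ≤ N1) : ∃ Λ, 0 ≤ Λ ∧ ∀ s t, T0 ≤ s → s < t → t ≤ T1 → (∀ τ ∈ Icc s t, ∀ x ∈ Icc (S.a τ) (S.b τ), |S.ρx τ x| ≤ N1) →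
      (∀ x ∈ Icc (S.a s) (S.b s), |S.vx s x| ≤ N) → ∀ x ∈ Icc (S.a t) (S.b t), |S.vx t x| ≤ Λ := by
  obtain ⟨V, r0, r1, l, hV, hr0, hl0, hb⟩ := tm_bds S h0.le h1
  have sub : Icc r0 r1 ⊆ Ioi 0 := fun r hr => hr0.trans_le hr.1
  have hne : ∀ r ∈ Icc r0 r1, r ≠ 0 := fun r hr => (sub hr).ne'
  have cμ : ContinuousOn μ (Icc r0 r1) := fun r hr => (hl.dμ r (sub hr)).continuousAt.continuousWithinAt
  have cP : ContinuousOn P (Icc r0 r1) := fun r hr => (hl.dP r (sub hr)).continuousAt.continuousWithinAt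
  have hr1 : r0 ≤ r1 := by
    obtain ⟨-, h⟩ := hb T0 ⟨le_rfl, h1⟩
    have := (h _ ⟨le_rfl, (S.hab T0 h0.le).le⟩).2
    exact this.1.trans this.2
  obtain ⟨rm, hrm, hmin⟩ := isCompact_Icc.exists_isMinOn (nonempty_Icc.2 hr1) (cμ.div continuousOn_id hne)
  obtain ⟨C1, hC1⟩ := isCompact_Icc.exists_bound_of_continuousOn ((hl.cμ1.mono sub).div continuousOn_id hne)
  obtain ⟨C2, hC2⟩ := isCompact_Icc.exists_bound_of_continuousOn ((hl.cP1.mono sub).div continuousOn_id hne)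
  obtain ⟨C3, hC3⟩ := isCompact_Icc.exists_bound_of_continuousOn (cP.sub (continuousOn_const (c := Pe)))
  obtain ⟨A, hAe⟩ : ∃ A, A = μ rm / rm := ⟨_, rfl⟩
  have hA : 0 < A := hAe ▸ div_pos (hl.μpos rm (sub hrm)) (sub hrm)
  obtain ⟨C, hC, c1, c2, c3⟩ : ∃ C, 0 ≤ C ∧ C1 ≤ C ∧ C2 ≤ C ∧ C3 ≤ C := ⟨max 0 (max C1 (max C2 C3)), by simp, by simp, by simp, by simp⟩
  obtain ⟨κ, hκe⟩ : ∃ κ, κ = ((C * N1 + V) + C * N1 + C + V + 1) / A := ⟨_, rfl⟩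
  have hκ : 0 < κ := by rw [hκe]; positivity
  obtain ⟨δ, hδe⟩ : ∃ δ, δ = min (1 / (4 * κ)) (l / 2) := ⟨_, rfl⟩
  have hδ : 0 < δ := by rw [hδe]; positivity
  have d1 : κ * δ ≤ 1 / 4 := by
    have : δ ≤ 1 / (4 * κ) := hδe ▸ min_le_left _ _
    rw [le_div_iff₀ (by positivity)] at this; linarith
  have d2 : δ ≤ l / 2 := hδe ▸ min_le_right _ _
  obtain ⟨Λ, hΛ⟩ : ∃ Λ, Λ = 1 + 2 * N + 4 * V / δ := ⟨_, rfl⟩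
  have hq : 0 < 4 * V / δ := by positivity
  have l3 : 4 * V ≤ Λ * δ := by
    have : 4 * V = 4 * V / δ * δ := by field_simp
    rw [this, hΛ]; exact mul_le_mul_of_nonneg_right (by linarith) hδ.le
  refine ⟨Λ, by linarith, fun s t hs hst ht H1 H2 => ?_⟩
  have i1 : ∀ τ ∈ Icc s t, τ ∈ Icc T0 T1 := fun τ h => ⟨hs.trans h.1, h.2.trans ht⟩
  have hs0 := h0.trans_le hs
  have it : t ∈ Icc s t := ⟨hst.le, le_rfl⟩
  have core : ∀ e : ℝ, |e| = 1 → _ := fun e he => tm_B2c hl S hu s t l V A C N N1 κ δ Λ e hs0 hst.le he hV (fun τ hτ =>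
    ⟨(hb τ (i1 τ hτ)).1, fun x hx => ((hb τ (i1 τ hτ)).2 x hx).1⟩) hA hC (fun τ hτ x hx => by
      have hr := ((hb τ (i1 τ hτ)).2 x hx).2
      exact ⟨hAe ▸ hmin hr, (hC1 _ hr).trans c1, (hC2 _ hr).trans c2, (hC3 _ hr).trans c3⟩) hN1 H1 H2 hκ hδ d1 (by linarith) (by linarith)
      (by linarith) l3 (by rw [hκe]; apply le_of_eq; field_simp)
  refine tm_dlip (S.v t) (S.vx t) _ _ Λ (S.hab t (hs0.trans hst).le) (by linarith) (S.hvx t (hs0.trans hst)) (S.vx_cont t (hs0.trans hst))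
    fun x hx y hy hxy => ?_
  by_cases h : y - x ≤ δ
  · have e1 := core 1 (by simp) x y hx.1.le hxy.le hy.2.le h
    have e2 := core (-1) (by simp) x y hx.1.le hxy.le hy.2.le h
    exact abs_le.2 ⟨by linarith, by linarith⟩
  · have e1 := abs_le.1 ((hb t (i1 t it)).2 x ⟨hx.1.le, hx.2.le⟩).1
    have e2 := abs_le.1 ((hb t (i1 t it)).2 y ⟨hy.1.le, hy.2.le⟩).1
    have : Λ * δ ≤ Λ * (y - x) := mul_le_mul_of_nonneg_left (by linarith) (by linarith)
    exact abs_le.2 ⟨by linarith, by linarith⟩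

lemma tm_BB (hl : TmLaw P μ P1 μ1) (S : PistonSol P μ Pe) (hu : ∀ t, 0 < t → S.u t = 0) (T0 T1 N : ℝ) (h0 : 0 < T0) (h1 : T0 ≤ T1)
    (hN : 0 ≤ N) : ∃ K, ∀ s t, T0 ≤ s → s < t → t ≤ T1 → (∀ τ ∈ Ioc s t, TmLB S τ) → TmB S N s → TmB S K t := by
  obtain ⟨N1, n1, H1⟩ := tm_B1 hl S T0 T1 N h0 h1 hN
  obtain ⟨Λ, n2, H2⟩ := tm_B2 hl S hu T0 T1 N (max N N1) h0 h1 hN (by positivity)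
  refine ⟨max N1 Λ, fun s t hs hst ht lb hB x hx => ⟨(H1 s t hs hst ht lb (fun y hy => (hB y hy).1) x hx).trans (le_max_left _ _),
    (H2 s t hs hst ht (fun τ hτ y hy => ?_) (fun y hy => (hB y hy).2) x hx).trans (le_max_right _ _)⟩⟩
  rcases hτ.1.lt_or_eq with h | h
  · exact (H1 s τ hs h (hτ.2.trans ht) (fun z hz => lb z ⟨hz.1, hz.2.trans hτ.2⟩) (fun y hy => (hB y hy).1) y hy).trans (le_max_right _ _)
  · subst h; exact (hB y hy).1.trans (le_max_left _ _)

lemma tm_Bmono (S : PistonSol P μ Pe) {N K t : ℝ} (h : N ≤ K) (hB : TmB S N t) : TmB S K t := fun x hx =>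
  ⟨(hB x hx).1.trans h, (hB x hx).2.trans h⟩

lemma tm_Bex (S : PistonSol P μ Pe) {t : ℝ} (ht : 0 < t) : ∃ n : ℕ, TmB S n t := by
  obtain ⟨C1, h1⟩ := isCompact_Icc.exists_bound_of_continuousOn (S.ρx_cont t ht.le)
  obtain ⟨C2, h2⟩ := isCompact_Icc.exists_bound_of_continuousOn (S.vx_cont t ht)
  obtain ⟨n, hn⟩ := exists_nat_ge (max C1 C2)
  exact ⟨n, fun x hx => ⟨(h1 x hx).trans ((le_max_left _ _).trans hn), (h2 x hx).trans ((le_max_right _ _).trans hn)⟩⟩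

lemma tm_qlim (S : PistonSol P μ Pe) (q : ℝ → ℝ → ℝ)
    (hq : ContinuousOn (fun p : ℝ × ℝ => q p.1 p.2) {p : ℝ × ℝ | 0 ≤ p.1 ∧ p.2 ∈ Icc (S.a p.1) (S.b p.1)}) (τ : ℕ → ℝ) (t : ℝ) (ht : 0 < t)
    (hτ : Tendsto τ atTop (𝓝 t)) (x : ℝ) (hx : x ∈ Ioo (S.a t) (S.b t)) :
    (∀ᶠ n in atTop, 0 < τ n ∧ x ∈ Icc (S.a (τ n)) (S.b (τ n))) ∧ Tendsto (fun n => q (τ n) x) atTop (𝓝 (q t x)) := by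
  have ev : ∀ᶠ n in atTop, 0 < τ n ∧ x ∈ Icc (S.a (τ n)) (S.b (τ n)) := by
    filter_upwards [hτ.eventually (eventually_gt_nhds ht), hτ.eventually ((tm_ad S ht).1.continuousAt.eventually_lt_const hx.1),
      hτ.eventually ((tm_ad S ht).2.continuousAt.eventually_const_lt hx.2)] with n a b c
    exact ⟨a, b.le, c.le⟩
  refine ⟨ev, ?_⟩
  have := hq (t, x) ⟨ht.le, hx.1.le, hx.2.le⟩
  refine Tendsto.comp (f := fun n => (τ n, x)) this (tendsto_nhdsWithin_iff.2 ⟨hτ.prodMk_nhds tendsto_const_nhds, ?_⟩)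
  filter_upwards [ev] with n hn
  exact ⟨hn.1.le, hn.2⟩

lemma tm_Bcl (S : PistonSol P μ Pe) (N : ℝ) (hN : 0 ≤ N) (τ : ℕ → ℝ) (t : ℝ) (ht : 0 < t) (hτ : Tendsto τ atTop (𝓝 t))
    (hB : ∀ n, TmB S N (τ n)) : TmB S N t := by
  have key : ∀ q q1 : ℝ → ℝ → ℝ, ContinuousOn (fun p : ℝ × ℝ => q p.1 p.2) {p : ℝ × ℝ | 0 ≤ p.1 ∧ p.2 ∈ Icc (S.a p.1) (S.b p.1)} →
      (∀ t, 0 < t → ∀ x ∈ Icc (S.a t) (S.b t), HasDerivAt (q t) (q1 t x) x) → ContinuousOn (q1 t) (Icc (S.a t) (S.b t)) →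
      (∀ n, ∀ x ∈ Icc (S.a (τ n)) (S.b (τ n)), |q1 (τ n) x| ≤ N) → ∀ x ∈ Icc (S.a t) (S.b t), |q1 t x| ≤ N := by
    intro q q1 h1 h2 h3 h4
    refine tm_dlip (q t) (q1 t) _ _ N (S.hab t ht.le) hN (h2 t ht) h3 fun x hx y hy hxy => ?_
    have ex := tm_qlim S q h1 τ t ht hτ x hx
    have ey := tm_qlim S q h1 τ t ht hτ y hy
    refine le_of_tendsto ((ey.2.sub ex.2).abs) ?_
    filter_upwards [ex.1, ey.1] with n a b
    have := tm_lip _ _ _ _ N (h2 (τ n) a.1) (h4 n) y b.2 x a.2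
    rwa [abs_of_pos (sub_pos.2 hxy)] at this
  exact fun x hx => ⟨key S.ρ S.ρx S.ρ_cont (fun t ht => S.hρx t ht.le) (S.ρx_cont t ht.le) (fun n x hx => (hB n x hx).1) x hx,
    key S.v S.vx S.v_cont S.hvx (S.vx_cont t ht) (fun n x hx => (hB n x hx).2) x hx⟩
end

section
variable {P μ P1 μ1 : ℝ → ℝ} {Pe : ℝ}

lemma tm_LBo (S : PistonSol P μ Pe) : IsClosed {t | ¬ TmLB S t} := by
  have : IsOpen {t | TmLB S t} := by
    refine isOpen_iff_mem_nhds.2 fun t ⟨N, hN⟩ => ?_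
    filter_upwards [eventually_eventually_nhds.2 hN] with τ h
    exact ⟨N, h⟩
  exact this.isClosed_compl

lemma tm_all (hl : TmLaw P μ P1 μ1) (S : PistonSol P μ Pe) (hu : ∀ t, 0 < t → S.u t = 0) : ∀ t, 0 < t → TmLB S t := by
  by_contra! hc
  obtain ⟨t0, h0, hn0⟩ := hc
  obtain ⟨K, hK⟩ : ∃ K : Set ℝ, K = {x | ¬ TmLB S (Real.exp x)} := ⟨_, rfl⟩
  have Kc : IsClosed K := hK ▸ (tm_LBo S).preimage Real.continuous_exp
  have : Nonempty K := ⟨Real.log t0, by rw [hK]; simpa [Real.exp_log h0] using hn0⟩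
  have : CompleteSpace K := Kc.completeSpace_coe
  obtain ⟨n, x, hx⟩ := nonempty_interior_of_iUnion_of_closed (f := fun n : ℕ => {x : K | TmB S n (Real.exp x)}) (fun n => by
    refine IsSeqClosed.isClosed fun xs x hxs hlim => ?_
    refine tm_Bcl S n (by positivity) (fun n => Real.exp (xs n)) _ (Real.exp_pos _) ?_ hxs
    exact (Real.continuous_exp.tendsto _).comp ((continuous_subtype_val.tendsto x).comp hlim)) (by
    refine eq_univ_of_forall fun x => ?_
    obtain ⟨n, hn⟩ := tm_Bex S (Real.exp_pos x)
    exact mem_iUnion.2 ⟨n, hn⟩)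
  rw [mem_interior_iff_mem_nhds, nhds_subtype, mem_comap] at hx
  obtain ⟨U, hU, hUs⟩ := hx
  obtain ⟨ts, hts⟩ : ∃ ts, ts = Real.exp x := ⟨_, rfl⟩
  have hpos : 0 < ts := hts ▸ Real.exp_pos _
  have hxl : (x : ℝ) = Real.log ts := by rw [hts, Real.log_exp]
  have hbad : ¬ TmLB S ts := by
    have h : ∀ y ∈ K, ¬ TmLB S (Real.exp y) := by rw [hK]; exact fun _ h => h
    exact hts ▸ h x x.2
  apply hbad
  have ev : ∀ᶠ t in 𝓝 ts, 0 < t ∧ (¬ TmLB S t → TmB S n t) := by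
    rw [hxl] at hU
    filter_upwards [eventually_gt_nhds hpos, (Real.continuousAt_log hpos.ne').eventually hU] with t a b
    refine ⟨a, fun h => ?_⟩
    have : Real.log t ∈ K := by rw [hK]; simpa [Real.exp_log a] using h
    have := hUs (show (⟨Real.log t, this⟩ : K) ∈ _ from b)
    simpa [Real.exp_log a] using this
  obtain ⟨r, hr, hr2⟩ := Metric.nhds_basis_closedBall.eventually_iff.1 ev
  simp only [Real.closedBall_eq_Icc] at hr2
  have hp0 : 0 < ts - r := (hr2 ⟨le_rfl, by linarith⟩).1
  obtain ⟨n0, hn0⟩ := tm_Bex S hp0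
  obtain ⟨N, hN⟩ : ∃ N : ℝ, N = max (n : ℝ) n0 := ⟨_, rfl⟩
  have hNn : (n : ℝ) ≤ N := hN ▸ le_max_left _ _
  have hNn0 : (n0 : ℝ) ≤ N := hN ▸ le_max_right _ _
  obtain ⟨L, hL⟩ := tm_BB hl S hu (ts - r) (ts + r) N hp0 (by linarith) (by have : (0:ℝ) ≤ n := by positivity
                                                                            linarith)
  refine ⟨max N L, ?_⟩
  filter_upwards [Icc_mem_nhds (by linarith : ts - r < ts) (by linarith : ts < ts + r)] with t ht
  have cQ : IsCompact ({ts - r} ∪ (Icc (ts - r) t ∩ {t | ¬ TmLB S t})) := isCompact_singleton.union (isCompact_Icc.inter_right (tm_LBo S))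
  obtain ⟨α, hα, hub⟩ := cQ.exists_isGreatest ⟨_, Or.inl rfl⟩
  have hα2 : α ∈ Icc (ts - r) t ∧ TmB S N α := by
    rcases hα with h | ⟨h, h'⟩
    · rw [mem_singleton_iff] at h
      exact ⟨⟨h.ge, h.le.trans ht.1⟩, h ▸ tm_Bmono S hNn0 hn0⟩
    · exact ⟨h, tm_Bmono S hNn ((hr2 ⟨h.1, h.2.trans ht.2⟩).2 h')⟩
  rcases hα2.1.2.lt_or_eq with h | h
  · refine tm_Bmono S (le_max_right _ _) (hL α t hα2.1.1 h ht.2 (fun τ hτ => ?_) hα2.2)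
    by_contra hh
    exact absurd (hub (Or.inr ⟨⟨hα2.1.1.trans hτ.1.le, hτ.2⟩, hh⟩)) (not_le.2 hτ.1)
  · exact h ▸ tm_Bmono S (le_max_left _ _) hα2.2
end

section
variable {P μ P1 μ1 : ℝ → ℝ} {Pe : ℝ}

lemma tm_icv (f : ℝ → ℝ) (A B : ℝ) (hAB : A ≤ B) (hf : ContinuousOn f (Icc A B)) (X Y : ℕ → ℝ) (hX : ∀ n, X n ∈ Icc A B) (hY : ∀ n, Y n ∈ Icc A B)
    (lX : Tendsto X atTop (𝓝 A)) (lY : Tendsto Y atTop (𝓝 B)) : Tendsto (fun n => ∫ y in (X n)..(Y n), f y) atTop (𝓝 (∫ y in A..B, f y)) := by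
  have cF : Continuous fun x => f (tm_cl A B x) := hf.comp_continuous (tm_cl_cont A B) fun x => tm_cl_mem A B x hAB
  have e : ∀ x ∈ Icc A B, ∀ y ∈ Icc A B, (∫ z in x..y, f z) = (∫ z in A..y, f (tm_cl A B z)) - ∫ z in A..x, f (tm_cl A B z) := by
    intro x hx y hy
    rw [intervalIntegral.integral_interval_sub_left (cF.intervalIntegrable _ _) (cF.intervalIntegrable _ _)]
    refine intervalIntegral.integral_congr fun z hz => ?_
    have := (uIcc_subset_Icc hx hy) hz
    simp only [tm_cl_id _ _ _ this]
  have cP : Continuous fun y => ∫ z in A..y, f (tm_cl A B z) := intervalIntegral.continuous_primitive (fun a b => cF.intervalIntegrable a b) A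
  rw [e A ⟨le_rfl, hAB⟩ B ⟨hAB, le_rfl⟩]
  simp only [fun n => e (X n) (hX n) (Y n) (hY n)]
  exact ((cP.tendsto B).comp lY).sub ((cP.tendsto A).comp lX)

lemma tm_fin (hl : TmLaw P μ P1 μ1) (S : PistonSol P μ Pe) (hu : ∀ t, 0 < t → S.u t = 0) (s t : ℝ) (hs : 0 < s) (hst : s ≤ t) :
    S.a' s + S.b' s + (∫ x in S.a s..S.b s, S.ρ s x * S.v s x) = S.a' t + S.b' t + ∫ x in S.a t..S.b t, S.ρ t x * S.v t x := by
  have lb : ∀ τ ∈ Icc s t, TmLB S τ := fun τ h => tm_all hl S hu τ (hs.trans_le h.1)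
  obtain ⟨N, hN⟩ := tm_cpt S s t lb
  obtain ⟨V, r0, r1, l, hV, hr0, hl0, hb⟩ := tm_bds S hs.le hst
  have pos : ∀ τ ∈ Icc s t, 0 < τ := fun τ h => hs.trans_le h.1
  have iA : ∀ τ ∈ Icc s t, S.a τ ∈ Icc (S.a τ) (S.b τ) := fun τ h => ⟨le_rfl, (S.hab τ (pos τ h).le).le⟩
  have iB : ∀ τ ∈ Icc s t, S.b τ ∈ Icc (S.a τ) (S.b τ) := fun τ h => ⟨(S.hab τ (pos τ h).le).le, le_rfl⟩
  have bA : ∀ τ ∈ Icc s t, |S.a' τ| ≤ V := fun τ h => by rw [← S.bc_a τ (pos τ h).le]; exact ((hb τ h).2 _ (iA τ h)).1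
  have bB : ∀ τ ∈ Icc s t, |S.b' τ| ≤ V := fun τ h => by rw [← S.bc_b τ (pos τ h).le]; exact ((hb τ h).2 _ (iB τ h)).1
  have LA := tm_lip S.a S.a' s t V (fun τ h => (tm_ad S (pos τ h)).1) bA
  have LB := tm_lip S.b S.b' s t V (fun τ h => (tm_ad S (pos τ h)).2) bB
  have sub : Icc r0 r1 ⊆ Ioi 0 := fun r hr => hr0.trans_le hr.1
  have cμ : ContinuousOn μ (Icc r0 r1) := fun r hr => (hl.dμ r (sub hr)).continuousAt.continuousWithinAt
  have cP : ContinuousOn P (Icc r0 r1) := fun r hr => (hl.dP r (sub hr)).continuousAt.continuousWithinAt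
  obtain ⟨C1, hC1⟩ := isCompact_Icc.exists_bound_of_continuousOn cμ
  obtain ⟨C2, hC2⟩ := isCompact_Icc.exists_bound_of_continuousOn cP
  set F : ℝ → ℝ → ℝ → ℝ := fun c τ x => (μ (S.ρ τ x) * S.vx τ x - P (S.ρ τ x) - S.ρ τ x * S.v τ x ^ 2) + S.ρ τ x * S.v τ x * c with hF
  have bF : ∀ τ ∈ Icc s t, ∀ x ∈ Icc (S.a τ) (S.b τ), ∀ c, |c| ≤ V → |F c τ x| ≤ C1 * N + C2 + r1 * V ^ 2 + r1 * V * V := by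
    intro τ hτ x hx c hc
    obtain ⟨u1, u2⟩ := (hb τ hτ).2 x hx
    have a1 : |S.ρ τ x| ≤ r1 := by rw [abs_of_pos (sub u2)]; exact u2.2
    have r1' := (abs_nonneg _).trans a1
    have a2 : |μ (S.ρ τ x)| ≤ C1 := hC1 _ u2
    have a3 : |P (S.ρ τ x)| ≤ C2 := hC2 _ u2
    have a4 := (hN τ hτ x hx).2
    simp only [hF]
    refine (abs_add_le _ _).trans (add_le_add ((abs_sub _ _).trans (add_le_add ((abs_sub _ _).trans (add_le_add ?_ a3)) ?_)) ?_)
    · rw [abs_mul]; exact mul_le_mul a2 a4 (abs_nonneg _) ((abs_nonneg _).trans a2)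
    · rw [abs_mul, abs_pow]; gcongr
    · rw [abs_mul, abs_mul]; gcongr
  have cρ : ∀ τ ∈ Icc s t, ContinuousOn (S.ρ τ) (Icc (S.a τ) (S.b τ)) := fun τ hτ x hx =>
    (S.hρx τ (pos τ hτ).le x hx).continuousAt.continuousWithinAt
  have cv : ∀ τ ∈ Icc s t, ContinuousOn (S.v τ) (Icc (S.a τ) (S.b τ)) := fun τ hτ x hx =>
    (S.hvx τ (pos τ hτ) x hx).continuousAt.continuousWithinAt
  have cF : ∀ τ ∈ Icc s t, ∀ c, ContinuousOn (F c τ) (Icc (S.a τ) (S.b τ)) := by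
    intro τ hτ c
    have m1 : MapsTo (S.ρ τ) (Icc (S.a τ) (S.b τ)) (Icc r0 r1) := fun x hx => ((hb τ hτ).2 x hx).2
    have c1 := cμ.comp (cρ τ hτ) m1
    have c2 := cP.comp (cρ τ hτ) m1
    have c3 := S.vx_cont τ (pos τ hτ)
    have c4 := cρ τ hτ
    have c5 := cv τ hτ
    exact (((c1.mul c3).sub c2).sub (c4.mul (c5.pow 2))).add ((c4.mul c5).mul continuousOn_const)
  obtain ⟨d, hd⟩ : ∃ d : ℕ → ℝ, d = fun n : ℕ => l / 3 * (1 / ((n : ℝ) + 1)) := ⟨_, rfl⟩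
  have d0 : ∀ n, 0 < d n := fun n => by rw [hd]; positivity
  have d1 : ∀ n, d n ≤ l / 3 := fun n => by
    rw [hd]
    have : 1 / ((n : ℝ) + 1) ≤ 1 := by rw [div_le_one (by positivity)]; linarith [(Nat.cast_nonneg n : (0:ℝ) ≤ n)]
    have := mul_le_mul_of_nonneg_left this (by linarith : 0 ≤ l / 3)
    simpa using this
  have dl : Tendsto d atTop (𝓝 0) := by
    have := tendsto_one_div_add_atTop_nhds_zero_nat.const_mul (l / 3)
    rw [hd]; simpa using this
  have hX : ∀ n, ∀ τ ∈ Icc s t, S.a τ < S.a τ + d n ∧ S.a τ + d n ≤ S.b τ - d n ∧ S.b τ - d n < S.b τ := fun n τ hτ => by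
    have := (hb τ hτ).1
    have := d0 n
    have := d1 n
    refine ⟨by linarith, by linarith, by linarith⟩
  have iX : ∀ n, ∀ τ ∈ Icc s t, S.a τ + d n ∈ Icc (S.a τ) (S.b τ) := fun n τ hτ => by
    obtain ⟨a, b, c⟩ := hX n τ hτ; exact ⟨a.le, b.trans c.le⟩
  have iY : ∀ n, ∀ τ ∈ Icc s t, S.b τ - d n ∈ Icc (S.a τ) (S.b τ) := fun n τ hτ => by
    obtain ⟨a, b, c⟩ := hX n τ hτ; exact ⟨a.le.trans b, c.le⟩
  have lX : ∀ τ, Tendsto (fun n => S.a τ + d n) atTop (𝓝 (S.a τ)) := fun τ => by simpa using dl.const_add (S.a τ)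
  have lY : ∀ τ, Tendsto (fun n => S.b τ - d n) atTop (𝓝 (S.b τ)) := fun τ => by simpa using dl.const_sub (S.b τ)
  have key : ∀ n, IntervalIntegrable (fun τ => F (S.b' τ) τ (S.b τ - d n) - F (S.a' τ) τ (S.a τ + d n)) volume s t ∧
      (∫ y in (S.a t + d n)..(S.b t - d n), S.ρ t y * S.v t y) - (∫ y in (S.a s + d n)..(S.b s - d n), S.ρ s y * S.v s y) =
      ∫ τ in s..t, (F (S.b' τ) τ (S.b τ - d n) - F (S.a' τ) τ (S.a τ + d n)) := by
    intro n
    have hLX : ∀ τ ∈ Icc s t, ∀ τ' ∈ Icc s t, |(S.a τ + d n) - (S.a τ' + d n)| ≤ V * |τ - τ'| := fun τ h τ' h' => by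
      rw [add_sub_add_right_eq_sub]; exact LA τ h τ' h'
    have hLY : ∀ τ ∈ Icc s t, ∀ τ' ∈ Icc s t, |(S.b τ - d n) - (S.b τ' - d n)| ≤ V * |τ - τ'| := fun τ h τ' h' => by
      rw [sub_sub_sub_cancel_right]; exact LB τ h τ' h'
    refine tm_G S s t V hs hst lb (fun τ => S.a τ + d n) (fun τ => S.b τ - d n) hLX hLY hV.le (hX n)
      (fun τ => ∫ y in (S.a τ + d n)..(S.b τ - d n), S.ρ τ y * S.v τ y) _ ?_
    intro T0 T1 X0 X1 N Z0 Z1 s1 t1 R a1 a2 a3 a4 a5 a6 sub bX bY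
    have sb : ∀ τ ∈ Ioo s1 t1, 0 < τ := fun τ h => pos τ (sub ⟨h.1.le, h.2.le⟩)
    exact tm_R1 hl R a1 a2 a3 s1 t1 V a4 a5 a6 hV.le (fun τ => S.a τ + d n) S.a' (fun τ => S.b τ - d n) S.b'
      (fun τ h τ' h' => hLX τ (sub h) τ' (sub h')) bX (fun τ h => (tm_ad S (sb τ h)).1.add_const _)
      (fun τ h τ' h' => hLY τ (sub h) τ' (sub h')) bY (fun τ h => (tm_ad S (sb τ h)).2.sub_const _) _ rfl
  have lk : ∀ τ ∈ Icc s t, Tendsto (fun n => F (S.b' τ) τ (S.b τ - d n) - F (S.a' τ) τ (S.a τ + d n)) atTop (𝓝 (-(S.a'' τ + S.b'' τ))) := by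
    intro τ hτ
    have e : -(S.a'' τ + S.b'' τ) = F (S.b' τ) τ (S.b τ) - F (S.a' τ) τ (S.a τ) := by
      simp only [hF]
      rw [S.newton_a τ (pos τ hτ), S.newton_b τ (pos τ hτ), hu τ (pos τ hτ), S.bc_a τ (pos τ hτ).le, S.bc_b τ (pos τ hτ).le]
      ring
    rw [e]
    refine Tendsto.sub ?_ ?_
    · exact (cF τ hτ _ _ (iB τ hτ)).tendsto.comp (tendsto_nhdsWithin_iff.2 ⟨lY τ, .of_forall fun n => iY n τ hτ⟩)
    · exact (cF τ hτ _ _ (iA τ hτ)).tendsto.comp (tendsto_nhdsWithin_iff.2 ⟨lX τ, .of_forall fun n => iX n τ hτ⟩)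
  have uI : ∀ τ ∈ uIoc s t, τ ∈ Icc s t := fun τ h => by rw [uIoc_of_le hst] at h; exact ⟨h.1.le, h.2⟩
  have bk : ∀ n, ∀ τ ∈ Icc s t, |F (S.b' τ) τ (S.b τ - d n) - F (S.a' τ) τ (S.a τ + d n)| ≤ 2 * (C1 * N + C2 + r1 * V ^ 2 + r1 * V * V) :=
    fun n τ hτ => by
    have := bF τ hτ _ (iY n τ hτ) _ (bB τ hτ)
    have := bF τ hτ _ (iX n τ hτ) _ (bA τ hτ)
    exact (abs_sub _ _).trans (by linarith)
  have L1 := intervalIntegral.tendsto_integral_filter_of_dominated_convergence (μ := volume) (a := s) (b := t)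
    (F := fun (n : ℕ) τ => F (S.b' τ) τ (S.b τ - d n) - F (S.a' τ) τ (S.a τ + d n)) (l := atTop) (f := fun τ => -(S.a'' τ + S.b'' τ))
    (fun _ => 2 * (C1 * N + C2 + r1 * V ^ 2 + r1 * V * V)) (.of_forall fun n => by
      rw [uIoc_of_le hst]; exact (key n).1.1.aestronglyMeasurable)
    (.of_forall fun n => .of_forall fun τ hτ => bk n τ (uI τ hτ)) intervalIntegrable_const (.of_forall fun τ hτ => lk τ (uI τ hτ))
  have Q : ∀ τ ∈ Icc s t, Tendsto (fun n => ∫ y in (S.a τ + d n)..(S.b τ - d n), S.ρ τ y * S.v τ y) atTop (𝓝 (∫ y in S.a τ..S.b τ, S.ρ τ y * S.v τ y)) :=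
    fun τ hτ => tm_icv _ _ _ (S.hab τ (pos τ hτ).le).le ((cρ τ hτ).mul (cv τ hτ)) _ _ (fun n => iX n τ hτ) (fun n => iY n τ hτ) (lX τ) (lY τ)
  have L2 := (Q t ⟨hst, le_rfl⟩).sub (Q s ⟨le_rfl, hst⟩)
  simp only [fun n => (key n).2] at L2
  have E := tendsto_nhds_unique L2 L1
  have II : IntervalIntegrable (fun τ => S.a'' τ + S.b'' τ) volume s t := by
    rw [intervalIntegrable_iff_integrableOn_Ioc_of_le hst]
    have me : AEStronglyMeasurable (fun τ => -(S.a'' τ + S.b'' τ)) (volume.restrict (Ioc s t)) :=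
      aestronglyMeasurable_of_tendsto_ae atTop (fun n => (key n).1.1.aestronglyMeasurable)
        ((ae_restrict_iff' measurableSet_Ioc).2 (.of_forall fun τ hτ => lk τ ⟨hτ.1.le, hτ.2⟩))
    have i1 : IntegrableOn (fun τ => -(S.a'' τ + S.b'' τ)) (Ioc s t) volume := by
      refine Integrable.mono' (integrable_const (2 * (C1 * N + C2 + r1 * V ^ 2 + r1 * V * V))) me ?_
      refine (ae_restrict_iff' measurableSet_Ioc).2 (.of_forall fun τ hτ => ?_)
      exact le_of_tendsto ((lk τ ⟨hτ.1.le, hτ.2⟩).abs) (.of_forall fun n => bk n τ ⟨hτ.1.le, hτ.2⟩)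
    have := i1.neg
    refine this.congr (.of_forall fun τ => ?_)
    simp
  have FT := intervalIntegral.integral_eq_sub_of_hasDerivAt (f := fun τ => S.a' τ + S.b' τ) (f' := fun τ => S.a'' τ + S.b'' τ) (a := s) (b := t)
    (fun τ hτ => by
      rw [uIcc_of_le hst] at hτ
      exact (S.ha'' τ (pos τ hτ)).add (S.hb'' τ (pos τ hτ))) II
  rw [intervalIntegral.integral_neg, FT] at E
  linarith
end

/-- **Conservation of total momentum for the open-loop system.**  Along every
classical solution of the two-piston system with zero input `u ≡ 0`, the total
momentum `R(t) = a'(t) + b'(t) + ∫_{a(t)}^{b(t)} ρ(t,x) v(t,x) dx` satisfies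
`dR/dt = 0` for all `t > 0`. -/
theorem total_momentum_constant_open_loop
    (P μ : ℝ → ℝ) (Pext : ℝ)
    (hP : ContDiffOn ℝ 2 P (Ioi 0)) (hμ : ContDiffOn ℝ 2 μ (Ioi 0))
    (hPpos : ∀ x, 0 < x → 0 < P x) (hμpos : ∀ x, 0 < x → 0 < μ x)
    (hPmono : StrictMonoOn P (Ioi 0))
    (hPrange : P '' Ioi 0 = Ioi 0)
    (hPext : 0 < Pext)
    (sol : PistonSol P μ Pext)
    (hu : ∀ t, 0 ≤ t → sol.u t = 0) :
    ∀ t, 0 < t →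
      HasDerivAt
        (fun s => sol.a' s + sol.b' s + ∫ x in sol.a s..sol.b s, sol.ρ s x * sol.v s x)
        0 t := by
  have hl := tm_law hP hμ hμpos
  have hu' : ∀ t, 0 < t → sol.u t = 0 := fun t h => hu t h.le
  intro t ht
  refine (hasDerivAt_const t (sol.a' t + sol.b' t + ∫ x in sol.a t..sol.b t, sol.ρ t x * sol.v t x)).congr_of_eventuallyEq ?_
  filter_upwards [eventually_gt_nhds ht] with s hs
  rcases le_total s t with h | h
  · exact tm_fin hl sol hu' s t hs h
  · exact (tm_fin hl sol hu' t s ht h).symm
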